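/- arXiv:2511.20805 — 2 statements merged into one kernel-verified Lean document; each statement's English description precedes it below -/
import Mathlib

section
/- Let g ≥ 12 be an integer. Then the maximum of g + r(P) − 3 − c(P), taken over all maximal lattice polygons P with exactly g interior lattice points and expected gonality egon(P) = 5, equals ⌊3g/2⌋ + 6; that is, some such P attains this value and every such P satisfies g + r(P) − 3 − c(P) ≤ ⌊3g/2⌋ + 6. (Note ⌊3g/2⌋ + 6 = ⌊U(g, 5)⌋ − 1 where U(g, d) = g + 2g/(d − 1) + 2d − 3.) -/
open Set

noncomputable section

/-- Embedding of the integer lattice `ℤ × ℤ` into the real plane. -/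
def latticeEmbed (p : ℤ × ℤ) : ℝ × ℝ := ((p.1 : ℝ), (p.2 : ℝ))

/-- A lattice polygon: the convex hull of a nonempty finite set of lattice points. -/
def IsLatticePolygon (P : Set (ℝ × ℝ)) : Prop :=
  ∃ S : Finset (ℤ × ℤ), S.Nonempty ∧
    P = convexHull ℝ (latticeEmbed '' (S : Set (ℤ × ℤ)))

/-- The interior lattice points of a set in the plane. -/
def interiorLatticePoints (P : Set (ℝ × ℝ)) : Set (ℤ × ℤ) :=
  {p : ℤ × ℤ | latticeEmbed p ∈ interior P}

/-- The genus of a lattice polygon: the number of interior lattice points. -/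
def polygonGenus (P : Set (ℝ × ℝ)) : ℕ := (interiorLatticePoints P).ncard

/-- The number of lattice points on the boundary. -/
def boundaryLatticeCount (P : Set (ℝ × ℝ)) : ℕ :=
  {p : ℤ × ℤ | latticeEmbed p ∈ frontier P}.ncard

/-- A subset of the plane is two-dimensional if it has nonempty interior. -/
def TwoDimensional (P : Set (ℝ × ℝ)) : Prop := (interior P).Nonempty

/-- A `ℤ`-affine transformation of the plane: `p ↦ A p + b` with `A ∈ GL₂(ℤ)`, `b ∈ ℤ²`. -/
def IsZAffine (φ : ℝ × ℝ → ℝ × ℝ) : Prop :=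
  ∃ a b c d e f : ℤ, (a * d - b * c = 1 ∨ a * d - b * c = -1) ∧
    ∀ p : ℝ × ℝ,
      φ p = ((a : ℝ) * p.1 + (b : ℝ) * p.2 + (e : ℝ),
             (c : ℝ) * p.1 + (d : ℝ) * p.2 + (f : ℝ))

/-- The horizontal strip `ℝ × [0, s]`. -/
def strip (s : ℝ) : Set (ℝ × ℝ) := {q : ℝ × ℝ | 0 ≤ q.2 ∧ q.2 ≤ s}

/-- `LatticeWidthIs P d` : `d` is the smallest positive integer `s` such that some
`ℤ`-affine transformation maps `P` into the strip `ℝ × [0, s]`. -/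
def LatticeWidthIs (P : Set (ℝ × ℝ)) (d : ℕ) : Prop :=
  IsLeast {s : ℕ | 0 < s ∧ ∃ φ, IsZAffine φ ∧ φ '' P ⊆ strip (s : ℝ)} d

/-- An edge of a polygon: an exposed face of dimension one. -/
def IsEdge (P τ : Set (ℝ × ℝ)) : Prop :=
  IsExposed ℝ P τ ∧ Module.finrank ℝ (vectorSpan ℝ τ) = 1

/-- A column vector of a polygon `P`: a nonzero integer vector `v` such that for some
edge `τ` of `P`, translating all lattice points of `P` off `τ` by `v` stays in `P`. -/
def IsColumnVector (P : Set (ℝ × ℝ)) (v : ℤ × ℤ) : Prop :=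
  v ≠ 0 ∧ ∃ τ : Set (ℝ × ℝ), IsEdge P τ ∧
    ∀ p : ℤ × ℤ, latticeEmbed p ∈ P \ τ → latticeEmbed (p + v) ∈ P

/-- The number of column vectors of `P`. -/
def columnVectorCount (P : Set (ℝ × ℝ)) : ℕ :=
  {v : ℤ × ℤ | IsColumnVector P v}.ncard

/-- A lattice polygon is maximal if no lattice polygon strictly containing it has the
same set of interior lattice points. -/
def IsMaximalPolygon (P : Set (ℝ × ℝ)) : Prop :=
  IsLatticePolygon P ∧
    ∀ Q : Set (ℝ × ℝ), IsLatticePolygon Q → P ⊆ Q →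
      interiorLatticePoints Q = interiorLatticePoints P → Q = P

/-- The interior polygon: the convex hull of the interior lattice points. -/
def interiorPolygon (P : Set (ℝ × ℝ)) : Set (ℝ × ℝ) :=
  convexHull ℝ (latticeEmbed '' interiorLatticePoints P)

/-- A lattice polygon is non-hyperelliptic if its interior polygon is two-dimensional. -/
def NonHyperelliptic (P : Set (ℝ × ℝ)) : Prop := TwoDimensional (interiorPolygon P)

/-- Two polygons are equivalent if one is the image of the other under a
`ℤ`-affine transformation. -/
def EquivPolygon (P Q : Set (ℝ × ℝ)) : Prop := ∃ φ, IsZAffine φ ∧ φ '' P = Q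

/-- The triangle `2Υ = conv{(−2,−2),(2,0),(0,2)}`. -/
def twoUpsilon : Set (ℝ × ℝ) :=
  convexHull ℝ {((-2 : ℝ), (-2 : ℝ)), ((2 : ℝ), (0 : ℝ)), ((0 : ℝ), (2 : ℝ))}

/-- `ExpectedGonalityIs P d` : the expected gonality of `P` is `d`, i.e.
`d = lw(P⁽¹⁾) + 2`, except that polygons equivalent to `2Υ` have expected gonality `3`. -/
def ExpectedGonalityIs (P : Set (ℝ × ℝ)) (d : ℕ) : Prop :=
  (EquivPolygon P twoUpsilon ∧ d = 3) ∨
  (¬ EquivPolygon P twoUpsilon ∧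
    ∃ w : ℕ, LatticeWidthIs (interiorPolygon P) w ∧ d = w + 2)

/-- `Q` contains a crystal of length `d`: a `(d+1) × (d−1)` grid of interior lattice
points occupying columns `x₀, …, x₀ + d` and rows `1, …, d − 1`. -/
def ContainsCrystal (Q : Set (ℝ × ℝ)) (d : ℕ) : Prop :=
  ∃ x₀ : ℤ, ∀ i j : ℤ, 0 ≤ i → i ≤ (d : ℤ) → 1 ≤ j → j ≤ (d : ℤ) - 1 →
    (x₀ + i, j) ∈ interiorLatticePoints Q

/-- The shear transformation `(x, y) ↦ (x + ℓ y, y)`. -/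
def shearMap (ℓ : ℤ) : ℝ × ℝ → ℝ × ℝ := fun q => (q.1 + (ℓ : ℝ) * q.2, q.2)

end

lemma zaff_inv {φ : ℝ × ℝ → ℝ × ℝ} (h : IsZAffine φ) :
    ∃ ψ, IsZAffine ψ ∧ (∀ p, ψ (φ p) = p) ∧ (∀ p, φ (ψ p) = p) := by
  obtain ⟨a, b, c, d, e, f, hdet, hφ⟩ := h
  rcases hdet with hdet | hdet
  · have hd : (a : ℝ) * d - b * c = 1 := by exact_mod_cast hdet
    refine ⟨fun p => (((d : ℤ) : ℝ) * p.1 + ((-b : ℤ) : ℝ) * p.2 + ((b * f - d * e : ℤ) : ℝ),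
      ((-c : ℤ) : ℝ) * p.1 + ((a : ℤ) : ℝ) * p.2 + ((c * e - a * f : ℤ) : ℝ)),
      ⟨d, -b, -c, a, b * f - d * e, c * e - a * f, Or.inl (by linarith), fun p => rfl⟩, ?_, ?_⟩
    · intro p
      rw [hφ]
      ext
      · push_cast; linear_combination p.1 * hd
      · push_cast; linear_combination p.2 * hd
    · intro p
      rw [hφ]
      ext
      · push_cast; linear_combination (p.1 - e) * hd
      · push_cast; linear_combination (p.2 - f) * hd
  · have hd : (a : ℝ) * d - b * c = -1 := by exact_mod_cast hdet
    refine ⟨fun p => (((-d : ℤ) : ℝ) * p.1 + ((b : ℤ) : ℝ) * p.2 + ((-(b * f - d * e) : ℤ) : ℝ),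
      ((c : ℤ) : ℝ) * p.1 + ((-a : ℤ) : ℝ) * p.2 + ((-(c * e - a * f) : ℤ) : ℝ)),
      ⟨-d, b, c, -a, -(b * f - d * e), -(c * e - a * f), Or.inr (by linarith), fun p => rfl⟩, ?_, ?_⟩
    · intro p
      rw [hφ]
      ext
      · push_cast; linear_combination -p.1 * hd
      · push_cast; linear_combination -p.2 * hd
    · intro p
      rw [hφ]
      ext
      · push_cast; linear_combination -(p.1 - e) * hd
      · push_cast; linear_combination -(p.2 - f) * hd

lemma zaff_cont {φ : ℝ × ℝ → ℝ × ℝ} (h : IsZAffine φ) : Continuous φ := by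
  obtain ⟨a, b, c, d, e, f, hdet, hφ⟩ := h
  have : φ = fun p => ((a : ℝ) * p.1 + (b : ℝ) * p.2 + (e : ℝ),
             (c : ℝ) * p.1 + (d : ℝ) * p.2 + (f : ℝ)) := funext hφ
  rw [this]; fun_prop

lemma zaff_homeo {φ : ℝ × ℝ → ℝ × ℝ} (h : IsZAffine φ) :
    ∃ H : (ℝ × ℝ) ≃ₜ (ℝ × ℝ), ⇑H = φ := by
  obtain ⟨ψ, hψ, h1, h2⟩ := zaff_inv h
  exact ⟨⟨⟨φ, ψ, h1, h2⟩, zaff_cont h, zaff_cont hψ⟩, rfl⟩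

lemma zaff_interior {φ : ℝ × ℝ → ℝ × ℝ} (h : IsZAffine φ) (P : Set (ℝ × ℝ)) :
    interior (φ '' P) = φ '' interior P := by
  obtain ⟨H, rfl⟩ := zaff_homeo h
  exact (H.image_interior P).symm

lemma zaff_frontier {φ : ℝ × ℝ → ℝ × ℝ} (h : IsZAffine φ) (P : Set (ℝ × ℝ)) :
    frontier (φ '' P) = φ '' frontier P := by
  obtain ⟨H, rfl⟩ := zaff_homeo h
  exact (H.image_frontier P).symm

lemma zaff_inj {φ : ℝ × ℝ → ℝ × ℝ} (h : IsZAffine φ) : Function.Injective φ := by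
  obtain ⟨H, rfl⟩ := zaff_homeo h
  exact H.injective

lemma embed_inj : Function.Injective latticeEmbed := by
  intro p q h
  simp only [latticeEmbed, Prod.mk.injEq, Int.cast_inj] at h
  exact Prod.ext h.1 h.2

/-- integer action with linear part -/
lemma zaff_int {φ : ℝ × ℝ → ℝ × ℝ} (h : IsZAffine φ) :
    ∃ E A : ℤ × ℤ → ℤ × ℤ, (∀ p, φ (latticeEmbed p) = latticeEmbed (E p)) ∧
      (∀ p v, E (p + v) = E p + A v) ∧ Function.Bijective E ∧ Function.Injective A ∧ A 0 = 0 := by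
  have key : ∀ {φ : ℝ × ℝ → ℝ × ℝ} (h : IsZAffine φ), ∃ E A : ℤ × ℤ → ℤ × ℤ,
      (∀ p, φ (latticeEmbed p) = latticeEmbed (E p)) ∧
      (∀ p v, E (p + v) = E p + A v) := by
    intro φ h
    obtain ⟨a, b, c, d, e, f, hdet, hφ⟩ := h
    refine ⟨fun p => (a * p.1 + b * p.2 + e, c * p.1 + d * p.2 + f),
      fun p => (a * p.1 + b * p.2, c * p.1 + d * p.2), ?_, ?_⟩
    · intro p; rw [hφ]; simp [latticeEmbed]
    · intro p v; ext <;> simp <;> ring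
  obtain ⟨ψ, hψ, h1, h2⟩ := zaff_inv h
  obtain ⟨E, A, hE, hA⟩ := key h
  obtain ⟨E', A', hE', hA'⟩ := key hψ
  have l : ∀ p, E' (E p) = p := fun p => embed_inj (by rw [← hE', ← hE, h1])
  have r : ∀ p, E (E' p) = p := fun p => embed_inj (by rw [← hE, ← hE', h2])
  have hEi : Function.Injective E := Function.LeftInverse.injective l
  refine ⟨E, A, hE, hA, ⟨hEi, Function.RightInverse.surjective r⟩, ?_, ?_⟩
  · intro v w hvw
    have : E (0 + v) = E (0 + w) := by rw [hA, hA, hvw]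
    simpa using hEi this
  · have := hA 0 0
    simpa using this

lemma zaff_hull {φ : ℝ × ℝ → ℝ × ℝ} (h : IsZAffine φ) (s : Set (ℝ × ℝ)) :
    φ '' convexHull ℝ s = convexHull ℝ (φ '' s) := by
  obtain ⟨a, b, c, d, e, f, hdet, hφ⟩ := h
  let F : (ℝ × ℝ) →ₗ[ℝ] (ℝ × ℝ) :=
    { toFun := fun p => ((a : ℝ) * p.1 + (b : ℝ) * p.2, (c : ℝ) * p.1 + (d : ℝ) * p.2)
      map_add' := by intro x y; ext <;> simp <;> ring
      map_smul' := by intro r x; ext <;> simp <;> ring }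
  let G : (ℝ × ℝ) →ᵃ[ℝ] (ℝ × ℝ) := F.toAffineMap + AffineMap.const ℝ (ℝ × ℝ) ((e : ℝ), (f : ℝ))
  have : φ = G := by
    funext p; rw [hφ]; simp [G, F]
  rw [this]
  exact G.image_convexHull s

lemma zaff_latpoly {φ : ℝ × ℝ → ℝ × ℝ} (h : IsZAffine φ) {P : Set (ℝ × ℝ)}
    (hP : IsLatticePolygon P) : IsLatticePolygon (φ '' P) := by
  classical
  obtain ⟨S, hS, rfl⟩ := hP
  obtain ⟨E, A, hE, -⟩ := zaff_int h
  refine ⟨S.image E, hS.image E, ?_⟩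
  rw [zaff_hull h, Finset.coe_image, image_image, image_image]
  simp only [hE]

lemma zaff_ilp {φ : ℝ × ℝ → ℝ × ℝ} (h : IsZAffine φ) (P : Set (ℝ × ℝ)) {E : ℤ × ℤ → ℤ × ℤ}
    (hE : ∀ p, φ (latticeEmbed p) = latticeEmbed (E p)) (p : ℤ × ℤ) :
    E p ∈ interiorLatticePoints (φ '' P) ↔ p ∈ interiorLatticePoints P := by
  simp only [interiorLatticePoints, mem_ofPred_eq]
  rw [zaff_interior h, ← hE]
  exact (zaff_inj h).mem_set_image

lemma ncard_eq_of_bij {E : ℤ × ℤ → ℤ × ℤ} (hE : Function.Bijective E) {s t : Set (ℤ × ℤ)}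
    (h : ∀ p, E p ∈ t ↔ p ∈ s) : t.ncard = s.ncard := by
  have : t = E '' s := by
    ext q
    obtain ⟨p, rfl⟩ := hE.2 q
    rw [h, hE.1.mem_set_image]
  rw [this, ncard_image_of_injective _ hE.1]

lemma zaff_genus {φ : ℝ × ℝ → ℝ × ℝ} (h : IsZAffine φ) (P : Set (ℝ × ℝ)) :
    polygonGenus (φ '' P) = polygonGenus P := by
  obtain ⟨E, A, hE, -, hb, -⟩ := zaff_int h
  exact ncard_eq_of_bij hb (zaff_ilp h P hE)

lemma zaff_bdry {φ : ℝ × ℝ → ℝ × ℝ} (h : IsZAffine φ) (P : Set (ℝ × ℝ)) :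
    boundaryLatticeCount (φ '' P) = boundaryLatticeCount P := by
  obtain ⟨E, A, hE, -, hb, -⟩ := zaff_int h
  refine ncard_eq_of_bij hb ?_
  intro p
  simp only [mem_ofPred_eq]
  rw [zaff_frontier h, ← hE]
  exact (zaff_inj h).mem_set_image

lemma inv_image {φ ψ : ℝ × ℝ → ℝ × ℝ} (h1 : ∀ p, ψ (φ p) = p) (P : Set (ℝ × ℝ)) :
    ψ '' (φ '' P) = P := by
  rw [image_image]; simp [h1]

lemma zaff_max {φ : ℝ × ℝ → ℝ × ℝ} (h : IsZAffine φ) {P : Set (ℝ × ℝ)}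
    (hP : IsMaximalPolygon P) : IsMaximalPolygon (φ '' P) := by
  refine ⟨zaff_latpoly h hP.1, ?_⟩
  intro Q hQ hPQ hI
  obtain ⟨ψ, hψ, h1, h2⟩ := zaff_inv h
  have hQ' : ψ '' Q = P := by
    apply hP.2 _ (zaff_latpoly hψ hQ)
    · have := image_mono (f := ψ) hPQ
      rwa [inv_image h1] at this
    · obtain ⟨E, A, hE, -, hb, -⟩ := zaff_int hψ
      ext q
      obtain ⟨p, rfl⟩ := hb.2 q
      rw [zaff_ilp hψ Q hE, hI, ← zaff_ilp hψ _ hE, inv_image h1]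
  rw [← hQ', inv_image h2]

lemma dual_form (l : StrongDual ℝ (ℝ × ℝ)) : ∃ α β : ℝ, ∀ z : ℝ × ℝ, l z = α * z.1 + β * z.2 := by
  refine ⟨l (1, 0), l (0, 1), fun z => ?_⟩
  have : z = z.1 • ((1 : ℝ), (0 : ℝ)) + z.2 • ((0 : ℝ), (1 : ℝ)) := by ext <;> simp
  conv_lhs => rw [this]
  rw [map_add, map_smul, map_smul]
  simp; ring

/-- edge data -/
def EdgeData (P τ : Set (ℝ × ℝ)) : Prop :=
  ∃ α β m : ℝ, (α ≠ 0 ∨ β ≠ 0) ∧ (∀ z ∈ P, α * z.1 + β * z.2 ≤ m) ∧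
    (∀ z, z ∈ τ ↔ z ∈ P ∧ α * z.1 + β * z.2 = m) ∧ ∃ a ∈ τ, ∃ b ∈ τ, a ≠ b

lemma edge_of_data {P τ : Set (ℝ × ℝ)} (h : EdgeData P τ) : IsEdge P τ := by
  obtain ⟨α, β, m, h0, hle, hτ, a, ha, b, hb, hab⟩ := h
  have ha' := (hτ a).1 ha
  have hb' := (hτ b).1 hb
  refine ⟨?_, ?_⟩
  · intro _
    refine ⟨α • ContinuousLinearMap.fst ℝ ℝ ℝ + β • ContinuousLinearMap.snd ℝ ℝ ℝ, ?_⟩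
    ext z
    simp only [mem_ofPred_eq]
    rw [hτ]
    constructor
    · rintro ⟨h1, h2⟩
      refine ⟨h1, fun y hy => ?_⟩
      have := hle y hy
      simp; linarith
    · rintro ⟨h1, h2⟩
      refine ⟨h1, le_antisymm (hle z h1) ?_⟩
      have := h2 a ha'.1
      simp at this; linarith
  · have hspan : vectorSpan ℝ τ = Submodule.span ℝ {b - a} := by
      apply le_antisymm
      · rw [vectorSpan_def, Submodule.span_le]
        rintro _ ⟨x, hx, y, hy, rfl⟩
        have hx' := (hτ x).1 hx
        have hy' := (hτ y).1 hy
        simp only [vsub_eq_sub, SetLike.mem_coe]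
        rw [Submodule.mem_span_singleton]
        have e1 : α * (b.1 - a.1) + β * (b.2 - a.2) = 0 := by linarith [ha'.2, hb'.2]
        have e2 : α * (x.1 - y.1) + β * (x.2 - y.2) = 0 := by linarith [hx'.2, hy'.2]
        have e3 : (b.1 - a.1) * (x.2 - y.2) = (b.2 - a.2) * (x.1 - y.1) := by
          rcases h0 with h0 | h0
          · apply mul_left_cancel₀ h0
            linear_combination (x.2 - y.2) * e1 - (b.2 - a.2) * e2
          · apply mul_left_cancel₀ h0
            linear_combination -(x.1 - y.1) * e1 + (b.1 - a.1) * e2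
        by_cases hb1 : b.1 - a.1 = 0
        · have hb2 : b.2 - a.2 ≠ 0 := by
            intro hb2
            exact hab (Prod.ext (by linarith) (by linarith))
          refine ⟨(x.2 - y.2) / (b.2 - a.2), ?_⟩
          ext
          · simp only [Prod.smul_fst, Prod.fst_sub, smul_eq_mul]
            rw [hb1] at e3 ⊢
            have : x.1 - y.1 = 0 := by
              rcases mul_eq_zero.1 (by linarith : (b.2 - a.2) * (x.1 - y.1) = 0) with h | h
              · exact absurd h hb2
              · exact h
            simp [this]
          · simp only [Prod.smul_snd, Prod.snd_sub, smul_eq_mul]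
            field_simp
        · refine ⟨(x.1 - y.1) / (b.1 - a.1), ?_⟩
          ext
          · simp only [Prod.smul_fst, Prod.fst_sub, smul_eq_mul]
            field_simp
          · simp only [Prod.smul_snd, Prod.snd_sub, smul_eq_mul]
            field_simp
            linarith
      · rw [Submodule.span_singleton_le_iff_mem]
        exact vsub_mem_vectorSpan ℝ hb ha
    rw [hspan, finrank_span_singleton (sub_ne_zero.2 (Ne.symm hab))]

lemma data_of_edge {P τ : Set (ℝ × ℝ)} (hP : (interior P).Nonempty) (h : IsEdge P τ) :
    EdgeData P τ := by
  obtain ⟨hexp, hfin⟩ := h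
  have hnt : τ.Nontrivial := by
    by_contra hc
    rw [not_nontrivial_iff] at hc
    rw [(vectorSpan_eq_bot_iff_subsingleton ℝ).2 hc] at hfin
    simp at hfin
  obtain ⟨a, ha, b, hb, hab⟩ := hnt
  obtain ⟨l, hl⟩ := hexp ⟨a, ha⟩
  obtain ⟨α, β, hf⟩ := dual_form l
  have hmem : ∀ z, z ∈ τ ↔ z ∈ P ∧ ∀ y ∈ P, α * y.1 + β * y.2 ≤ α * z.1 + β * z.2 := by
    intro z; rw [hl]; simp only [hf, mem_ofPred_eq]
  have ha' := (hmem a).1 ha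
  refine ⟨α, β, α * a.1 + β * a.2, ?_, ha'.2, ?_, a, ha, b, hb, hab⟩
  · by_contra hc
    push Not at hc
    have hτP : τ = P := by
      ext z; rw [hmem]; simp [hc.1, hc.2]
    rw [hτP] at hfin
    have h1 : vectorSpan ℝ P = ⊤ := by
      obtain ⟨x, hx⟩ := hP
      have h2 := isOpen_interior.affineSpan_eq_top (⟨x, hx⟩ : (interior P).Nonempty)
      have h3 : affineSpan ℝ P = ⊤ := by
        rw [eq_top_iff, ← h2]; exact affineSpan_mono ℝ interior_subset
      rw [← direction_affineSpan, h3, AffineSubspace.direction_top]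
    rw [h1, finrank_top] at hfin
    simp at hfin
  · intro z
    rw [hmem]
    constructor
    · rintro ⟨h1, h2⟩
      exact ⟨h1, le_antisymm (ha'.2 z h1) (h2 a ha'.1)⟩
    · rintro ⟨h1, h2⟩
      exact ⟨h1, fun y hy => h2 ▸ ha'.2 y hy⟩

lemma zaff_edgedata {φ : ℝ × ℝ → ℝ × ℝ} (h : IsZAffine φ) {P τ : Set (ℝ × ℝ)}
    (hτ : EdgeData P τ) : EdgeData (φ '' P) (φ '' τ) := by
  obtain ⟨ψ, hψ, h1, h2⟩ := zaff_inv h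
  obtain ⟨a, b, c, d, e, f, hdet, hψf⟩ := hψ
  obtain ⟨α, β, m, h0, hle, hτ, x, hx, y, hy, hxy⟩ := hτ
  have hdet' : (a * d - b * c : ℝ) ≠ 0 := by
    have : a * d - b * c ≠ 0 := by rcases hdet with h | h <;> rw [h] <;> norm_num
    exact_mod_cast this
  have hval : ∀ p : ℝ × ℝ, (α * a + β * c) * (φ p).1 + (α * b + β * d) * (φ p).2 =
      α * p.1 + β * p.2 - (α * e + β * f) := by
    intro p
    have := h1 p
    rw [hψf] at this
    have t1 := congrArg Prod.fst this
    have t2 := congrArg Prod.snd this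
    simp only at t1 t2
    linear_combination α * t1 + β * t2
  refine ⟨α * a + β * c, α * b + β * d, m - (α * e + β * f), ?_, ?_, ?_,
    φ x, mem_image_of_mem _ hx, φ y, mem_image_of_mem _ hy, (zaff_inj h).ne hxy⟩
  · by_contra hc
    push Not at hc
    have e1 : α * (a * d - b * c : ℝ) = 0 := by linear_combination d * hc.1 - c * hc.2
    have e2 : β * (a * d - b * c : ℝ) = 0 := by linear_combination a * hc.2 - b * hc.1
    rcases h0 with h0 | h0
    · exact (mul_ne_zero h0 hdet') e1
    · exact (mul_ne_zero h0 hdet') e2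
  · rintro _ ⟨z, hz, rfl⟩
    rw [hval]; linarith [hle z hz]
  · intro q
    obtain ⟨z, rfl⟩ : ∃ z, φ z = q := ⟨ψ q, h2 q⟩
    rw [(zaff_inj h).mem_set_image, (zaff_inj h).mem_set_image, hτ, hval]
    constructor
    · rintro ⟨t1, t2⟩; exact ⟨t1, by linarith⟩
    · rintro ⟨t1, t2⟩; exact ⟨t1, by linarith⟩

lemma latpts_finite {P : Set (ℝ × ℝ)} (hP : IsCompact P) :
    {p : ℤ × ℤ | latticeEmbed p ∈ P}.Finite := by
  obtain ⟨M, hM⟩ := hP.isBounded.exists_norm_le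
  refine (((Set.finite_Icc (-⌈M⌉) ⌈M⌉)).prod ((Set.finite_Icc (-⌈M⌉) ⌈M⌉))).subset ?_
  intro p hp
  have := hM _ hp
  rw [Prod.norm_def] at this
  have h1 := (le_max_left _ _).trans this
  have h2 := (le_max_right _ _).trans this
  simp only [latticeEmbed, Real.norm_eq_abs, abs_le] at h1 h2
  have hc := Int.le_ceil M
  simp only [mem_prod, mem_Icc]
  refine ⟨⟨?_, ?_⟩, ⟨?_, ?_⟩⟩
  · have : (-⌈M⌉ : ℝ) ≤ p.1 := by linarith [h1.1]
    exact_mod_cast this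
  · have : (p.1 : ℝ) ≤ ⌈M⌉ := by linarith [h1.2]
    exact_mod_cast this
  · have : (-⌈M⌉ : ℝ) ≤ p.2 := by linarith [h2.1]
    exact_mod_cast this
  · have : (p.2 : ℝ) ≤ ⌈M⌉ := by linarith [h2.2]
    exact_mod_cast this

lemma latpoly_compact {P : Set (ℝ × ℝ)} (hP : IsLatticePolygon P) : IsCompact P := by
  obtain ⟨S, hS, rfl⟩ := hP
  exact (S.finite_toSet.image _).isCompact_convexHull ℝ

lemma latpoly_convex {P : Set (ℝ × ℝ)} (hP : IsLatticePolygon P) : Convex ℝ P := by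
  obtain ⟨S, hS, rfl⟩ := hP
  exact convex_convexHull _ _

/-- strict positivity: interior points satisfy linear inequalities strictly -/
lemma interior_strict {P : Set (ℝ × ℝ)} {α β m : ℝ} (h0 : α ≠ 0 ∨ β ≠ 0)
    (hle : ∀ z ∈ P, α * z.1 + β * z.2 ≤ m) {z : ℝ × ℝ} (hz : z ∈ interior P) :
    α * z.1 + β * z.2 < m := by
  by_contra hc
  push Not at hc
  have hcont : Filter.Tendsto (fun ε : ℝ => (z.1 + ε * α, z.2 + ε * β)) (nhds 0) (nhds z) := by
    have : Continuous (fun ε : ℝ => (z.1 + ε * α, z.2 + ε * β)) := by fun_prop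
    have := this.tendsto 0
    simpa using this
  have hev := hcont.eventually (mem_interior_iff_mem_nhds.1 hz)
  rw [Filter.Eventually, Metric.mem_nhds_iff] at hev
  obtain ⟨r, hr, hb⟩ := hev
  have hmem : r / 2 ∈ Metric.ball (0 : ℝ) r := by
    rw [Metric.mem_ball, Real.dist_eq, abs_lt]; constructor <;> linarith
  have h1 := hle _ (hb hmem)
  simp only at h1
  have hpos : 0 < α ^ 2 + β ^ 2 := by
    rcases h0 with h | h
    · have := sq_pos_of_ne_zero h; positivity
    · have := sq_pos_of_ne_zero h; positivity
  nlinarith [mul_pos hr hpos]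

lemma col_finite {P : Set (ℝ × ℝ)} (hP : IsCompact P) {p0 : ℤ × ℤ}
    (h0 : latticeEmbed p0 ∈ interior P) : {v : ℤ × ℤ | IsColumnVector P v}.Finite := by
  refine ((latpts_finite hP).image (fun q => q - p0)).subset ?_
  rintro v ⟨hv, τ, hτ, hcol⟩
  obtain ⟨α, β, m, hne, hle, hmem, -⟩ := data_of_edge ⟨_, h0⟩ hτ
  have := interior_strict hne hle h0
  refine ⟨p0 + v, hcol p0 ⟨interior_subset h0, ?_⟩, by simp⟩
  rw [hmem]; rintro ⟨-, h⟩; exact this.ne h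

lemma zaff_col {φ : ℝ × ℝ → ℝ × ℝ} (h : IsZAffine φ) {P : Set (ℝ × ℝ)}
    (hP : (interior P).Nonempty) {E A : ℤ × ℤ → ℤ × ℤ}
    (hE : ∀ p, φ (latticeEmbed p) = latticeEmbed (E p))
    (hA : ∀ p v, E (p + v) = E p + A v) (hb : Function.Bijective E) (hAi : Function.Injective A)
    (hA0 : A 0 = 0) {v : ℤ × ℤ} (hv : IsColumnVector P v) : IsColumnVector (φ '' P) (A v) := by
  obtain ⟨hv0, τ, hτ, hcol⟩ := hv
  refine ⟨?_, φ '' τ, edge_of_data (zaff_edgedata h (data_of_edge hP hτ)), ?_⟩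
  · rw [← hA0]; exact hAi.ne hv0
  · intro q hq
    obtain ⟨p, rfl⟩ := hb.2 q
    rw [← hE] at hq
    rw [← hA, ← hE, (zaff_inj h).mem_set_image]
    apply hcol
    rw [mem_sdiff, (zaff_inj h).mem_set_image, (zaff_inj h).mem_set_image] at hq
    exact hq

lemma zaff_colcount {φ : ℝ × ℝ → ℝ × ℝ} (h : IsZAffine φ) {P : Set (ℝ × ℝ)} (hP : IsCompact P)
    {p0 : ℤ × ℤ} (h0 : latticeEmbed p0 ∈ interior P) :
    columnVectorCount (φ '' P) ≤ columnVectorCount P := by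
  obtain ⟨ψ, hψ, h1, h2⟩ := zaff_inv h
  obtain ⟨E, A, hE, hA, hb, hAi, hA0⟩ := zaff_int hψ
  have hne : (interior (φ '' P)).Nonempty := by
    rw [zaff_interior h]; exact ⟨_, mem_image_of_mem _ h0⟩
  unfold columnVectorCount
  rw [← ncard_image_of_injective _ hAi]
  apply ncard_le_ncard _ (col_finite hP h0)
  rintro _ ⟨v, hv, rfl⟩
  have := zaff_col hψ hne hE hA hb hAi hA0 hv
  rwa [inv_image h1] at this

lemma supp {Q : Set (ℝ × ℝ)} (hQ : Convex ℝ Q) (hne : (interior Q).Nonempty) {e : ℝ × ℝ}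
    (he : e ∉ interior Q) : ∃ α β : ℝ, (α ≠ 0 ∨ β ≠ 0) ∧
      ∀ z ∈ Q, α * z.1 + β * z.2 ≤ α * e.1 + β * e.2 := by
  obtain ⟨f, hf⟩ := geometric_hahn_banach_open_point hQ.interior isOpen_interior he
  obtain ⟨α, β, hαβ⟩ := dual_form f
  refine ⟨α, β, ?_, ?_⟩
  · by_contra hc
    push Not at hc
    obtain ⟨x, hx⟩ := hne
    have := hf x hx
    rw [hαβ, hαβ, hc.1, hc.2] at this
    simp at this
  · intro z hz
    have hz' : z ∈ closure (interior Q) := by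
      rw [hQ.closure_interior_eq_closure_of_nonempty_interior hne]
      exact subset_closure hz
    have hcl : IsClosed {z : ℝ × ℝ | α * z.1 + β * z.2 ≤ α * e.1 + β * e.2} :=
      isClosed_le (by fun_prop) (by fun_prop)
    have hsub : interior Q ⊆ {z : ℝ × ℝ | α * z.1 + β * z.2 ≤ α * e.1 + β * e.2} := by
      intro y hy
      have := hf y hy
      rw [hαβ, hαβ] at this
      exact this.le
    exact closure_minimal hsub hcl hz'

lemma four {Q : Set (ℝ × ℝ)} (hQ : Convex ℝ Q) (hne : (interior Q).Nonempty)
    {a b p q e : ℝ × ℝ} (ha : a ∈ Q) (hb : b ∈ Q) (hp : p ∈ Q) (hq : q ∈ Q) (hab : a ≠ b)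
    {u1 u2 c θ : ℝ} (hua : u1 * a.1 + u2 * a.2 = c) (hub : u1 * b.1 + u2 * b.2 = c)
    (hup : u1 * p.1 + u2 * p.2 < c) (huq : c < u1 * q.1 + u2 * q.2)
    (h0 : 0 < θ) (h1 : θ < 1) (he1 : e.1 = (1 - θ) * a.1 + θ * b.1)
    (he2 : e.2 = (1 - θ) * a.2 + θ * b.2) : e ∈ interior Q := by
  by_contra hc
  obtain ⟨α, β, hne0, hle⟩ := supp hQ hne hc
  have fa := hle a ha
  have fb := hle b hb
  have fp := hle p hp
  have fq := hle q hq
  rw [he1, he2] at fa fb fp fq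
  have hd : α * (b.1 - a.1) + β * (b.2 - a.2) = 0 := by
    apply le_antisymm
    · have : (1 - θ) * (α * (b.1 - a.1) + β * (b.2 - a.2)) ≤ 0 := by linarith
      by_contra hcc
      push Not at hcc
      have := mul_pos (by linarith : 0 < 1 - θ) hcc
      linarith
    · have : 0 ≤ θ * (α * (b.1 - a.1) + β * (b.2 - a.2)) := by linarith
      by_contra hcc
      push Not at hcc
      have := mul_neg_of_pos_of_neg h0 hcc
      linarith
  have hd' : u1 * (b.1 - a.1) + u2 * (b.2 - a.2) = 0 := by linarith
  have hcr : α * u2 = β * u1 := by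
    by_cases hb1 : b.1 - a.1 = 0
    · have hb2 : b.2 - a.2 ≠ 0 := by
        intro hb2
        exact hab (Prod.ext (by linarith) (by linarith))
      rw [hb1] at hd hd'
      have e1 : β = 0 := by simpa [hb2] using hd
      have e2 : u2 = 0 := by simpa [hb2] using hd'
      rw [e1, e2]; ring
    · apply mul_left_cancel₀ hb1
      linear_combination u2 * hd - β * hd'
  have fe : (1 - θ) * a.1 * α + θ * b.1 * α + (1 - θ) * a.2 * β + θ * b.2 * β
      = α * a.1 + β * a.2 := by linear_combination θ * hd
  -- multiply by u
  have gp : α * (p.1 - a.1) + β * (p.2 - a.2) ≤ 0 := by linarith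
  have gq : α * (q.1 - a.1) + β * (q.2 - a.2) ≤ 0 := by linarith
  have hp' : u1 * (p.1 - a.1) + u2 * (p.2 - a.2) < 0 := by linarith
  have hq' : 0 < u1 * (q.1 - a.1) + u2 * (q.2 - a.2) := by linarith
  by_cases hu1 : u1 = 0
  · have hu2 : u2 ≠ 0 := by
      intro hu2; rw [hu1, hu2] at hq'; simp at hq'
    have hα : α = 0 := by
      rw [hu1] at hcr; simpa [hu2] using hcr
    have hβ : β = 0 := by
      rw [hu1] at hp' hq'
      rw [hα] at gp gq
      simp only [zero_mul, zero_add] at *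
      -- β x ≤ 0, u2 x<0
      by_contra hβ
      rcases lt_or_gt_of_ne hβ with h | h <;> rcases lt_or_gt_of_ne hu2 with h' | h' <;>
        nlinarith
    rcases hne0 with h | h
    · exact h hα
    · exact h hβ
  · obtain ⟨k, hk⟩ : ∃ k, α = k * u1 := ⟨α / u1, by field_simp⟩
    have hk2 : β = k * u2 := by
      apply mul_left_cancel₀ hu1
      rw [hk] at hcr; linarith
    rw [hk, hk2] at gp gq
    have hk0 : k = 0 := by
      apply le_antisymm
      · by_contra hcc; push Not at hcc
        have := mul_pos hcc hq'; linarith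
      · by_contra hcc; push Not at hcc
        have := mul_pos_of_neg_of_neg hcc hp'; linarith
    rw [hk0] at hk hk2
    rcases hne0 with h | h
    · exact h (by simpa using hk)
    · exact h (by simpa using hk2)

lemma hull_le {S : Set (ℝ × ℝ)} {α β m : ℝ} (h : ∀ s ∈ S, α * s.1 + β * s.2 ≤ m) :
    ∀ z ∈ convexHull ℝ S, α * z.1 + β * z.2 ≤ m := by
  have hc : Convex ℝ {z : ℝ × ℝ | α * z.1 + β * z.2 ≤ m} := by
    intro x hx y hy a b ha hb hab
    simp only [mem_ofPred_eq, Prod.fst_add, Prod.snd_add, Prod.smul_fst, Prod.smul_snd,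
      smul_eq_mul] at *
    calc _ = a * (α * x.1 + β * x.2) + b * (α * y.1 + β * y.2) := by ring
      _ ≤ a * m + b * m := by gcongr
      _ = m := by rw [← add_mul, hab, one_mul]
  exact fun z hz => convexHull_min (t := {z : ℝ × ℝ | α * z.1 + β * z.2 ≤ m}) h hc hz

structure Good (S : Finset (ℤ × ℤ)) (P : Set (ℝ × ℝ)) : Prop where
  hP : P = convexHull ℝ (latticeEmbed '' (S : Set (ℤ × ℤ)))
  rows : ∀ s ∈ S, 0 ≤ s.2 ∧ s.2 ≤ 5
  bot : ∃ s ∈ S, s.2 = 0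
  top : ∃ s ∈ S, s.2 = 5
  int : (interior P).Nonempty

def RTop (P : Set (ℝ × ℝ)) (R : ℤ → ℝ) : Prop :=
  ∀ t : ℤ, 0 ≤ t → t ≤ 5 → (R t, (t : ℝ)) ∈ P ∧ ∀ x : ℝ, (x, (t : ℝ)) ∈ P → x ≤ R t

def RBot (P : Set (ℝ × ℝ)) (K : ℤ → ℝ) : Prop :=
  ∀ t : ℤ, 0 ≤ t → t ≤ 5 → (-K t, (t : ℝ)) ∈ P ∧ ∀ x : ℝ, (x, (t : ℝ)) ∈ P → -x ≤ K t

def refl1 : ℝ × ℝ → ℝ × ℝ := fun z => (-z.1, z.2)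
def refl2 : ℝ × ℝ → ℝ × ℝ := fun z => (z.1, 5 - z.2)

lemma refl1_z : IsZAffine refl1 :=
  ⟨-1, 0, 0, 1, 0, 0, by norm_num, fun p => by simp [refl1]⟩

lemma refl2_z : IsZAffine refl2 :=
  ⟨1, 0, 0, -1, 0, 5, by norm_num, fun p => by simp [refl2]; ring⟩

lemma mem_refl1 (P : Set (ℝ × ℝ)) (x y : ℝ) : (x, y) ∈ refl1 '' P ↔ (-x, y) ∈ P := by
  have : (x, y) = refl1 (-x, y) := by simp [refl1]
  rw [this, (zaff_inj refl1_z).mem_set_image]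

lemma mem_refl2 (P : Set (ℝ × ℝ)) (x y : ℝ) : (x, y) ∈ refl2 '' P ↔ (x, 5 - y) ∈ P := by
  have : (x, y) = refl2 (x, 5 - y) := by simp [refl2]
  rw [this, (zaff_inj refl2_z).mem_set_image]

lemma isTop_refl1 {P : Set (ℝ × ℝ)} {K : ℤ → ℝ} : RTop (refl1 '' P) K ↔ RBot P K := by
  unfold RTop RBot
  simp only [mem_refl1]
  refine forall_congr' fun t => forall_congr' fun _ => forall_congr' fun _ => and_congr Iff.rfl ?_
  constructor
  · intro h x hx; exact h (-x) (by simpa using hx)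
  · intro h x hx; simpa using h (-x) hx

lemma isBot_refl1 {P : Set (ℝ × ℝ)} {K : ℤ → ℝ} : RBot (refl1 '' P) K ↔ RTop P K := by
  rw [← isTop_refl1, inv_image (φ := refl1) (ψ := refl1) (by intro p; simp [refl1])]

lemma isTop_refl2 {P : Set (ℝ × ℝ)} {K : ℤ → ℝ} (h : RTop P K) :
    RTop (refl2 '' P) (fun t => K (5 - t)) := by
  intro t h0 h5
  have := h (5 - t) (by omega) (by omega)
  simp only [mem_refl2]
  push_cast at this
  exact this

lemma isBot_refl2 {P : Set (ℝ × ℝ)} {K : ℤ → ℝ} (h : RBot P K) :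
    RBot (refl2 '' P) (fun t => K (5 - t)) := by
  intro t h0 h5
  have := h (5 - t) (by omega) (by omega)
  simp only [mem_refl2]
  push_cast at this
  exact this

lemma good_refl1 {S : Finset (ℤ × ℤ)} {P : Set (ℝ × ℝ)} (h : Good S P) :
    Good (S.image fun p => (-p.1, p.2)) (refl1 '' P) := by
  refine ⟨?_, ?_, ?_, ?_, ?_⟩
  · rw [h.hP, zaff_hull refl1_z, Finset.coe_image, image_image, image_image]
    simp [refl1, latticeEmbed]
  · simp only [Finset.mem_image]
    rintro _ ⟨p, hp, rfl⟩; exact h.rows p hp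
  · obtain ⟨s, hs, h0⟩ := h.bot
    exact ⟨_, Finset.mem_image_of_mem _ hs, h0⟩
  · obtain ⟨s, hs, h0⟩ := h.top
    exact ⟨_, Finset.mem_image_of_mem _ hs, h0⟩
  · rw [zaff_interior refl1_z]; exact h.int.image _

lemma good_refl2 {S : Finset (ℤ × ℤ)} {P : Set (ℝ × ℝ)} (h : Good S P) :
    Good (S.image fun p => (p.1, 5 - p.2)) (refl2 '' P) := by
  refine ⟨?_, ?_, ?_, ?_, ?_⟩
  · rw [h.hP, zaff_hull refl2_z, Finset.coe_image, image_image, image_image]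
    simp [refl2, latticeEmbed]
  · simp only [Finset.mem_image]
    rintro _ ⟨p, hp, rfl⟩
    have := h.rows p hp
    simp only; omega
  · obtain ⟨s, hs, h0⟩ := h.top
    exact ⟨_, Finset.mem_image_of_mem _ hs, by simp [h0]⟩
  · obtain ⟨s, hs, h0⟩ := h.bot
    exact ⟨_, Finset.mem_image_of_mem _ hs, by simp [h0]⟩
  · rw [zaff_interior refl2_z]; exact h.int.image _

section
variable {S : Finset (ℤ × ℤ)} {P : Set (ℝ × ℝ)}

lemma Good.convex (h : Good S P) : Convex ℝ P := by rw [h.hP]; exact convex_convexHull _ _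

lemma Good.poly (h : Good S P) : IsLatticePolygon P := by
  obtain ⟨s, hs, -⟩ := h.bot
  exact ⟨S, ⟨s, hs⟩, h.hP⟩

lemma Good.mem (h : Good S P) {s : ℤ × ℤ} (hs : s ∈ S) : latticeEmbed s ∈ P := by
  rw [h.hP]; exact subset_convexHull _ _ (mem_image_of_mem _ hs)

lemma Good.le (h : Good S P) {α β m : ℝ} (hs : ∀ s ∈ S, α * s.1 + β * s.2 ≤ m) :
    ∀ z ∈ P, α * z.1 + β * z.2 ≤ m := by
  rw [h.hP]; apply hull_le
  rintro _ ⟨s, hs', rfl⟩; exact hs s hs'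

lemma Good.row (h : Good S P) {z : ℝ × ℝ} (hz : z ∈ P) : 0 ≤ z.2 ∧ z.2 ≤ 5 := by
  constructor
  · have := h.le (α := 0) (β := -1) (m := 0) (fun s hs => by
      have := (h.rows s hs).1
      have : (0 : ℝ) ≤ s.2 := by exact_mod_cast this
      linarith) z hz
    linarith
  · have := h.le (α := 0) (β := 1) (m := 5) (fun s hs => by
      have := (h.rows s hs).2
      have : (s.2 : ℝ) ≤ 5 := by exact_mod_cast this
      linarith) z hz
    linarith

lemma comb (hc : Convex ℝ P) {x y x' y' θ : ℝ} (h1 : (x, y) ∈ P) (h2 : (x', y') ∈ P)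
    (h0 : 0 ≤ θ) (h1' : θ ≤ 1) : ((1 - θ) * x + θ * x', (1 - θ) * y + θ * y') ∈ P := by
  have := hc h1 h2 (by linarith : 0 ≤ 1 - θ) h0 (by ring)
  simpa using this

lemma Good.exists_top (h : Good S P) : ∃ R, RTop P R := by
  have : ∀ t : ℤ, ∃ r : ℝ, 0 ≤ t → t ≤ 5 → (r, (t : ℝ)) ∈ P ∧ ∀ x : ℝ, (x, (t : ℝ)) ∈ P → x ≤ r := by
    intro t
    by_cases ht : 0 ≤ t ∧ t ≤ 5
    · obtain ⟨b, hb, hb0⟩ := h.bot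
      obtain ⟨a, ha, ha5⟩ := h.top
      have hb' := h.mem hb
      have ha' := h.mem ha
      simp only [latticeEmbed, hb0, ha5] at hb' ha'
      have ht0 : (0 : ℝ) ≤ t := by exact_mod_cast ht.1
      have ht5 : (t : ℝ) ≤ 5 := by exact_mod_cast ht.2
      have hm := comb h.convex hb' ha' (θ := t / 5) (by positivity) (by linarith)
      have hcp : IsCompact (P ∩ {z : ℝ × ℝ | z.2 = t}) :=
        (latpoly_compact h.poly).inter_right (isClosed_eq (by fun_prop) (by fun_prop))
      obtain ⟨z, hz, hmax⟩ := hcp.exists_isMaxOn (f := Prod.fst)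
        ⟨_, hm, by simp⟩ (by fun_prop)
      refine ⟨z.1, fun _ _ => ⟨?_, ?_⟩⟩
      · have : z.2 = t := hz.2
        rw [← this]; exact hz.1
      · intro x hx
        exact hmax (⟨hx, rfl⟩ : (x, (t : ℝ)) ∈ P ∩ {z : ℝ × ℝ | z.2 = t})
    · exact ⟨0, fun h1 h2 => absurd ⟨h1, h2⟩ ht⟩
  choose R hR using this
  exact ⟨R, hR⟩

lemma Good.exists_bot (h : Good S P) : ∃ R, RBot P R := by
  obtain ⟨R, hR⟩ := (good_refl1 h).exists_top
  exact ⟨R, isTop_refl1.1 hR⟩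

lemma Good.concave (h : Good S P) {R : ℤ → ℝ} (hR : RTop P R) (t : ℤ) (h1 : 1 ≤ t) (h4 : t ≤ 4) :
    R (t - 1) + R (t + 1) ≤ 2 * R t := by
  have a := (hR (t - 1) (by omega) (by omega)).1
  have b := (hR (t + 1) (by omega) (by omega)).1
  have := comb h.convex a b (θ := 1 / 2) (by norm_num) (by norm_num)
  have h2 := (hR t (by omega) (by omega)).2 ((1 - 1 / 2) * R (t - 1) + 1 / 2 * R (t + 1)) (by
    convert this using 2
    push_cast; ring)
  linarith

lemma Good.int_strict (h : Good S P) {z : ℝ × ℝ} (hz : z ∈ interior P) : 0 < z.2 ∧ z.2 < 5 := by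
  constructor
  · have := interior_strict (α := 0) (β := -1) (m := 0) (by norm_num)
      (fun z hz => by linarith [(h.row hz).1]) hz
    linarith
  · have := interior_strict (α := 0) (β := 1) (m := 5) (by norm_num)
      (fun z hz => by linarith [(h.row hz).2]) hz
    linarith

lemma seg_int (hc : Convex ℝ P) {x y x' y' θ : ℝ} (h1 : (x, y) ∈ interior P) (h2 : (x', y') ∈ P)
    (h0 : 0 ≤ θ) (h1' : θ < 1) : ((1 - θ) * x + θ * x', (1 - θ) * y + θ * y') ∈ interior P := by
  have := hc.combo_interior_self_mem_interior h1 h2 (by linarith : 0 < 1 - θ) h0 (by ring)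
  simpa using this

/-- each middle row contains an interior point -/
lemma Good.row_int (h : Good S P) (t : ℝ) (h1 : 0 < t) (h4 : t < 5) :
    ∃ x : ℝ, (x, t) ∈ interior P := by
  obtain ⟨b, hb, hb0⟩ := h.bot
  obtain ⟨a, ha, ha5⟩ := h.top
  have hb' := h.mem hb
  have ha' := h.mem ha
  simp only [latticeEmbed, hb0, ha5] at hb' ha'
  obtain ⟨⟨x, y⟩, hz⟩ := h.int
  have hy := h.int_strict hz
  simp only at hy
  rcases le_total y t with hyt | hyt
  · have := seg_int h.convex hz ha' (θ := (t - y) / (5 - y))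
      (div_nonneg (by linarith) (by linarith)) (by rw [div_lt_one (by linarith)]; linarith)
    refine ⟨_, by convert this using 2; push_cast; field_simp [(by linarith : (5 - y) ≠ 0)]; ring⟩
  · have := seg_int h.convex hz hb' (θ := (y - t) / y)
      (div_nonneg (by linarith) (by linarith)) (by rw [div_lt_one (by linarith)]; linarith)
    refine ⟨_, by convert this using 2; push_cast; field_simp [(by linarith : y ≠ 0)]; ring⟩

lemma Good.int_top (h : Good S P) {R : ℤ → ℝ} (hR : RTop P R) {x : ℝ} {t : ℤ}
    (hz : (x, (t : ℝ)) ∈ interior P) : x < R t := by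
  have hy := h.int_strict hz
  simp only at hy
  have h0 : 0 < t := by exact_mod_cast hy.1
  have h5 : t < 5 := by exact_mod_cast hy.2
  by_contra hc
  push Not at hc
  have hx : x = R t := le_antisymm ((hR t h0.le h5.le).2 x (interior_subset hz)) hc
  have hcont : Filter.Tendsto (fun ε : ℝ => (x + ε, (t : ℝ))) (nhds 0) (nhds (x, (t : ℝ))) := by
    have : Continuous (fun ε : ℝ => (x + ε, (t : ℝ))) := by fun_prop
    have := this.tendsto 0
    simpa using this
  have hev := hcont.eventually (mem_interior_iff_mem_nhds.1 hz)
  rw [Filter.Eventually, Metric.mem_nhds_iff] at hev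
  obtain ⟨r, hr, hb⟩ := hev
  have hmem : r / 2 ∈ Metric.ball (0 : ℝ) r := by
    rw [Metric.mem_ball, Real.dist_eq, abs_lt]; constructor <;> linarith
  have := (hR t h0.le h5.le).2 _ (hb hmem)
  linarith

lemma Good.int_bot (h : Good S P) {K : ℤ → ℝ} (hK : RBot P K) {x : ℝ} {t : ℤ}
    (hz : (x, (t : ℝ)) ∈ interior P) : -x < K t := by
  apply (good_refl1 h).int_top (isTop_refl1.2 hK) (t := t)
  rw [zaff_interior refl1_z, mem_refl1]; simpa using hz

lemma Good.lt (h : Good S P) {R K : ℤ → ℝ} (hR : RTop P R) (hK : RBot P K) {t : ℤ}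
    (h0 : 0 < t) (h5 : t < 5) : -K t < R t := by
  obtain ⟨x, hx⟩ := h.row_int t (by exact_mod_cast h0) (by exact_mod_cast h5)
  linarith [h.int_top hR hx, h.int_bot hK hx]

lemma Good.mem_iff (h : Good S P) {R K : ℤ → ℝ} (hR : RTop P R) (hK : RBot P K) (p : ℤ × ℤ) :
    latticeEmbed p ∈ P ↔ 0 ≤ p.2 ∧ p.2 ≤ 5 ∧ (p.1 : ℝ) ≤ R p.2 ∧ -(p.1 : ℝ) ≤ K p.2 := by
  constructor
  · intro hp
    have := h.row hp
    simp only [latticeEmbed] at this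
    have h0 : 0 ≤ p.2 := by exact_mod_cast this.1
    have h5 : p.2 ≤ 5 := by exact_mod_cast this.2
    exact ⟨h0, h5, (hR _ h0 h5).2 _ hp, (hK _ h0 h5).2 _ hp⟩
  · rintro ⟨h0, h5, h1, h2⟩
    have a := (hR _ h0 h5).1
    have b := (hK _ h0 h5).1
    have hs : Icc (-K p.2) (R p.2) ⊆ {x : ℝ | (x, (p.2 : ℝ)) ∈ P} := by
      have hcv : Convex ℝ {x : ℝ | (x, (p.2 : ℝ)) ∈ P} := by
        intro x hx y hy a b ha hb hab
        have := h.convex hx hy ha hb hab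
        simp only [Prod.smul_mk, smul_eq_mul, Prod.mk_add_mk, ← add_mul, hab, one_mul] at this
        exact this
      exact hcv.ordConnected.out b a
    exact hs ⟨by linarith, h1⟩

lemma Good.int_iff (h : Good S P) {R K : ℤ → ℝ} (hR : RTop P R) (hK : RBot P K) (p : ℤ × ℤ) :
    latticeEmbed p ∈ interior P ↔ 1 ≤ p.2 ∧ p.2 ≤ 4 ∧ (p.1 : ℝ) < R p.2 ∧ -(p.1 : ℝ) < K p.2 := by
  constructor
  · intro hp
    have := h.int_strict hp
    simp only [latticeEmbed] at this
    have h0 : 0 < p.2 := by exact_mod_cast this.1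
    have h5 : p.2 < 5 := by exact_mod_cast this.2
    exact ⟨by omega, by omega, h.int_top hR hp, h.int_bot hK hp⟩
  · rintro ⟨h0, h5, h1, h2⟩
    have a := (hR p.2 (by omega) (by omega)).1
    have b := (hK p.2 (by omega) (by omega)).1
    obtain ⟨s0, hs0, e0⟩ := h.bot
    obtain ⟨s5, hs5, e5⟩ := h.top
    have hlt : -K p.2 < R p.2 := by linarith
    have h0' : (1 : ℝ) ≤ p.2 := by exact_mod_cast h0
    have h5' : (p.2 : ℝ) ≤ 4 := by exact_mod_cast h5
    refine four h.convex h.int b a (h.mem hs0) (h.mem hs5) ?_ (u1 := 0) (u2 := 1) (c := p.2)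
      (θ := (p.1 + K p.2) / (R p.2 + K p.2)) (by simp) (by simp) ?_ ?_ ?_ ?_ ?_ ?_
    · intro hh
      have := congrArg Prod.fst hh
      simp only at this; linarith
    · simp [latticeEmbed, e0]; linarith
    · simp [latticeEmbed, e5]; linarith
    · apply div_pos <;> linarith
    · rw [div_lt_one (by linarith)]; linarith
    · simp only [latticeEmbed]
      have : R p.2 + K p.2 ≠ 0 := by linarith
      field_simp; ring
    · simp only [latticeEmbed]; ring

/-- supporting line at a right boundary point -/
lemma Good.slope (h : Good S P) {R : ℤ → ℝ} (hR : RTop P R) (t : ℤ) (h1 : 1 ≤ t) (h4 : t ≤ 4) :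
    ∃ k : ℝ, ∀ z ∈ P, z.1 ≤ R t + k * (z.2 - t) := by
  have hni : (R t, (t : ℝ)) ∉ interior P := fun hh => lt_irrefl _ (h.int_top hR hh)
  obtain ⟨α, β, hne, hle⟩ := supp h.convex h.int hni
  simp only at hle
  obtain ⟨K, hK⟩ := h.exists_bot
  have hlt := h.lt hR hK (t := t) (by omega) (by omega)
  have hL := hle _ (hK t (by omega) (by omega)).1
  simp only at hL
  have hα0 : 0 ≤ α := by
    by_contra hc; push Not at hc
    nlinarith
  have h1' : (1 : ℝ) ≤ t := by exact_mod_cast h1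
  have h4' : (t : ℝ) ≤ 4 := by exact_mod_cast h4
  have hα : 0 < α := by
    rcases hα0.lt_or_eq with hh | hh
    · exact hh
    · exfalso
      obtain ⟨s0, hs0, e0⟩ := h.bot
      obtain ⟨s5, hs5, e5⟩ := h.top
      have f0 := hle _ (h.mem hs0)
      have f5 := hle _ (h.mem hs5)
      simp only [latticeEmbed, e0, e5, ← hh, zero_mul, zero_add] at f0 f5
      push_cast at f0 f5
      have : β = 0 := by nlinarith
      rcases hne with h | h
      · exact h hh.symm
      · exact h this
  refine ⟨-β / α, fun z hz => ?_⟩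
  have := hle z hz
  have e : R t + -β / α * (z.2 - t) = (α * R t + β * t - β * z.2) / α := by field_simp; ring
  rw [e, le_div_iff₀ hα]
  linarith

lemma hull_weights {e : ℝ × ℝ} (h : Good S P) (he : e ∈ P) :
    ∃ w : ℤ × ℤ → ℝ, (∀ s ∈ S, 0 ≤ w s) ∧ ∑ s ∈ S, w s = 1 ∧ ∀ α β γ : ℝ,
      ∑ s ∈ S, w s * (α * s.1 + β * s.2 + γ) = α * e.1 + β * e.2 + γ := by
  classical
  rw [h.hP, ← Finset.coe_image, Finset.mem_convexHull'] at he
  obtain ⟨w, h0, h1, hs⟩ := he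
  rw [Finset.sum_image embed_inj.injOn] at h1 hs
  refine ⟨fun s => w (latticeEmbed s), fun s hs => h0 _ (Finset.mem_image_of_mem _ hs), h1, ?_⟩
  intro α β γ
  have e1 := congrArg Prod.fst hs
  have e2 := congrArg Prod.snd hs
  rw [Prod.fst_sum] at e1
  rw [Prod.snd_sum] at e2
  simp only [Prod.smul_fst, Prod.smul_snd, smul_eq_mul, latticeEmbed] at e1 e2
  rw [← e1, ← e2]
  simp only [mul_add, Finset.sum_add_distrib, Finset.mul_sum]
  congr 1
  · congr 1 <;> (apply Finset.sum_congr rfl; intros; simp only [latticeEmbed]; ring)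
  · rw [← Finset.sum_mul, h1, one_mul]

lemma Good.int0 (h : Good S P) {R : ℤ → ℝ} (hR : RTop P R) : ∃ n : ℤ, R 0 = n := by
  have he := (hR 0 le_rfl (by norm_num)).1
  obtain ⟨w, h0, h1, hw⟩ := hull_weights h he
  have e1 := hw 0 1 0
  simp only [zero_mul, zero_add, one_mul, add_zero, Int.cast_zero] at e1
  have hz : ∀ s ∈ S, w s * (s.2 : ℝ) = 0 := by
    rw [Finset.sum_eq_zero_iff_of_nonneg] at e1
    · exact e1
    · intro s hs
      exact mul_nonneg (h0 s hs) (by exact_mod_cast (h.rows s hs).1)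
  by_contra hc
  push Not at hc
  have e2 := hw (-1) 0 (R 0)
  simp only [zero_mul, add_zero] at e2
  have e3 : ∑ s ∈ S, w s * (-1 * (s.1 : ℝ) + R 0) = 0 := by rw [e2]; ring
  have hrow : ∀ s ∈ S, w s ≠ 0 → (s.1 : ℝ) < R 0 := by
    intro s hs hws
    have : (s.2 : ℝ) = 0 := by simpa [hws] using hz s hs
    refine lt_of_le_of_ne ((hR 0 le_rfl (by norm_num)).2 _ ?_) (hc _).symm
    have hm := h.mem hs
    simp only [latticeEmbed, this] at hm
    simpa using hm
  rw [Finset.sum_eq_zero_iff_of_nonneg] at e3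
  · have : ∀ s ∈ S, w s = 0 := by
      intro s hs
      by_contra hws
      have a := e3 s hs
      have b := hrow s hs hws
      rcases mul_eq_zero.1 a with a | a
      · exact hws a
      · linarith
    rw [Finset.sum_eq_zero this] at h1
    norm_num at h1
  · intro s hs
    by_cases hws : w s = 0
    · simp [hws]
    · exact mul_nonneg (h0 s hs) (by linarith [hrow s hs hws])

lemma Good.int5 (h : Good S P) {R : ℤ → ℝ} (hR : RTop P R) : ∃ n : ℤ, R 5 = n := by
  have := (good_refl2 h).int0 (isTop_refl2 hR)
  simpa using this

lemma Good.linear (h : Good S P) {R : ℤ → ℝ} (hR : RTop P R) (t : ℤ) (h1 : 1 ≤ t) (h4 : t ≤ 4)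
    (hn : ∀ n : ℤ, R t ≠ n) : R (t - 1) + R (t + 1) = 2 * R t := by
  obtain ⟨k, hk⟩ := h.slope hR t h1 h4
  have he := (hR t (by omega) (by omega)).1
  obtain ⟨w, h0, hw1, hw⟩ := hull_weights h he
  have e1 := hw (-1) k (R t - k * t)
  have e1' : ∑ s ∈ S, w s * (-1 * (s.1 : ℝ) + k * s.2 + (R t - k * t)) = 0 := by rw [e1]; ring
  have hz : ∀ s ∈ S, w s * (-1 * (s.1 : ℝ) + k * s.2 + (R t - k * t)) = 0 := by
    rw [Finset.sum_eq_zero_iff_of_nonneg] at e1'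
    · exact e1'
    · intro s hs
      refine mul_nonneg (h0 s hs) ?_
      have := hk _ (h.mem hs)
      simp only [latticeEmbed] at this
      linarith
  have hline : ∀ s ∈ S, w s ≠ 0 → (s.1 : ℝ) = R t + k * (s.2 - t) := by
    intro s hs hws
    rcases mul_eq_zero.1 (hz s hs) with a | a
    · exact absurd a hws
    · linarith
  have hnt : ∀ s ∈ S, w s ≠ 0 → s.2 ≠ t := by
    intro s hs hws hst
    have := hline s hs hws
    rw [hst] at this
    apply hn s.1; linarith
  have e2 := hw 0 1 (-t)
  have e2' : ∑ s ∈ S, w s * ((s.2 : ℝ) - t) = 0 := by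
    rw [← sub_eq_zero.2 e2]; simp [sub_eq_add_neg]
  have hne : ∃ s ∈ S, w s ≠ 0 := by
    by_contra hc
    push Not at hc
    rw [Finset.sum_eq_zero hc] at hw1; norm_num at hw1
  obtain ⟨s0, hs0, hws0⟩ := hne
  have hex : (∃ s ∈ S, w s ≠ 0 ∧ s.2 < t) ∧ (∃ s ∈ S, w s ≠ 0 ∧ t < s.2) := by
    constructor
    · by_contra hc
      push Not at hc
      have hnn : ∀ s ∈ S, 0 ≤ w s * ((s.2 : ℝ) - t) := by
        intro s hs
        by_cases hws : w s = 0
        · simp [hws]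
        · have : (t : ℝ) ≤ s.2 := by exact_mod_cast hc s hs hws
          exact mul_nonneg (h0 s hs) (by linarith)
      rw [Finset.sum_eq_zero_iff_of_nonneg hnn] at e2'
      rcases mul_eq_zero.1 (e2' s0 hs0) with a | a
      · exact hws0 a
      · exact hnt s0 hs0 hws0 (by exact_mod_cast (sub_eq_zero.1 a))
    · by_contra hc
      push Not at hc
      have hnn : ∀ s ∈ S, w s * ((s.2 : ℝ) - t) ≤ 0 := by
        intro s hs
        by_cases hws : w s = 0
        · simp [hws]
        · have : (s.2 : ℝ) ≤ t := by exact_mod_cast hc s hs hws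
          exact mul_nonpos_of_nonneg_of_nonpos (h0 s hs) (by linarith)
      rw [Finset.sum_eq_zero_iff_of_nonpos hnn] at e2'
      rcases mul_eq_zero.1 (e2' s0 hs0) with a | a
      · exact hws0 a
      · exact hnt s0 hs0 hws0 (by exact_mod_cast (sub_eq_zero.1 a))
  obtain ⟨⟨a, ha, hwa, hat⟩, ⟨b, hb, hwb, hbt⟩⟩ := hex
  have ha' := h.mem ha
  have hb' := h.mem hb
  have la := hline a ha hwa
  have lb := hline b hb hwb
  simp only [latticeEmbed] at ha' hb'
  have hat' : (a.2 : ℝ) ≤ t - 1 := by exact_mod_cast (by omega : a.2 ≤ t - 1)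
  have hbt' : (t : ℝ) + 1 ≤ b.2 := by exact_mod_cast (by omega : t + 1 ≤ b.2)
  have hpt : ∀ y : ℝ, a.2 ≤ y → y ≤ b.2 → (R t + k * (y - t), y) ∈ P := by
    intro y hy1 hy2
    have hpos : (0 : ℝ) < b.2 - a.2 := by linarith
    have := comb h.convex ha' hb' (θ := (y - a.2) / (b.2 - a.2))
      (div_nonneg (by linarith) (by linarith)) (by rw [div_le_one (by linarith)]; linarith)
    rw [la, lb] at this
    have hne : (b.2 - a.2 : ℝ) ≠ 0 := hpos.ne'
    convert this using 2
    · field_simp; ring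
    · field_simp; ring
  have r1 := (hR (t - 1) (by omega) (by omega)).2 (R t + k * (((t - 1 : ℤ) : ℝ) - t))
    (hpt _ (by push_cast; linarith) (by push_cast; linarith))
  have r2 := (hR (t + 1) (by omega) (by omega)).2 (R t + k * (((t + 1 : ℤ) : ℝ) - t))
    (hpt _ (by push_cast; linarith) (by push_cast; linarith))
  have := h.concave hR t h1 h4
  push_cast at r1 r2
  linarith

end

lemma ncard_rows (T : Finset ℤ) (lo hi : ℤ → ℤ) :
    {p : ℤ × ℤ | p.2 ∈ T ∧ lo p.2 ≤ p.1 ∧ p.1 ≤ hi p.2}.ncard =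
      ∑ t ∈ T, (hi t + 1 - lo t).toNat := by
  classical
  have : {p : ℤ × ℤ | p.2 ∈ T ∧ lo p.2 ≤ p.1 ∧ p.1 ≤ hi p.2} =
      ↑((T.sigma (fun t => Finset.Icc (lo t) (hi t))).image (fun x => ((x.2, x.1) : ℤ × ℤ))) := by
    ext ⟨x, t⟩
    simp only [mem_ofPred_eq, Finset.coe_image, mem_image, Finset.mem_coe, Finset.mem_sigma,
      Finset.mem_Icc, Prod.mk.injEq]
    constructor
    · intro h; exact ⟨⟨t, x⟩, h, rfl, rfl⟩
    · rintro ⟨⟨t', x'⟩, h, rfl, rfl⟩; exact h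
  rw [this, ncard_coe_finset, Finset.card_image_of_injOn, Finset.card_sigma]
  · simp
  · rintro ⟨a, b⟩ - ⟨c, d⟩ - h
    simp only [Prod.mk.injEq] at h
    obtain ⟨rfl, rfl⟩ := h
    rfl

lemma sum14 (f : ℤ → ℕ) : ∑ t ∈ Finset.Icc (1 : ℤ) 4, f t = f 1 + f 2 + f 3 + f 4 := by
  have : Finset.Icc (1 : ℤ) 4 = {1, 2, 3, 4} := by decide
  rw [this]; simp [Finset.sum_insert]; ring

lemma sum05 (f : ℤ → ℕ) : ∑ t ∈ Finset.Icc (0 : ℤ) 5, f t = f 0 + f 1 + f 2 + f 3 + f 4 + f 5 := by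
  have : Finset.Icc (0 : ℤ) 5 = {0, 1, 2, 3, 4, 5} := by decide
  rw [this]; simp [Finset.sum_insert]; ring

section
variable {S : Finset (ℤ × ℤ)} {P : Set (ℝ × ℝ)}

lemma Good.genus (h : Good S P) {R K : ℤ → ℝ} (hR : RTop P R) (hK : RBot P K) :
    (polygonGenus P : ℤ) = ⌈R 1⌉ + ⌈K 1⌉ + ⌈R 2⌉ + ⌈K 2⌉ + ⌈R 3⌉ + ⌈K 3⌉ + ⌈R 4⌉ + ⌈K 4⌉ - 4 := by
  have e : interiorLatticePoints P =
      {p : ℤ × ℤ | p.2 ∈ Finset.Icc (1 : ℤ) 4 ∧ 1 - ⌈K p.2⌉ ≤ p.1 ∧ p.1 ≤ ⌈R p.2⌉ - 1} := by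
    ext p
    simp only [interiorLatticePoints, mem_ofPred_eq, Finset.mem_Icc]
    rw [h.int_iff hR hK]
    have a := Int.lt_ceil (a := R p.2) (z := p.1)
    have b := Int.lt_ceil (a := K p.2) (z := -p.1)
    push_cast at b
    rw [← a, ← b]
    constructor
    · rintro ⟨h1, h2, h3, h4⟩; exact ⟨⟨h1, h2⟩, by omega, by omega⟩
    · rintro ⟨⟨h1, h2⟩, h3, h4⟩; exact ⟨h1, h2, by omega, by omega⟩
  have hpos : ∀ t : ℤ, 1 ≤ t → t ≤ 4 → 1 ≤ ⌈R t⌉ + ⌈K t⌉ := by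
    intro t h1 h4
    have := h.lt hR hK (t := t) (by omega) (by omega)
    have a := Int.le_ceil (R t)
    have b := Int.le_ceil (K t)
    have : (0 : ℝ) < ((⌈R t⌉ + ⌈K t⌉ : ℤ) : ℝ) := by push_cast; linarith
    have : (0 : ℤ) < ⌈R t⌉ + ⌈K t⌉ := by exact_mod_cast this
    omega
  have p1 := hpos 1 (by norm_num) (by norm_num)
  have p2 := hpos 2 (by norm_num) (by norm_num)
  have p3 := hpos 3 (by norm_num) (by norm_num)
  have p4 := hpos 4 (by norm_num) (by norm_num)
  unfold polygonGenus
  rw [e, ncard_rows (Finset.Icc (1:ℤ) 4) (fun t => 1 - ⌈K t⌉) (fun t => ⌈R t⌉ - 1), sum14]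
  push_cast
  omega

lemma Good.total (h : Good S P) {R K : ℤ → ℝ} (hR : RTop P R) (hK : RBot P K) :
    (polygonGenus P : ℤ) + boundaryLatticeCount P = ⌊R 0⌋ + ⌊K 0⌋ + ⌊R 1⌋ + ⌊K 1⌋ + ⌊R 2⌋ + ⌊K 2⌋
      + ⌊R 3⌋ + ⌊K 3⌋ + ⌊R 4⌋ + ⌊K 4⌋ + ⌊R 5⌋ + ⌊K 5⌋ + 6 := by
  have hcp := latpoly_compact h.poly
  have hun : {p : ℤ × ℤ | latticeEmbed p ∈ P} =
      interiorLatticePoints P ∪ {p : ℤ × ℤ | latticeEmbed p ∈ frontier P} := by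
    ext p
    simp only [interiorLatticePoints, mem_ofPred_eq, mem_union]
    rw [hcp.isClosed.frontier_eq]
    constructor
    · intro hp
      by_cases hi : latticeEmbed p ∈ interior P
      · exact Or.inl hi
      · exact Or.inr ⟨hp, hi⟩
    · rintro (hp | hp)
      · exact interior_subset hp
      · exact hp.1
  have hfin := latpts_finite hcp
  have hsum : {p : ℤ × ℤ | latticeEmbed p ∈ P}.ncard = polygonGenus P + boundaryLatticeCount P := by
    have hf' := hfin
    rw [hun] at hf'
    rw [hun, ncard_union_eq _ (hf'.subset subset_union_left) (hf'.subset subset_union_right)]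
    · rfl
    · rw [disjoint_left]
      intro p hp hq
      simp only [interiorLatticePoints, mem_ofPred_eq] at hp hq
      exact hq.2 hp
  have e : {p : ℤ × ℤ | latticeEmbed p ∈ P} =
      {p : ℤ × ℤ | p.2 ∈ Finset.Icc (0 : ℤ) 5 ∧ -⌊K p.2⌋ ≤ p.1 ∧ p.1 ≤ ⌊R p.2⌋} := by
    ext p
    simp only [mem_ofPred_eq, Finset.mem_Icc]
    rw [h.mem_iff hR hK]
    have a := Int.le_floor (a := R p.2) (z := p.1)
    have b := Int.le_floor (a := K p.2) (z := -p.1)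
    push_cast at b
    rw [← a, ← b]
    constructor
    · rintro ⟨h1, h2, h3, h4⟩; exact ⟨⟨h1, h2⟩, by omega, by omega⟩
    · rintro ⟨⟨h1, h2⟩, h3, h4⟩; exact ⟨h1, h2, by omega, by omega⟩
  have hpos : ∀ t : ℤ, 0 ≤ t → t ≤ 5 → -1 ≤ ⌊R t⌋ + ⌊K t⌋ := by
    intro t h1 h4
    have := (hR t h1 h4).2 _ (hK t h1 h4).1
    have a := Int.lt_floor_add_one (R t)
    have b := Int.lt_floor_add_one (K t)
    have : (-2 : ℝ) < ((⌊R t⌋ + ⌊K t⌋ : ℤ) : ℝ) := by push_cast; linarith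
    have : (-2 : ℤ) < ⌊R t⌋ + ⌊K t⌋ := by exact_mod_cast this
    omega
  have p0 := hpos 0 (by norm_num) (by norm_num)
  have p1 := hpos 1 (by norm_num) (by norm_num)
  have p2 := hpos 2 (by norm_num) (by norm_num)
  have p3 := hpos 3 (by norm_num) (by norm_num)
  have p4 := hpos 4 (by norm_num) (by norm_num)
  have p5 := hpos 5 (by norm_num) (by norm_num)
  rw [e, ncard_rows (Finset.Icc (0:ℤ) 5) (fun t => -⌊K t⌋) (fun t => ⌊R t⌋), sum05] at hsum
  omega

/-- defect of one side -/
noncomputable def EE (R : ℤ → ℝ) : ℤ :=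
  ⌈R 1⌉ + ⌈R 2⌉ + ⌈R 3⌉ + ⌈R 4⌉ - 2 * (⌈R 0⌉ + ⌈R 5⌉)
    + 2 * (⌈R 1⌉ - ⌊R 1⌋ + (⌈R 2⌉ - ⌊R 2⌋) + (⌈R 3⌉ - ⌊R 3⌋) + (⌈R 4⌉ - ⌊R 4⌋))

lemma int_or (x : ℝ) : (∃ n : ℤ, x = n ∧ ⌈x⌉ = n ∧ ⌊x⌋ = n) ∨
    ((∀ n : ℤ, x ≠ n) ∧ ∃ n : ℤ, ⌊x⌋ = n ∧ ⌈x⌉ = n + 1 ∧ (n : ℝ) < x ∧ x < n + 1) := by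
  by_cases hx : ∃ n : ℤ, x = n
  · obtain ⟨n, rfl⟩ := hx
    left; exact ⟨n, rfl, by simp, by simp⟩
  · push Not at hx
    right
    have h1 : (⌊x⌋ : ℝ) < x := lt_of_le_of_ne (Int.floor_le x) (hx _).symm
    have h2 := Int.lt_floor_add_one x
    refine ⟨hx, ⌊x⌋, rfl, ?_, h1, h2⟩
    rw [Int.ceil_eq_iff]; push_cast
    constructor <;> linarith

set_option maxHeartbeats 1000000 in
lemma Good.EE_cases (h : Good S P) {R : ℤ → ℝ} (hR : RTop P R) :
    4 ≤ EE R ∨ ∃ r0 r1 r2 r3 r4 r5 : ℤ, R 0 = r0 ∧ R 1 = r1 ∧ R 2 = r2 ∧ R 3 = r3 ∧ R 4 = r4 ∧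
      R 5 = r5 ∧ EE R = r1 + r2 + r3 + r4 - 2 * (r0 + r5) ∧ r0 + r2 ≤ 2 * r1 ∧ r1 + r3 ≤ 2 * r2 ∧
      r2 + r4 ≤ 2 * r3 ∧ r3 + r5 ≤ 2 * r4 := by
  obtain ⟨a, ha⟩ := h.int0 hR
  obtain ⟨b, hb⟩ := h.int5 hR
  have c1 := h.concave hR 1 (by norm_num) (by norm_num)
  have c2 := h.concave hR 2 (by norm_num) (by norm_num)
  have c3 := h.concave hR 3 (by norm_num) (by norm_num)
  have c4 := h.concave hR 4 (by norm_num) (by norm_num)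
  have l1 := h.linear hR 1 (by norm_num) (by norm_num)
  have l2 := h.linear hR 2 (by norm_num) (by norm_num)
  have l3 := h.linear hR 3 (by norm_num) (by norm_num)
  have l4 := h.linear hR 4 (by norm_num) (by norm_num)
  norm_num at c1 c2 c3 c4 l1 l2 l3 l4
  unfold EE
  have hca : ⌈R 0⌉ = a := by rw [ha]; simp
  have hcb : ⌈R 5⌉ = b := by rw [hb]; simp
  rw [hca, hcb]
  rcases int_or (R 1) with ⟨n1, e1, f1, g1⟩ | ⟨m1, n1, g1, f1, u1, v1⟩ <;>
  rcases int_or (R 2) with ⟨n2, e2, f2, g2⟩ | ⟨m2, n2, g2, f2, u2, v2⟩ <;>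
  rcases int_or (R 3) with ⟨n3, e3, f3, g3⟩ | ⟨m3, n3, g3, f3, u3, v3⟩ <;>
  rcases int_or (R 4) with ⟨n4, e4, f4, g4⟩ | ⟨m4, n4, g4, f4, u4, v4⟩ <;>
  rw [f1, f2, f3, f4, g1, g2, g3, g4]
  · right
    refine ⟨a, n1, n2, n3, n4, b, ha, e1, e2, e3, e4, hb, by ring, ?_, ?_, ?_, ?_⟩
    · rw [ha, e1, e2] at c1; exact_mod_cast c1
    · rw [e1, e2, e3] at c2; exact_mod_cast c2
    · rw [e2, e3, e4] at c3; exact_mod_cast c3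
    · rw [hb, e3, e4] at c4; exact_mod_cast c4
  · left
    have l := l4 m4
    rw [ha, e1, e2] at c1
    rw [e1, e2, e3] at c2
    rw [e3, hb] at l
    have w1 : 2 * (n4 : ℝ) < n3 + b := by linarith
    have w2 : (n3 : ℝ) + b < 2 * n4 + 2 := by linarith
    have c3' : 2 * (n2 : ℝ) + (n3 + b) ≤ 4 * n3 := by linarith
    norm_cast at w1 w2 c1 c2 c3'
    omega
  · left
    have l := l3 m3
    rw [ha, e1, e2] at c1
    rw [e2, e4] at l
    have w1 : 2 * (n3 : ℝ) < n2 + n4 := by linarith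
    have w2 : (n2 : ℝ) + n4 < 2 * n3 + 2 := by linarith
    have c2' : 2 * (n1 : ℝ) + (n2 + n4) ≤ 4 * n2 := by linarith
    have c4' : (n2 : ℝ) + n4 + 2 * b ≤ 4 * n4 := by linarith
    norm_cast at w1 w2 c1 c2' c4'
    omega
  · left
    have : (4 : ℝ) ≤ ((n1 + n2 + (n3 + 1) + (n4 + 1) - 2 * (a + b) + 2 * (n1 - n1 + (n2 - n2) + (n3 + 1 - n3) + (n4 + 1 - n4)) : ℤ) : ℝ) := by push_cast; linarith
    exact_mod_cast this
  · left
    have l := l2 m2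
    rw [e3, e4, hb] at c4
    rw [e1, e3] at l
    have w1 : 2 * (n2 : ℝ) < n1 + n3 := by linarith
    have w2 : (n1 : ℝ) + n3 < 2 * n2 + 2 := by linarith
    have c2' : 2 * (a : ℝ) + (n1 + n3) ≤ 4 * n1 := by linarith
    have c4' : (n1 : ℝ) + n3 + 2 * n4 ≤ 4 * n3 := by linarith
    norm_cast at w1 w2 c4 c2' c4'
    omega
  · left
    have : (4 : ℝ) ≤ ((n1 + (n2 + 1) + n3 + (n4 + 1) - 2 * (a + b) + 2 * (n1 - n1 + (n2 + 1 - n2) + (n3 - n3) + (n4 + 1 - n4)) : ℤ) : ℝ) := by push_cast; linarith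
    exact_mod_cast this
  · left
    have : (4 : ℝ) ≤ ((n1 + (n2 + 1) + (n3 + 1) + n4 - 2 * (a + b) + 2 * (n1 - n1 + (n2 + 1 - n2) + (n3 + 1 - n3) + (n4 - n4)) : ℤ) : ℝ) := by push_cast; linarith
    exact_mod_cast this
  · left
    have : (4 : ℝ) ≤ ((n1 + (n2 + 1) + (n3 + 1) + (n4 + 1) - 2 * (a + b) + 2 * (n1 - n1 + (n2 + 1 - n2) + (n3 + 1 - n3) + (n4 + 1 - n4)) : ℤ) : ℝ) := by push_cast; linarith
    exact_mod_cast this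
  · left
    have l := l1 m1
    rw [e3, e4, hb] at c4
    rw [e2, e3, e4] at c3
    rw [ha, e2] at l
    have w1 : 2 * (n1 : ℝ) < a + n2 := by linarith
    have w2 : (a : ℝ) + n2 < 2 * n1 + 2 := by linarith
    have c2' : (a : ℝ) + n2 + 2 * n3 ≤ 4 * n2 := by linarith
    norm_cast at w1 w2 c4 c3 c2'
    omega
  · left
    have : (4 : ℝ) ≤ (((n1 + 1) + n2 + n3 + (n4 + 1) - 2 * (a + b) + 2 * (n1 + 1 - n1 + (n2 - n2) + (n3 - n3) + (n4 + 1 - n4)) : ℤ) : ℝ) := by push_cast; linarith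
    exact_mod_cast this
  · left
    have : (4 : ℝ) ≤ (((n1 + 1) + n2 + (n3 + 1) + n4 - 2 * (a + b) + 2 * (n1 + 1 - n1 + (n2 - n2) + (n3 + 1 - n3) + (n4 - n4)) : ℤ) : ℝ) := by push_cast; linarith
    exact_mod_cast this
  · left
    have : (4 : ℝ) ≤ (((n1 + 1) + n2 + (n3 + 1) + (n4 + 1) - 2 * (a + b) + 2 * (n1 + 1 - n1 + (n2 - n2) + (n3 + 1 - n3) + (n4 + 1 - n4)) : ℤ) : ℝ) := by push_cast; linarith
    exact_mod_cast this
  · left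
    have : (4 : ℝ) ≤ (((n1 + 1) + (n2 + 1) + n3 + n4 - 2 * (a + b) + 2 * (n1 + 1 - n1 + (n2 + 1 - n2) + (n3 - n3) + (n4 - n4)) : ℤ) : ℝ) := by push_cast; linarith
    exact_mod_cast this
  · left
    have : (4 : ℝ) ≤ (((n1 + 1) + (n2 + 1) + n3 + (n4 + 1) - 2 * (a + b) + 2 * (n1 + 1 - n1 + (n2 + 1 - n2) + (n3 - n3) + (n4 + 1 - n4)) : ℤ) : ℝ) := by push_cast; linarith
    exact_mod_cast this
  · left
    have : (4 : ℝ) ≤ (((n1 + 1) + (n2 + 1) + (n3 + 1) + n4 - 2 * (a + b) + 2 * (n1 + 1 - n1 + (n2 + 1 - n2) + (n3 + 1 - n3) + (n4 - n4)) : ℤ) : ℝ) := by push_cast; linarith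
    exact_mod_cast this
  · left
    have : (4 : ℝ) ≤ (((n1 + 1) + (n2 + 1) + (n3 + 1) + (n4 + 1) - 2 * (a + b) + 2 * (n1 + 1 - n1 + (n2 + 1 - n2) + (n3 + 1 - n3) + (n4 + 1 - n4)) : ℤ) : ℝ) := by push_cast; linarith
    exact_mod_cast this

end

section
variable {S : Finset (ℤ × ℤ)} {P : Set (ℝ × ℝ)}

lemma Good.maxL8 (h : Good S P) (hm : IsMaximalPolygon P) {R : ℤ → ℝ} (hR : RTop P R)
    {r0 r1 k : ℤ} (e0 : R 0 = r0) (e1 : R 1 = r1) (e2 : R 2 = r1 + k) (e3 : R 3 = r1 + 2 * k)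
    (e4 : R 4 = r1 + 3 * k) (e5 : R 5 = r1 + 4 * k) (hlt : r0 ≤ r1 - k - 1) : False := by
  classical
  obtain ⟨K, hK⟩ := h.exists_bot
  have hlt' : (r0 : ℝ) ≤ r1 - k - 1 := by exact_mod_cast hlt
  set S' : Finset (ℤ × ℤ) := insert (r0 + 1, 0) S with hS'
  set Q := convexHull ℝ (latticeEmbed '' (S' : Set (ℤ × ℤ))) with hQ
  have hPQ : P ⊆ Q := by
    rw [h.hP]
    apply convexHull_mono
    apply image_mono
    rw [hS']; simp
  have hg : Good S' Q := by
    refine ⟨rfl, ?_, ?_, ?_, ?_⟩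
    · intro s hs
      rw [hS', Finset.mem_insert] at hs
      rcases hs with rfl | hs
      · norm_num
      · exact h.rows s hs
    · obtain ⟨s, hs, h0⟩ := h.bot
      exact ⟨s, Finset.mem_insert_of_mem hs, h0⟩
    · obtain ⟨s, hs, h0⟩ := h.top
      exact ⟨s, Finset.mem_insert_of_mem hs, h0⟩
    · exact h.int.mono (interior_mono hPQ)
  have hnew : latticeEmbed (r0 + 1, 0) ∈ Q := hg.mem (Finset.mem_insert_self _ _)
  have hint : interiorLatticePoints Q = interiorLatticePoints P := by
    ext p
    constructor
    · intro hp
      simp only [interiorLatticePoints, mem_ofPred_eq] at hp ⊢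
      have hrow := hg.int_strict hp
      simp only [latticeEmbed] at hrow
      have t0 : 0 < p.2 := by exact_mod_cast hrow.1
      have t5 : p.2 < 5 := by exact_mod_cast hrow.2
      rw [h.int_iff hR hK]
      refine ⟨by omega, by omega, ?_, ?_⟩
      · have := interior_strict (P := Q) (α := 1) (β := -k) (m := r1 - k) (by norm_num) (by
          apply hg.le
          intro s hs
          rw [hS', Finset.mem_insert] at hs
          rcases hs with rfl | hs
          · push_cast; linarith
          · have hs' := (h.mem_iff hR hK s).1 (h.mem hs)
            obtain ⟨x, t⟩ := s
            obtain ⟨a, b, c, -⟩ := hs'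
            simp only at a b c ⊢
            interval_cases t
            · rw [e0] at c; push_cast; linarith
            · rw [e1] at c; push_cast; linarith
            · rw [e2] at c; push_cast; linarith
            · rw [e3] at c; push_cast; linarith
            · rw [e4] at c; push_cast; linarith
            · rw [e5] at c; push_cast; linarith) hp
        obtain ⟨x, t⟩ := p
        simp only [latticeEmbed] at this t0 t5 ⊢
        interval_cases t
        · rw [e1]; push_cast at this; linarith
        · rw [e2]; push_cast at this; linarith
        · rw [e3]; push_cast at this; linarith
        · rw [e4]; push_cast at this; linarith
      · obtain ⟨m, hm'⟩ := (good_refl1 h).slope (isTop_refl1.2 hK) p.2 (by omega) (by omega)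
        have hm2 : ∀ z ∈ P, -z.1 ≤ K p.2 + m * (z.2 - p.2) := by
          intro z hz
          exact hm' (refl1 z) (mem_image_of_mem _ hz)
        have h00 := hm2 _ (hR 0 le_rfl (by norm_num)).1
        rw [e0] at h00
        have := interior_strict (P := Q) (α := -1) (β := -m) (m := K p.2 - m * p.2) (by norm_num) (by
          apply hg.le
          intro s hs
          rw [hS', Finset.mem_insert] at hs
          rcases hs with rfl | hs
          · push_cast; push_cast at h00; linarith
          · have := hm2 _ (h.mem hs)
            simp only [latticeEmbed] at this
            linarith) hp
        simp only [latticeEmbed] at this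
        linarith
    · intro hp
      exact interior_mono hPQ hp
  have := hm.2 Q hg.poly hPQ hint
  rw [this] at hnew
  have := (h.mem_iff hR hK _).1 hnew
  have := this.2.2.1
  simp only [e0] at this
  push_cast at this
  linarith

lemma Good.EE_cases2 (h : Good S P) (hm : IsMaximalPolygon P) {R : ℤ → ℝ} (hR : RTop P R) :
    4 ≤ EE R ∨ ∃ r0 r1 r2 r3 r4 r5 : ℤ, R 0 = r0 ∧ R 1 = r1 ∧ R 2 = r2 ∧ R 3 = r3 ∧ R 4 = r4 ∧
      R 5 = r5 ∧ r0 + r2 ≤ 2 * r1 ∧ r1 + r3 ≤ 2 * r2 ∧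
      r2 + r4 ≤ 2 * r3 ∧ r3 + r5 ≤ 2 * r4 ∧ (r1 - r0) - (r5 - r4) ≤ 1 ∧
      (EE R = 3 ∨ (EE R = 0 ∧ ∃ k, r1 = r0 + k ∧ r2 = r0 + 2 * k ∧ r3 = r0 + 3 * k ∧
        r4 = r0 + 4 * k ∧ r5 = r0 + 5 * k)) := by
  rcases h.EE_cases hR with h4 | ⟨r0, r1, r2, r3, r4, r5, e0, e1, e2, e3, e4, e5, hE, c1, c2, c3, c4⟩
  · exact Or.inl h4
  by_cases h4 : 4 ≤ EE R
  · exact Or.inl h4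
  right
  refine ⟨r0, r1, r2, r3, r4, r5, e0, e1, e2, e3, e4, e5, c1, c2, c3, c4, by omega, ?_⟩
  by_cases h3 : EE R = 3
  · exact Or.inl h3
  right
  by_cases h2 : EE R = 2
  · exfalso
    by_cases hk : r1 - r0 = r2 - r1
    · -- top end differs
      obtain ⟨k, hk⟩ : ∃ k, r5 = r4 + k := ⟨r5 - r4, by ring⟩
      have f3 : r3 = r4 - (k + 1) := by omega
      have f2 : r2 = r4 - 2 * (k + 1) := by omega
      have f1 : r1 = r4 - 3 * (k + 1) := by omega
      have f0 : r0 = r4 - 4 * (k + 1) := by omega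
      refine (good_refl2 h).maxL8 (zaff_max refl2_z hm) (isTop_refl2 hR) (r0 := r5) (r1 := r4)
        (k := -(k + 1)) ?_ ?_ ?_ ?_ ?_ ?_ (by omega)
      · norm_num [e5]
      · norm_num [e4]
      · norm_num [e3, f3]; ring
      · norm_num [e2, f2]; ring
      · norm_num [e1, f1]; ring
      · norm_num [e0, f0]; ring
    · obtain ⟨k, hk⟩ : ∃ k, r2 = r1 + k := ⟨r2 - r1, by ring⟩
      have f3 : r3 = r1 + 2 * k := by omega
      have f4 : r4 = r1 + 3 * k := by omega
      have f5 : r5 = r1 + 4 * k := by omega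
      refine h.maxL8 hm hR (r0 := r0) (r1 := r1) (k := k) e0 e1 ?_ ?_ ?_ ?_ (by omega)
      · rw [e2, hk]; push_cast; ring
      · rw [e3, f3]; push_cast; ring
      · rw [e4, f4]; push_cast; ring
      · rw [e5, f5]; push_cast; ring
  · have q0 : (r1 - r0) - (r5 - r4) ≤ 0 := by omega
    have q1 : r2 - r1 = r1 - r0 := by omega
    have q2 : r3 - r2 = r1 - r0 := by omega
    have q3 : r4 - r3 = r1 - r0 := by omega
    have q4 : r5 - r4 = r1 - r0 := by omega
    exact ⟨by omega, r1 - r0, by omega, by omega, by omega, by omega, by omega⟩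

lemma Good.col_top (h : Good S P) {R K : ℤ → ℝ} (hR : RTop P R) (hK : RBot P K) {j : ℤ}
    (h1 : ∀ t : ℤ, 0 ≤ t → t ≤ 4 → R t + j ≤ R (t + 1))
    (h2 : ∀ t : ℤ, 0 ≤ t → t ≤ 4 → K t - j ≤ K (t + 1)) (h5 : -K 5 < R 5) :
    IsColumnVector P (j, 1) := by
  refine ⟨by simp [Prod.ext_iff], {z | z ∈ P ∧ z.2 = 5}, edge_of_data ⟨0, 1, 5, by norm_num, ?_, ?_,
    (R 5, 5), ?_, (-K 5, 5), ?_, ?_⟩, ?_⟩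
  · intro z hz; linarith [(h.row hz).2]
  · intro z; simp
  · exact ⟨by simpa using (hR 5 (by norm_num) le_rfl).1, rfl⟩
  · exact ⟨by simpa using (hK 5 (by norm_num) le_rfl).1, rfl⟩
  · intro he; rw [Prod.ext_iff] at he; simp only at he; linarith [he.1]
  · rintro ⟨x, t⟩ ⟨hp, hn⟩
    have hp' := (h.mem_iff hR hK _).1 hp
    obtain ⟨t0, t5, a, b⟩ := hp'
    simp only at t0 t5 a b
    have ht : t ≠ 5 := by
      rintro rfl
      exact hn ⟨hp, by simp [latticeEmbed]⟩
    rw [h.mem_iff hR hK]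
    have := h1 t t0 (by omega)
    have := h2 t t0 (by omega)
    refine ⟨by simp; omega, by simp; omega, ?_, ?_⟩
    · simp only [Prod.mk_add_mk]; push_cast; linarith
    · simp only [Prod.mk_add_mk]; push_cast; linarith

lemma Good.col_bot (h : Good S P) {R K : ℤ → ℝ} (hR : RTop P R) (hK : RBot P K) {j : ℤ}
    (h1 : ∀ t : ℤ, 0 ≤ t → t ≤ 4 → R (t + 1) + j ≤ R t)
    (h2 : ∀ t : ℤ, 0 ≤ t → t ≤ 4 → K (t + 1) - j ≤ K t) (h5 : -K 0 < R 0) :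
    IsColumnVector P (j, -1) := by
  refine ⟨by simp [Prod.ext_iff], {z | z ∈ P ∧ z.2 = 0}, edge_of_data ⟨0, -1, 0, by norm_num, ?_, ?_,
    (R 0, 0), ?_, (-K 0, 0), ?_, ?_⟩, ?_⟩
  · intro z hz; linarith [(h.row hz).1]
  · intro z; simp
  · exact ⟨by simpa using (hR 0 le_rfl (by norm_num)).1, rfl⟩
  · exact ⟨by simpa using (hK 0 le_rfl (by norm_num)).1, rfl⟩
  · intro he; rw [Prod.ext_iff] at he; simp only at he; linarith [he.1]
  · rintro ⟨x, t⟩ ⟨hp, hn⟩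
    have hp' := (h.mem_iff hR hK _).1 hp
    obtain ⟨t0, t5, a, b⟩ := hp'
    simp only at t0 t5 a b
    have ht : t ≠ 0 := by
      rintro rfl
      exact hn ⟨hp, by simp [latticeEmbed]⟩
    rw [h.mem_iff hR hK]
    have a1 := h1 (t - 1) (by omega) (by omega)
    have a2 := h2 (t - 1) (by omega) (by omega)
    rw [sub_add_cancel] at a1 a2
    refine ⟨by simp; omega, by simp; omega, ?_, ?_⟩
    · simp only [Prod.mk_add_mk, ← sub_eq_add_neg]; push_cast; linarith
    · simp only [Prod.mk_add_mk, ← sub_eq_add_neg]; push_cast; linarith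

lemma Good.col_right (h : Good S P) {R K : ℤ → ℝ} (hR : RTop P R) (hK : RBot P K) {a k : ℤ}
    (h1 : ∀ t : ℤ, 0 ≤ t → t ≤ 5 → R t = a + k * t) : IsColumnVector P (1, 0) := by
  refine ⟨by simp [Prod.ext_iff], {z | z ∈ P ∧ z.1 - k * z.2 = a},
    edge_of_data ⟨1, -k, a, by norm_num, ?_, ?_, (R 0, (0 : ℤ)), ?_, (R 5, (5 : ℤ)), ?_, ?_⟩, ?_⟩
  · apply h.le
    intro s hs
    have := (h.mem_iff hR hK s).1 (h.mem hs)
    have h2 := this.2.2.1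
    rw [h1 _ this.1 this.2.1] at h2
    linarith
  · intro z; simp only [mem_ofPred_eq]; constructor
    · rintro ⟨a, b⟩; exact ⟨a, by linarith⟩
    · rintro ⟨a, b⟩; exact ⟨a, by linarith⟩
  · exact ⟨(hR 0 le_rfl (by norm_num)).1, by rw [h1 0 le_rfl (by norm_num)]; push_cast; ring⟩
  · exact ⟨(hR 5 (by norm_num) le_rfl).1, by rw [h1 5 (by norm_num) le_rfl]; push_cast; ring⟩
  · intro he; rw [Prod.ext_iff] at he; norm_num at he
  · rintro ⟨x, t⟩ ⟨hp, hn⟩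
    have hp' := (h.mem_iff hR hK _).1 hp
    obtain ⟨t0, t5, c, b⟩ := hp'
    simp only at t0 t5 c b
    rw [h.mem_iff hR hK]
    simp only [Prod.mk_add_mk, add_zero]
    refine ⟨t0, t5, ?_, by push_cast; linarith⟩
    rw [h1 t t0 t5] at c ⊢
    have hne : (x : ℝ) ≠ a + k * t := by
      intro he; exact hn ⟨hp, by simp only [latticeEmbed]; linarith⟩
    have hlt := lt_of_le_of_ne c hne
    have hlt' : x < a + k * t := by exact_mod_cast hlt
    have : x + 1 ≤ a + k * t := hlt'
    exact_mod_cast this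

lemma Good.col_left (h : Good S P) {R K : ℤ → ℝ} (hR : RTop P R) (hK : RBot P K) {a k : ℤ}
    (h1 : ∀ t : ℤ, 0 ≤ t → t ≤ 5 → K t = a + k * t) : IsColumnVector P (-1, 0) := by
  have h' := good_refl1 h
  have := h'.col_right (isTop_refl1.2 hK) (isBot_refl1.2 hR) h1
  have e : ∀ p, refl1 (latticeEmbed p) = latticeEmbed (-p.1, p.2) := by
    intro p; simp [refl1, latticeEmbed]
  have := zaff_col refl1_z h'.int e (A := fun p => (-p.1, p.2)) (by
    intro p v; simp; ring) (by
    have : Function.Involutive (fun p : ℤ × ℤ => (-p.1, p.2)) := by intro p; simp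
    exact this.bijective) (by
    have : Function.Involutive (fun p : ℤ × ℤ => (-p.1, p.2)) := by intro p; simp
    exact this.injective) (by simp) this
  rw [inv_image (φ := refl1) (ψ := refl1) (by intro p; simp [refl1])] at this
  simpa using this

lemma Good.col_vert (h : Good S P) {R K : ℤ → ℝ} (hR : RTop P R) (hK : RBot P K) {a k : ℤ}
    (h1 : ∀ t : ℤ, 0 ≤ t → t ≤ 5 → R t = a + k * t)
    {r0 r1 r2 r3 r4 r5 : ℤ} (e0 : K 0 = r0) (e1 : K 1 = r1) (e2 : K 2 = r2) (e3 : K 3 = r3)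
    (e4 : K 4 = r4) (e5 : K 5 = r5) (c1 : r0 + r2 ≤ 2 * r1) (c2 : r1 + r3 ≤ 2 * r2)
    (c3 : r2 + r4 ≤ 2 * r3) (c4 : r3 + r5 ≤ 2 * r4) (hd : (r1 - r0) - (r5 - r4) ≤ 1) :
    ∃ v : ℤ × ℤ, v.2 ≠ 0 ∧ IsColumnVector P v := by
  have e : ∀ x y : ℤ, x ≤ y → (x : ℝ) ≤ y := fun x y hh => by exact_mod_cast hh
  by_cases hk : -k ≤ r5 - r4
  · refine ⟨(k, 1), by simp, h.col_top hR hK ?_ ?_ ?_⟩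
    · intro t t0 t4
      rw [h1 t t0 (by omega), h1 (t + 1) (by omega) (by omega)]; push_cast; linarith
    · intro t t0 t4
      interval_cases t <;> norm_num <;> simp only [e0, e1, e2, e3, e4, e5]
      · have := e r0 (r1 + k) (by omega); push_cast at this; linarith
      · have := e r1 (r2 + k) (by omega); push_cast at this; linarith
      · have := e r2 (r3 + k) (by omega); push_cast at this; linarith
      · have := e r3 (r4 + k) (by omega); push_cast at this; linarith
      · have := e r4 (r5 + k) (by omega); push_cast at this; linarith
    · have := h.lt hR hK (t := 4) (by norm_num) (by norm_num)
      rw [e4, h1 4 (by norm_num) (by norm_num)] at this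
      rw [e5, h1 5 (by norm_num) (by norm_num)]
      have := e r4 (r5 + k) (by omega); push_cast at *; linarith
  · refine ⟨(-k, -1), by simp, h.col_bot hR hK ?_ ?_ ?_⟩
    · intro t t0 t4
      rw [h1 t t0 (by omega), h1 (t + 1) (by omega) (by omega)]; push_cast; linarith
    · intro t t0 t4
      interval_cases t <;> norm_num <;> simp only [e0, e1, e2, e3, e4, e5]
      · have := e (r1 + k) r0 (by omega); push_cast at this; linarith
      · have := e (r2 + k) r1 (by omega); push_cast at this; linarith
      · have := e (r3 + k) r2 (by omega); push_cast at this; linarith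
      · have := e (r4 + k) r3 (by omega); push_cast at this; linarith
      · have := e (r5 + k) r4 (by omega); push_cast at this; linarith
    · have := h.lt hR hK (t := 1) (by norm_num) (by norm_num)
      rw [e1, h1 1 (by norm_num) (by norm_num)] at this
      rw [e0, h1 0 (by norm_num) (by norm_num)]
      have := e (r1 + k) r0 (by omega); push_cast at *; linarith

lemma lin_of {R : ℤ → ℝ} {r0 r1 r2 r3 r4 r5 k : ℤ} (e0 : R 0 = r0) (e1 : R 1 = r1) (e2 : R 2 = r2)
    (e3 : R 3 = r3) (e4 : R 4 = r4) (e5 : R 5 = r5) (h : r1 = r0 + k ∧ r2 = r0 + 2 * k ∧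
    r3 = r0 + 3 * k ∧ r4 = r0 + 4 * k ∧ r5 = r0 + 5 * k) :
    ∀ t : ℤ, 0 ≤ t → t ≤ 5 → R t = r0 + k * t := by
  obtain ⟨f1, f2, f3, f4, f5⟩ := h
  intro t t0 t5
  interval_cases t
  · rw [e0]; push_cast; ring
  · rw [e1, f1]; push_cast; ring
  · rw [e2, f2]; push_cast; ring
  · rw [e3, f3]; push_cast; ring
  · rw [e4, f4]; push_cast; ring
  · rw [e5, f5]; push_cast; ring

lemma Good.boundA (h : Good S P) (hm : IsMaximalPolygon P) {R K : ℤ → ℝ} (hR : RTop P R)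
    (hK : RBot P K) {p0 : ℤ × ℤ} (hp0 : latticeEmbed p0 ∈ interior P) {a k : ℤ}
    (h1 : ∀ t : ℤ, 0 ≤ t → t ≤ 5 → R t = a + k * t) : 6 ≤ EE K + 2 * columnVectorCount P := by
  classical
  have hfin := col_finite (latpoly_compact h.poly) hp0
  have c1 := h.col_right hR hK h1
  have lower : ∀ T : Finset (ℤ × ℤ), (∀ v ∈ T, IsColumnVector P v) → T.card ≤ columnVectorCount P := by
    intro T hT
    rw [← ncard_coe_finset]
    exact ncard_le_ncard (fun v hv => hT v hv) hfin
  rcases (good_refl1 h).EE_cases2 (zaff_max refl1_z hm) (isTop_refl1.2 hK) with h4 |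
    ⟨r0, r1, r2, r3, r4, r5, e0, e1, e2, e3, e4, e5, d1, d2, d3, d4, hd, hh⟩
  · have := lower {(1, 0)} (by simpa using c1)
    simp at this
    omega
  · obtain ⟨v, hv, cv⟩ := h.col_vert hR hK h1 e0 e1 e2 e3 e4 e5 d1 d2 d3 d4 hd
    rcases hh with h3 | ⟨hz, k', hk'⟩
    · have := lower {(1, 0), v} (by simp [c1, cv])
      rw [Finset.card_pair (by rintro rfl; simp at hv)] at this
      omega
    · have c2 := h.col_left hR hK (lin_of e0 e1 e2 e3 e4 e5 hk')
      have := lower {(1, 0), (-1, 0), v} (by simp [c1, c2, cv])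
      rw [Finset.card_insert_of_notMem, Finset.card_pair (by rintro rfl; simp at hv)] at this
      · omega
      · simp only [Finset.mem_insert, Finset.mem_singleton]
        rintro (hh | rfl)
        · norm_num at hh
        · simp at hv

theorem Good.bound (h : Good S P) (hm : IsMaximalPolygon P) {p0 : ℤ × ℤ}
    (hp0 : latticeEmbed p0 ∈ interior P) :
    2 * (boundaryLatticeCount P : ℤ) ≤ polygonGenus P + 18 + 2 * columnVectorCount P := by
  obtain ⟨R, hR⟩ := h.exists_top
  obtain ⟨K, hK⟩ := h.exists_bot
  have key : 6 ≤ EE R + EE K + 2 * columnVectorCount P := by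
    rcases h.EE_cases2 hm hR with h4 |
      ⟨r0, r1, r2, r3, r4, r5, e0, e1, e2, e3, e4, e5, d1, d2, d3, d4, hd, h3 | ⟨hz, k', hk'⟩⟩
    rotate_left 2
    · have := h.boundA hm hR hK hp0 (lin_of e0 e1 e2 e3 e4 e5 hk')
      omega
    all_goals
      rcases (good_refl1 h).EE_cases2 (zaff_max refl1_z hm) (isTop_refl1.2 hK) with h4' |
        ⟨r0, r1, r2, r3, r4, r5, e0, e1, e2, e3, e4, e5, d1, d2, d3, d4, hd, h3' | ⟨hz, k', hk'⟩⟩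
      · omega
      · omega
      · have := (good_refl1 h).boundA (zaff_max refl1_z hm) (isTop_refl1.2 hK) (isBot_refl1.2 hR)
          (p0 := (-p0.1, p0.2)) (by
            rw [zaff_interior refl1_z]
            exact ⟨_, hp0, by simp [refl1, latticeEmbed]⟩) (lin_of e0 e1 e2 e3 e4 e5 hk')
        have := zaff_colcount refl1_z (latpoly_compact h.poly) hp0
        omega
  have g1 := h.genus hR hK
  have g2 := h.total hR hK
  obtain ⟨a0, ha0⟩ := h.int0 hR
  obtain ⟨a5, ha5⟩ := h.int5 hR
  obtain ⟨b0, hb0⟩ := (good_refl1 h).int0 (isTop_refl1.2 hK)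
  obtain ⟨b5, hb5⟩ := (good_refl1 h).int5 (isTop_refl1.2 hK)
  unfold EE at key
  rw [ha0, ha5, hb0, hb5] at key g2
  simp only [Int.ceil_intCast, Int.floor_intCast] at key g2
  omega

end

lemma top_rows {S : Finset (ℤ × ℤ)} {P : Set (ℝ × ℝ)}
    (hP : P = convexHull ℝ (latticeEmbed '' (S : Set (ℤ × ℤ))))
    (hrow : ∀ p ∈ interiorLatticePoints P, 1 ≤ p.2 ∧ p.2 ≤ 4) (hg : 12 ≤ polygonGenus P) :
    ∀ s ∈ S, s.2 ≤ 5 := by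
  rintro ⟨σ, h⟩ hs
  by_contra hc
  simp only at hc
  obtain ⟨n, hn⟩ : ∃ n : ℤ, h = n + 5 := ⟨h - 5, by ring⟩
  have hn1 : 1 ≤ n := by omega
  have hn1' : (1 : ℝ) ≤ n := by exact_mod_cast hn1
  have hconv : Convex ℝ P := by rw [hP]; exact convex_convexHull _ _
  have hsP : ((σ : ℝ), (h : ℝ)) ∈ P := by
    rw [hP]; exact subset_convexHull _ _ ⟨(σ, h), hs, rfl⟩
  -- crossing
  have cross : ∀ p ∈ interiorLatticePoints P,
      ((p.1 * n + σ * (5 - p.2)) / (n + (5 - p.2) : ℝ), (5 : ℝ)) ∈ interior P := by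
    intro p hp
    have hr := hrow p hp
    have hr1 : (p.2 : ℝ) ≤ 4 := by exact_mod_cast hr.2
    have hpos : (0 : ℝ) < n + (5 - p.2) := by linarith
    have hθ1 : (5 - (p.2 : ℝ)) / (n + (5 - p.2)) < 1 := by
      rw [div_lt_one hpos]; linarith
    have hθ0 : 0 ≤ (5 - (p.2 : ℝ)) / (n + (5 - p.2)) := div_nonneg (by linarith) hpos.le
    have := seg_int hconv (x := p.1) (y := p.2) hp hsP hθ0 hθ1
    convert this using 2
    · field_simp; ring
    · rw [hn]; push_cast; field_simp; ring
  have hne : (interiorLatticePoints P).Nonempty := by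
    by_contra hh
    rw [not_nonempty_iff_eq_empty] at hh
    unfold polygonGenus at hg
    rw [hh, ncard_empty] at hg; omega
  have no5 : ∀ m : ℤ, ((m : ℝ), (5 : ℝ)) ∉ interior P := by
    intro m hm
    have := hrow (m, 5) (by simpa [interiorLatticePoints, latticeEmbed] using hm)
    simp at this
  obtain ⟨p0, hp0⟩ := hne
  have c0 := cross p0 hp0
  set x0 := (p0.1 * n + σ * (5 - p0.2)) / (n + (5 - p0.2) : ℝ) with hx0
  set m := ⌊x0⌋ with hm
  have between : ∀ (x : ℝ) (k : ℤ), (x, (5 : ℝ)) ∈ interior P → ¬ (x ≤ k ∧ (k : ℝ) ≤ x0) ∧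
      ¬ (x0 ≤ k ∧ (k : ℝ) ≤ x) := by
    have seg : ∀ (x y : ℝ) (k : ℤ), (x, (5 : ℝ)) ∈ interior P → (y, (5 : ℝ)) ∈ interior P →
        ¬ (x ≤ k ∧ (k : ℝ) ≤ y) := by
      rintro x y k hx hy ⟨h1, h2⟩
      rcases eq_or_lt_of_le (h1.trans h2) with h12 | h12
      · have : x = k := by linarith
        rw [this] at hx; exact no5 k hx
      · have := comb hconv.interior hx hy (θ := (k - x) / (y - x))
          (div_nonneg (by linarith) (by linarith)) (by rw [div_le_one (by linarith)]; linarith)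
        apply no5 k
        convert this using 2
        · have : y - x ≠ 0 := by linarith
          field_simp; ring
        · ring
    intro x k hx
    exact ⟨seg x x0 k hx c0, seg x0 x k c0 hx⟩
  have fl := Int.floor_le x0
  have fl' := Int.lt_floor_add_one x0
  rw [← hm] at fl fl'
  have range : ∀ p ∈ interiorLatticePoints P,
      m * (n + (5 - p.2)) < p.1 * n + σ * (5 - p.2) ∧
      p.1 * n + σ * (5 - p.2) < (m + 1) * (n + (5 - p.2)) := by
    intro p hp
    have hr := hrow p hp
    have hr1 : (p.2 : ℝ) ≤ 4 := by exact_mod_cast hr.2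
    have hpos : (0 : ℝ) < n + (5 - p.2) := by linarith
    have b1 := (between _ m (cross p hp)).1
    have b2 := (between _ (m + 1) (cross p hp)).2
    push_cast at b2
    have g1 : (m : ℝ) < (p.1 * n + σ * (5 - p.2)) / (n + (5 - p.2)) := by
      by_contra hh
      push Not at hh
      exact b1 ⟨hh, fl⟩
    have g2 : (p.1 * n + σ * (5 - p.2)) / (n + (5 - p.2) : ℝ) < m + 1 := by
      by_contra hh
      push Not at hh
      exact b2 ⟨fl'.le, hh⟩
    rw [lt_div_iff₀ hpos] at g1
    rw [div_lt_iff₀ hpos] at g2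
    constructor
    · exact_mod_cast g1
    · exact_mod_cast g2
  set q : ℤ → ℤ := fun t => (m * (n + (5 - t)) - σ * (5 - t)) / n with hq
  have hcard := ncard_rows (Finset.Icc (1 : ℤ) 4) (fun t => q t + 1) (fun t => q t + (5 - t))
  rw [sum14] at hcard
  have e10 : {p : ℤ × ℤ | p.2 ∈ Finset.Icc (1 : ℤ) 4 ∧ q p.2 + 1 ≤ p.1 ∧
      p.1 ≤ q p.2 + (5 - p.2)}.ncard = 10 := by
    rw [hcard]; omega
  have hsub : interiorLatticePoints P ⊆ {p : ℤ × ℤ | p.2 ∈ Finset.Icc (1 : ℤ) 4 ∧ q p.2 + 1 ≤ p.1 ∧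
      p.1 ≤ q p.2 + (5 - p.2)} := by
    intro p hp
    have hr := hrow p hp
    obtain ⟨r1, r2⟩ := range p hp
    set u := 5 - p.2 with hu
    set α := m * (n + u) - σ * u with hα
    have hq' : q p.2 = α / n := rfl
    have d1 := Int.emod_add_mul_ediv α n
    have d2 := Int.emod_nonneg α (by omega : n ≠ 0)
    have d3 := Int.emod_lt_of_pos α (by omega : 0 < n)
    rw [← hq'] at d1
    refine ⟨by simpa using hr, ?_, ?_⟩
    · have : n * q p.2 < n * p.1 := by nlinarith
      have := lt_of_mul_lt_mul_left this (by omega)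
      omega
    · have hmul : 0 ≤ (n - 1) * (u - 1) := mul_nonneg (by omega) (by omega)
      have : n * p.1 < n * (q p.2 + u + 1) := by nlinarith
      have := lt_of_mul_lt_mul_left this (by omega)
      omega
  have := ncard_le_ncard hsub (finite_of_ncard_ne_zero (by rw [e10]; norm_num))
  rw [e10] at this
  unfold polygonGenus at hg
  omega

lemma strip_hull {P : Set (ℝ × ℝ)} {ψ : ℝ × ℝ → ℝ × ℝ} (hψ : IsZAffine ψ) {w : ℝ}
    (h : ∀ p ∈ interiorLatticePoints P, 0 ≤ (ψ (latticeEmbed p)).2 ∧ (ψ (latticeEmbed p)).2 ≤ w) :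
    ψ '' interiorPolygon P ⊆ strip w := by
  unfold interiorPolygon
  rw [zaff_hull hψ]
  intro z hz
  constructor
  · have := hull_le (α := 0) (β := -1) (m := 0) (by
      rintro _ ⟨_, ⟨p, hp, rfl⟩, rfl⟩
      have := (h p hp).1; linarith) z hz
    linarith
  · have := hull_le (α := 0) (β := 1) (m := w) (by
      rintro _ ⟨_, ⟨p, hp, rfl⟩, rfl⟩
      have := (h p hp).2; linarith) z hz
    linarith

theorem upper {P : Set (ℝ × ℝ)} (hm : IsMaximalPolygon P) (hg : 12 ≤ polygonGenus P)
    (he : ExpectedGonalityIs P 5) :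
    2 * (boundaryLatticeCount P : ℤ) ≤ polygonGenus P + 18 + 2 * columnVectorCount P := by
  rcases he with ⟨-, h53⟩ | ⟨-, w, hw, h5⟩
  · omega
  obtain rfl : w = 3 := by omega
  obtain ⟨⟨-, φ, hφ, hsub⟩, hmin⟩ := hw
  obtain ⟨a, b, c, d, e, f, hdet, hφf⟩ := hφ
  set Φ : ℝ × ℝ → ℝ × ℝ := fun z => ((φ z).1, (φ z).2 + 1) with hΦ
  have hΦz : IsZAffine Φ := ⟨a, b, c, d, e, f + 1, hdet, fun p => by
    simp only [hΦ, hφf]; push_cast; ext <;> simp; ring⟩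
  have hφz : IsZAffine φ := ⟨a, b, c, d, e, f, hdet, hφf⟩
  have hφ'z : IsZAffine (fun z => ((φ z).1, (φ z).2 - 1)) := ⟨a, b, c, d, e, f - 1, hdet, fun p => by
    simp only [hφf]; push_cast; ext <;> simp; ring⟩
  obtain ⟨E, A, hE, -, hb, -, -⟩ := zaff_int hΦz
  have hE2 : ∀ p, (φ (latticeEmbed p)).2 = (E p).2 - 1 := by
    intro p
    have := congrArg Prod.snd (hE p)
    simp only [hΦ, latticeEmbed] at this
    simp only [latticeEmbed]; linarith
  have row : ∀ p ∈ interiorLatticePoints P, 1 ≤ (E p).2 ∧ (E p).2 ≤ 4 := by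
    intro p hp
    have : φ (latticeEmbed p) ∈ strip ((3 : ℕ) : ℝ) :=
      hsub ⟨_, subset_convexHull _ _ (mem_image_of_mem _ hp), rfl⟩
    obtain ⟨s1, s2⟩ := this
    rw [hE2] at s1 s2
    constructor
    · have : (1 : ℝ) ≤ (E p).2 := by linarith
      exact_mod_cast this
    · have : ((E p).2 : ℝ) ≤ 4 := by push_cast at s2; linarith
      exact_mod_cast this
  have ex4 : ∃ p ∈ interiorLatticePoints P, (E p).2 = 4 := by
    by_contra hc
    push Not at hc
    have : 3 ≤ 2 := hmin ⟨by norm_num, φ, hφz, strip_hull hφz (by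
      intro p hp
      have h1 := row p hp
      have h2 : (E p).2 ≤ 3 := by have := hc p hp; omega
      have h3 : (1 : ℝ) ≤ (E p).2 := by exact_mod_cast h1.1
      have h4 : ((E p).2 : ℝ) ≤ 3 := by exact_mod_cast h2
      rw [hE2]; push_cast; constructor <;> linarith)⟩
    omega
  have ex1 : ∃ p ∈ interiorLatticePoints P, (E p).2 = 1 := by
    by_contra hc
    push Not at hc
    have : 3 ≤ 2 := hmin ⟨by norm_num, _, hφ'z, strip_hull hφ'z (by
      intro p hp
      have h1 := row p hp
      have h2 : 2 ≤ (E p).2 := by have := hc p hp; omega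
      have h3 : (2 : ℝ) ≤ (E p).2 := by exact_mod_cast h2
      have h4 : ((E p).2 : ℝ) ≤ 4 := by exact_mod_cast h1.2
      simp only [hE2]; push_cast; constructor <;> linarith)⟩
    omega
  have hm' := zaff_max hΦz hm
  have hgen := zaff_genus hΦz P
  have hbd := zaff_bdry hΦz P
  have row' : ∀ q ∈ interiorLatticePoints (Φ '' P), 1 ≤ q.2 ∧ q.2 ≤ 4 := by
    intro q hq
    obtain ⟨p, rfl⟩ := hb.2 q
    exact row p ((zaff_ilp hΦz P hE p).1 hq)
  obtain ⟨p4, hp4, h4⟩ := ex4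
  obtain ⟨p1, hp1, h1⟩ := ex1
  have hp4' := (zaff_ilp hΦz P hE p4).2 hp4
  have hp1' := (zaff_ilp hΦz P hE p1).2 hp1
  have hcol := zaff_colcount hΦz (latpoly_compact hm.1) hp4
  obtain ⟨S, hS, hPS⟩ := hm'.1
  set P' := Φ '' P with hP'
  have hup : ∀ s ∈ S, s.2 ≤ 5 := top_rows hPS row' (by omega)
  have hlo : ∀ s ∈ S, 0 ≤ s.2 := by
    have hr2 : refl2 '' P' = convexHull ℝ (latticeEmbed ''
        ((S.image fun p : ℤ × ℤ => (p.1, 5 - p.2) : Finset (ℤ × ℤ)) : Set (ℤ × ℤ))) := by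
      rw [hPS, zaff_hull refl2_z, Finset.coe_image, image_image, image_image]
      simp [refl2, latticeEmbed]
    have := top_rows hr2 (by
      intro q hq
      simp only [interiorLatticePoints, mem_ofPred_eq, zaff_interior refl2_z, latticeEmbed] at hq
      rw [mem_refl2] at hq
      have := row' (q.1, 5 - q.2) (by
        simp only [interiorLatticePoints, mem_ofPred_eq, latticeEmbed]; push_cast; exact hq)
      simp only at this; omega) (by rw [zaff_genus refl2_z]; omega)
    intro s hs
    have := this (s.1, 5 - s.2) (Finset.mem_image_of_mem _ hs)
    simp only at this; omega
  have good : Good S P' := by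
    refine ⟨hPS, fun s hs => ⟨hlo s hs, hup s hs⟩, ?_, ?_, ⟨_, hp4'⟩⟩
    · by_contra hc
      push Not at hc
      have := interior_strict (P := P') (α := 0) (β := -1) (m := -1) (by norm_num) (by
        rw [hPS]; apply hull_le
        rintro _ ⟨s, hs, rfl⟩
        have : 1 ≤ s.2 := by have := hc s hs; have := hlo s hs; omega
        have : (1 : ℝ) ≤ s.2 := by exact_mod_cast this
        simp only [latticeEmbed]; linarith) hp1'
      simp only [latticeEmbed, h1] at this
      norm_num at this
    · by_contra hc
      push Not at hc
      have := interior_strict (P := P') (α := 0) (β := 1) (m := 4) (by norm_num) (by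
        rw [hPS]; apply hull_le
        rintro _ ⟨s, hs, rfl⟩
        have : s.2 ≤ 4 := by have := hc s hs; have := hup s hs; omega
        have : (s.2 : ℝ) ≤ 4 := by exact_mod_cast this
        simp only [latticeEmbed]; linarith) hp4'
      simp only [latticeEmbed, h4] at this
      norm_num at this
  have := good.bound hm' hp4'
  omega

noncomputable def exS (n s : ℤ) : Finset (ℤ × ℤ) :=
  (Finset.Icc 0 (n + 2) ×ˢ Finset.Icc 0 5).filter (fun p => p.2 - s ≤ p.1 ∧ p.1 ≤ n + p.2)

def exP (n s : ℤ) : Set (ℝ × ℝ) := convexHull ℝ (latticeEmbed '' (exS n s : Set (ℤ × ℤ)))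

def exH (n s : ℤ) : Prop :=
  (s = 0 ∧ 5 ≤ n) ∨ (s = 2 ∧ 3 ≤ n) ∨ (s = 3 ∧ 3 ≤ n) ∨ (s = 5 ∧ 3 ≤ n)

lemma mem_exS {n s x t : ℤ} : (x, t) ∈ exS n s ↔ 0 ≤ t ∧ t ≤ 5 ∧ 0 ≤ x ∧ t - s ≤ x ∧ x ≤ n + t ∧
    x ≤ n + 2 := by
  simp only [exS, Finset.mem_filter, Finset.mem_product, Finset.mem_Icc]
  omega

lemma exP_of {n s x t : ℤ} (h : (x, t) ∈ exS n s) : ((x : ℝ), (t : ℝ)) ∈ exP n s :=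
  subset_convexHull _ _ ⟨(x, t), h, rfl⟩

lemma exP_le {n s : ℤ} {z : ℝ × ℝ} (hz : z ∈ exP n s) :
    0 ≤ z.2 ∧ z.2 ≤ 5 ∧ 0 ≤ z.1 ∧ z.2 - s ≤ z.1 ∧ z.1 ≤ n + z.2 ∧ z.1 ≤ n + 2 := by
  have key : ∀ α β m : ℤ, (∀ x t : ℤ, (x, t) ∈ exS n s → α * x + β * t ≤ m) →
      (α : ℝ) * z.1 + β * z.2 ≤ m := by
    intro α β m h
    refine hull_le ?_ z hz
    rintro _ ⟨⟨x, t⟩, hs, rfl⟩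
    simp only [latticeEmbed]
    exact_mod_cast h x t hs
  have h1 := key 0 (-1) 0 (fun x t h => by rw [mem_exS] at h; omega)
  have h2 := key 0 1 5 (fun x t h => by rw [mem_exS] at h; omega)
  have h3 := key (-1) 0 0 (fun x t h => by rw [mem_exS] at h; omega)
  have h4 := key (-1) 1 s (fun x t h => by rw [mem_exS] at h; omega)
  have h5 := key 1 (-1) n (fun x t h => by rw [mem_exS] at h; omega)
  have h6 := key 1 0 (n + 2) (fun x t h => by rw [mem_exS] at h; omega)
  push_cast at *
  refine ⟨?_, ?_, ?_, ?_, ?_, ?_⟩ <;> linarith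

lemma exP_mem {n s x t : ℤ} : ((x : ℝ), (t : ℝ)) ∈ exP n s ↔ (x, t) ∈ exS n s := by
  refine ⟨fun h => ?_, exP_of⟩
  have := exP_le h
  simp only at this
  rw [mem_exS]
  exact_mod_cast this

lemma exP_mem' {n s : ℤ} (p : ℤ × ℤ) : latticeEmbed p ∈ exP n s ↔ 0 ≤ p.2 ∧ p.2 ≤ 5 ∧ 0 ≤ p.1 ∧
    p.2 - s ≤ p.1 ∧ p.1 ≤ n + p.2 ∧ p.1 ≤ n + 2 := by
  obtain ⟨x, t⟩ := p
  exact exP_mem.trans mem_exS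

lemma exP_int {n s : ℤ} (h : exH n s) : (interior (exP n s)).Nonempty := by
  unfold exH at h
  have hc : Convex ℝ (exP n s) := convex_convexHull _ _
  have a1 := exP_of (n := n) (s := s) (x := 2) (t := 1) (by rw [mem_exS]; omega)
  have a2 := exP_of (n := n) (s := s) (x := 3) (t := 1) (by rw [mem_exS]; omega)
  have a3 := exP_of (n := n) (s := s) (x := 2) (t := 2) (by rw [mem_exS]; omega)
  have a4 := exP_of (n := n) (s := s) (x := 3) (t := 2) (by rw [mem_exS]; omega)
  refine ⟨(5 / 2, 3 / 2), mem_interior.2 ⟨Ioo 2 3 ×ˢ Ioo 1 2, ?_, isOpen_Ioo.prod isOpen_Ioo, ?_⟩⟩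
  · rintro ⟨x, y⟩ ⟨⟨x1, x2⟩, y1, y2⟩
    simp only at x1 x2 y1 y2
    have b1 := comb hc a1 a2 (θ := x - 2) (by linarith) (by linarith)
    have b2 := comb hc a3 a4 (θ := x - 2) (by linarith) (by linarith)
    have b3 := comb hc b1 b2 (θ := y - 1) (by linarith) (by linarith)
    convert b3 using 2
    · push_cast; ring
    · push_cast; ring
  · constructor <;> constructor <;> norm_num

lemma exP_good {n s : ℤ} (h : exH n s) : Good (exS n s) (exP n s) := by
  refine ⟨rfl, ?_, ⟨(0, 0), ?_, rfl⟩, ⟨(n + 2, 5), ?_, rfl⟩, exP_int h⟩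
  · rintro ⟨x, t⟩ hs
    rw [mem_exS] at hs
    simp only; omega
  · unfold exH at h; rw [mem_exS]; omega
  · unfold exH at h; rw [mem_exS]; omega

lemma exP_top {n s : ℤ} (h : exH n s) :
    RTop (exP n s) (fun t => ((n + min t 2 : ℤ) : ℝ)) := by
  unfold exH at h
  intro t t0 t5
  refine ⟨exP_of (by rw [mem_exS]; omega), ?_⟩
  intro x hx
  have := exP_le hx
  simp only at this
  obtain ⟨-, -, -, -, a, b⟩ := this
  push_cast
  rcases min_cases (t : ℝ) 2 with ⟨e, -⟩ | ⟨e, -⟩ <;> rw [e] <;> linarith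

lemma exP_bot {n s : ℤ} (h : exH n s) :
    RBot (exP n s) (fun t => ((-max 0 (t - s) : ℤ) : ℝ)) := by
  unfold exH at h
  intro t t0 t5
  constructor
  · have := exP_of (n := n) (s := s) (x := max 0 (t - s)) (t := t) (by rw [mem_exS]; omega)
    convert this using 2
    push_cast; ring
  intro x hx
  have := exP_le hx
  simp only at this
  obtain ⟨-, -, a, b, -⟩ := this
  push_cast
  rcases max_cases (0 : ℝ) (t - s) with ⟨e, -⟩ | ⟨e, -⟩ <;> rw [e] <;> linarith

lemma exP_ilp {n s : ℤ} (h : exH n s) (p : ℤ × ℤ) : p ∈ interiorLatticePoints (exP n s) ↔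
    1 ≤ p.2 ∧ p.2 ≤ 4 ∧ p.1 < n + p.2 ∧ p.1 < n + 2 ∧ 0 < p.1 ∧ p.2 - s < p.1 := by
  refine ((exP_good h).int_iff (exP_top h) (exP_bot h) p).trans ?_
  have e1 : ((p.1 : ℝ) < ((n + min p.2 2 : ℤ) : ℝ)) ↔ p.1 < n + min p.2 2 := by exact_mod_cast Iff.rfl
  have e2 : (-(p.1 : ℝ) < ((-max 0 (p.2 - s) : ℤ) : ℝ)) ↔ -p.1 < -max 0 (p.2 - s) := by
    exact_mod_cast Iff.rfl
  rw [e1, e2]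
  omega

lemma exP_genus {n s : ℤ} (h : exH n s) : (polygonGenus (exP n s) : ℤ) =
    4 * n + 3 - max 0 (1 - s) - max 0 (2 - s) - max 0 (3 - s) - max 0 (4 - s) := by
  have := (exP_good h).genus (exP_top h) (exP_bot h)
  simp only [Int.ceil_intCast] at this
  omega

lemma exP_total {n s : ℤ} (h : exH n s) :
    (boundaryLatticeCount (exP n s) : ℤ) = 2 * n + s + 7 := by
  have := (exP_good h).total (exP_top h) (exP_bot h)
  simp only [Int.floor_intCast] at this
  have := exP_genus h
  unfold exH at h
  omega

lemma edgeMax {P Q : Set (ℝ × ℝ)} (hP : (interior P).Nonempty) (hPQ : P ⊆ Q) (hQ : Convex ℝ Q)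
    (hI : interiorLatticePoints Q = interiorLatticePoints P) {a b : ℝ × ℝ} {e : ℤ × ℤ}
    {u1 u2 c θ : ℝ} (hu : u1 ≠ 0 ∨ u2 ≠ 0)
    (ha : a ∈ P) (hb : b ∈ P) (hab : a ≠ b) (hle : ∀ z ∈ P, u1 * z.1 + u2 * z.2 ≤ c)
    (hua : u1 * a.1 + u2 * a.2 = c) (hub : u1 * b.1 + u2 * b.2 = c)
    (h0 : 0 < θ) (h1 : θ < 1) (he1 : (e.1 : ℝ) = (1 - θ) * a.1 + θ * b.1)
    (he2 : (e.2 : ℝ) = (1 - θ) * a.2 + θ * b.2) : ∀ z ∈ Q, u1 * z.1 + u2 * z.2 ≤ c := by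
  intro z hz
  by_contra hc
  push Not at hc
  obtain ⟨p, hp⟩ := hP
  have hup := interior_strict hu hle hp
  have : e ∈ interiorLatticePoints Q :=
    four hQ (⟨p, interior_mono hPQ hp⟩) (hPQ ha) (hPQ hb) (hPQ (interior_subset hp)) hz hab hua hub
      hup hc h0 h1 he1 he2
  rw [hI] at this
  have h2 := interior_strict hu hle this
  simp only [latticeEmbed, he1, he2] at h2
  have : u1 * ((1 - θ) * a.1 + θ * b.1) + u2 * ((1 - θ) * a.2 + θ * b.2) = c := by
    linear_combination (1 - θ) * hua + θ * hub
  linarith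

lemma exP_max {n s : ℤ} (h : exH n s) : IsMaximalPolygon (exP n s) := by
  refine ⟨(exP_good h).poly, ?_⟩
  intro Q hQ hPQ hI
  have hQc := latpoly_convex hQ
  have hne := exP_int h
  unfold exH at h
  -- integer-friendly version of edgeMax
  have key : ∀ (u1 u2 c xa ya xb yb xe ye i l : ℤ), (u1 ≠ 0 ∨ u2 ≠ 0) → (xa, ya) ∈ exS n s →
      (xb, yb) ∈ exS n s → (xa ≠ xb ∨ ya ≠ yb) →
      (∀ x t : ℤ, (x, t) ∈ exS n s → u1 * x + u2 * t ≤ c) → u1 * xa + u2 * ya = c →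
      u1 * xb + u2 * yb = c → 0 < i → i < l → l * xe = (l - i) * xa + i * xb →
      l * ye = (l - i) * ya + i * yb → ∀ x t : ℤ, ((x : ℝ), (t : ℝ)) ∈ Q → u1 * x + u2 * t ≤ c := by
    intro u1 u2 c xa ya xb yb xe ye i l hu ha hb hab hle hua hub hi hil hxe hye x t hxt
    have hl0 : (0 : ℝ) < l := by exact_mod_cast hi.trans hil
    have hi0 : (0 : ℝ) < i := by exact_mod_cast hi
    have hil' : (i : ℝ) < l := by exact_mod_cast hil
    have hxe' : (l : ℝ) * xe = (l - i) * xa + i * xb := by exact_mod_cast hxe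
    have hye' : (l : ℝ) * ye = (l - i) * ya + i * yb := by exact_mod_cast hye
    have := edgeMax hne hPQ hQc hI (a := ((xa : ℝ), (ya : ℝ))) (b := ((xb : ℝ), (yb : ℝ)))
      (e := (xe, ye)) (u1 := u1) (u2 := u2) (c := c) (θ := i / l) (by exact_mod_cast hu)
      (exP_of ha) (exP_of hb) (by
        intro hh; simp only [Prod.mk.injEq, Int.cast_inj] at hh; omega) (by
        apply hull_le
        rintro _ ⟨⟨x, t⟩, hs, rfl⟩
        simp only [latticeEmbed]
        exact_mod_cast hle x t hs) (by simp only; exact_mod_cast hua) (by simp only; exact_mod_cast hub)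
        (div_pos hi0 hl0) (by rw [div_lt_one hl0]; exact hil')
        (by simp only; field_simp; linarith) (by simp only; field_simp; linarith) _ hxt
    simp only at this
    exact_mod_cast this
  apply Subset.antisymm _ hPQ
  obtain ⟨T, hT, hQT⟩ := hQ
  conv_lhs => rw [hQT]
  apply convexHull_mono
  rintro _ ⟨⟨x, t⟩, hxt, rfl⟩
  refine ⟨(x, t), ?_, rfl⟩
  have hin : ((x : ℝ), (t : ℝ)) ∈ Q := by
    rw [hQT]; exact subset_convexHull _ _ ⟨(x, t), hxt, rfl⟩
  have k1 := key 0 (-1) 0 0 0 n 0 1 0 1 n (by omega) (by rw [mem_exS]; omega) (by rw [mem_exS]; omega)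
    (by omega) (fun x t hh => by rw [mem_exS] at hh; omega) (by omega) (by omega) (by omega)
    (by omega) (by ring) (by ring) x t hin
  have k2 := key 0 1 5 (5 - s) 5 (n + 2) 5 (6 - s) 5 1 (n + s - 3) (by omega)
    (by rw [mem_exS]; omega) (by rw [mem_exS]; omega)
    (by omega) (fun x t hh => by rw [mem_exS] at hh; omega) (by omega) (by omega) (by omega)
    (by omega) (by ring) (by ring) x t hin
  have k3 := key 1 (-1) n n 0 (n + 2) 2 (n + 1) 1 1 2 (by omega)
    (by rw [mem_exS]; omega) (by rw [mem_exS]; omega)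
    (by omega) (fun x t hh => by rw [mem_exS] at hh; omega) (by omega) (by omega) (by omega)
    (by omega) (by ring) (by ring) x t hin
  have k4 := key 1 0 (n + 2) (n + 2) 2 (n + 2) 5 (n + 2) 3 1 3 (by omega)
    (by rw [mem_exS]; omega) (by rw [mem_exS]; omega)
    (by omega) (fun x t hh => by rw [mem_exS] at hh; omega) (by omega) (by omega) (by omega)
    (by omega) (by ring) (by ring) x t hin
  have k5 : s ≠ 0 → -1 * x + 0 * t ≤ 0 := fun hs0 =>
    key (-1) 0 0 0 0 0 s 0 1 1 s (by omega)
    (by rw [mem_exS]; omega) (by rw [mem_exS]; omega)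
    (by omega) (fun x t hh => by rw [mem_exS] at hh; omega) (by omega) (by omega) (by omega)
    (by omega) (by ring) (by ring) x t hin
  have k6 : s ≠ 5 → -1 * x + 1 * t ≤ s := fun hs0 =>
    key (-1) 1 s 0 s (5 - s) 5 1 (s + 1) 1 (5 - s) (by omega)
    (by rw [mem_exS]; omega) (by rw [mem_exS]; omega)
    (by omega) (fun x t hh => by rw [mem_exS] at hh; omega) (by omega) (by omega) (by omega)
    (by omega) (by ring) (by ring) x t hin
  rw [Finset.mem_coe, mem_exS]
  omega

lemma exP_lw {n s : ℤ} (h : exH n s) : LatticeWidthIs (interiorPolygon (exP n s)) 3 := by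
  constructor
  · have hz : IsZAffine (fun z => (z.1, z.2 - 1)) :=
      ⟨1, 0, 0, 1, 0, -1, by norm_num, fun p => by simp; ring⟩
    refine ⟨by norm_num, _, hz, strip_hull hz ?_⟩
    intro p hp
    rw [exP_ilp h] at hp
    have a : (1 : ℝ) ≤ p.2 := by exact_mod_cast hp.1
    have b : (p.2 : ℝ) ≤ 4 := by exact_mod_cast hp.2.1
    simp only [latticeEmbed]
    push_cast
    constructor <;> linarith
  · rintro w ⟨w0, φ, ⟨a, b, c, d, e, f, hdet, hφ⟩, hsub⟩
    by_contra hw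
    push Not at hw
    have key : ∀ x t : ℤ, (x, t) ∈ interiorLatticePoints (exP n s) →
        0 ≤ c * x + d * t + f ∧ c * x + d * t + f ≤ w := by
      intro x t hp
      have : φ (latticeEmbed (x, t)) ∈ strip (w : ℝ) :=
        hsub ⟨_, subset_convexHull _ _ (mem_image_of_mem _ hp), rfl⟩
      rw [hφ] at this
      obtain ⟨h1, h2⟩ := this
      simp only [latticeEmbed] at h1 h2
      exact ⟨by exact_mod_cast h1, by exact_mod_cast h2⟩
    have h' := h
    unfold exH at h'
    have i1 := key 3 2 (by rw [exP_ilp h]; simp only; omega)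
    have i3 := key 2 1 (by rw [exP_ilp h]; simp only; omega)
    have i4 := key (n + 1) 4 (by rw [exP_ilp h]; simp only; omega)
    have hc : c = 0 := by
      by_cases hs : s = 0
      · have i2 := key 6 2 (by rw [exP_ilp h]; simp only; omega)
        omega
      · have i5 := key 1 2 (by rw [exP_ilp h]; simp only; omega)
        have i2 := key 4 2 (by rw [exP_ilp h]; simp only; omega)
        omega
    subst hc
    have hd : d = 0 := by omega
    subst hd
    omega

lemma upsilon_genus : polygonGenus twoUpsilon ≤ 9 := by
  have key : ∀ α β m : ℝ, (α * (-2) + β * (-2) ≤ m) → (α * 2 + β * 0 ≤ m) → (α * 0 + β * 2 ≤ m) →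
      ∀ z ∈ twoUpsilon, α * z.1 + β * z.2 ≤ m := by
    intro α β m h1 h2 h3
    apply hull_le
    intro z hz
    simp only [mem_insert_iff, mem_singleton_iff] at hz
    rcases hz with rfl | rfl | rfl
    · exact h1
    · exact h2
    · exact h3
  have hsub : interiorLatticePoints twoUpsilon ⊆
      ((Finset.Icc (-1) 1 ×ˢ Finset.Icc (-1) 1 : Finset (ℤ × ℤ)) : Set (ℤ × ℤ)) := by
    intro p hp
    have a1 := interior_strict (by norm_num)
      (key 1 0 2 (by norm_num) (by norm_num) (by norm_num)) hp
    have a2 := interior_strict (by norm_num)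
      (key (-1) 0 2 (by norm_num) (by norm_num) (by norm_num)) hp
    have a3 := interior_strict (by norm_num)
      (key 0 1 2 (by norm_num) (by norm_num) (by norm_num)) hp
    have a4 := interior_strict (by norm_num)
      (key 0 (-1) 2 (by norm_num) (by norm_num) (by norm_num)) hp
    simp only [latticeEmbed] at a1 a2 a3 a4
    have b1 : p.1 < 2 := by have : (p.1 : ℝ) < 2 := by linarith
                            exact_mod_cast this
    have b2 : -2 < p.1 := by have : (-2 : ℝ) < p.1 := by linarith
                             exact_mod_cast this
    have b3 : p.2 < 2 := by have : (p.2 : ℝ) < 2 := by linarith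
                            exact_mod_cast this
    have b4 : -2 < p.2 := by have : (-2 : ℝ) < p.2 := by linarith
                             exact_mod_cast this
    simp only [Finset.mem_coe, Finset.mem_product, Finset.mem_Icc]
    omega
  have := ncard_le_ncard hsub (Finset.finite_toSet _)
  rw [ncard_coe_finset] at this
  exact this

lemma exP_egon {n s : ℤ} (h : exH n s) (hg : 12 ≤ polygonGenus (exP n s)) :
    ExpectedGonalityIs (exP n s) 5 := by
  right
  refine ⟨?_, 3, exP_lw h, rfl⟩
  rintro ⟨φ, hφ, he⟩
  have := zaff_genus hφ (exP n s)
  rw [he] at this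
  have := upsilon_genus
  omega

lemma exP_col {n s : ℤ} (h : exH n s) {v : ℤ × ℤ} (hv : IsColumnVector (exP n s) v) :
    (s = 5 ∧ (v = (0, 1) ∨ v = (-1, 0))) ∨ (s = 0 ∧ (v = (-1, -1) ∨ v = (-1, 0))) := by
  obtain ⟨hv0, τ, hτ, hcol⟩ := hv
  obtain ⟨α, β, m, hne, hle, hmem, -⟩ := data_of_edge (exP_int h) hτ
  obtain ⟨a, b⟩ := v
  have hab : ¬ (a = 0 ∧ b = 0) := by
    rintro ⟨rfl, rfl⟩; exact hv0 rfl
  unfold exH at h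
  have key : ∀ x t : ℤ, (x, t) ∈ exS n s → (x + a, t + b) ∉ exS n s → α * x + β * t = m := by
    intro x t h1 h2
    by_contra hc
    have := hcol (x, t) ⟨exP_of h1, fun hh => hc ((hmem _).1 hh).2⟩
    exact h2 (exP_mem.1 this)
  have key2 : ∀ x t : ℤ, (x, t) ∈ exS n s → α * x + β * t ≠ m → (x + a, t + b) ∈ exS n s := by
    intro x t h1 h2
    by_contra hc
    exact h2 (key x t h1 hc)
  rcases lt_trichotomy b 0 with hb | hb | hb
  · have p1 := key 0 0 (by rw [mem_exS]; omega) (by rw [mem_exS]; omega)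
    have p2 := key n 0 (by rw [mem_exS]; omega) (by rw [mem_exS]; omega)
    push_cast at p1 p2
    have hm : m = 0 := by linarith
    subst hm
    have hn : (n : ℝ) ≠ 0 := by
      have : n ≠ 0 := by omega
      exact_mod_cast this
    have hα : α = 0 := by
      have : α * n = 0 := by linarith
      exact (mul_eq_zero.1 this).resolve_right hn
    subst hα
    have hβ : β ≠ 0 := by simpa using hne
    have q1 := key2 (n + 1) 1 (by rw [mem_exS]; omega) (by simpa using hβ)
    rw [mem_exS] at q1
    by_cases hs : s = 0
    · have q2 := key2 1 1 (by rw [mem_exS]; omega) (by simpa using hβ)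
      rw [mem_exS] at q2
      right
      refine ⟨hs, Or.inl ?_⟩
      rw [Prod.mk.injEq]; omega
    · have q2 := key2 0 1 (by rw [mem_exS]; omega) (by simpa using hβ)
      rw [mem_exS] at q2
      omega
  · subst hb
    rcases lt_or_gt_of_ne (show a ≠ 0 by omega) with ha | ha
    · have p1 := key 0 0 (by rw [mem_exS]; omega) (by rw [mem_exS]; omega)
      have p2 := key 0 s (by rw [mem_exS]; omega) (by rw [mem_exS]; omega)
      have p3 := key (5 - s) 5 (by rw [mem_exS]; omega) (by rw [mem_exS]; omega)
      push_cast at p1 p2 p3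
      have hm : m = 0 := by linarith
      subst hm
      have fin : α ≠ 0 → a = -1 := by
        intro hα
        have q1 := key2 1 0 (by rw [mem_exS]; omega) (by simpa using hα)
        rw [mem_exS] at q1
        omega
      rcases h with ⟨rfl, hn⟩ | ⟨rfl, hn⟩ | ⟨rfl, hn⟩ | ⟨rfl, hn⟩
      · right
        refine ⟨rfl, Or.inr ?_⟩
        rw [Prod.mk.injEq]; refine ⟨fin ?_, rfl⟩
        rintro rfl
        push_cast at p3
        rcases hne with h | h
        · exact h rfl
        · apply h; linarith
      · exfalso; push_cast at p2 p3
        rcases hne with h | h <;> apply h <;> linarith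
      · exfalso; push_cast at p2 p3
        rcases hne with h | h <;> apply h <;> linarith
      · left
        refine ⟨rfl, Or.inr ?_⟩
        rw [Prod.mk.injEq]; refine ⟨fin ?_, rfl⟩
        rintro rfl
        push_cast at p2
        rcases hne with h | h
        · exact h rfl
        · apply h; linarith
    · exfalso
      have p1 := key n 0 (by rw [mem_exS]; omega) (by rw [mem_exS]; omega)
      have p2 := key (n + 2) 2 (by rw [mem_exS]; omega) (by rw [mem_exS]; omega)
      have p3 := key (n + 2) 5 (by rw [mem_exS]; omega) (by rw [mem_exS]; omega)
      push_cast at p1 p2 p3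
      have hβ : β = 0 := by linarith
      subst hβ
      rcases hne with h | h
      · apply h; linarith
      · exact h rfl
  · have p1 := key (5 - s) 5 (by rw [mem_exS]; omega) (by rw [mem_exS]; omega)
    have p2 := key (n + 2) 5 (by rw [mem_exS]; omega) (by rw [mem_exS]; omega)
    push_cast at p1 p2
    have hn : ((n + s - 3 : ℤ) : ℝ) ≠ 0 := by
      have : n + s - 3 ≠ 0 := by omega
      exact_mod_cast this
    have hα : α = 0 := by
      have : α * ((n + s - 3 : ℤ) : ℝ) = 0 := by push_cast; linarith
      exact (mul_eq_zero.1 this).resolve_right hn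
    subst hα
    have hβ : β ≠ 0 := by simpa using hne
    have off : ∀ x : ℤ, (0 : ℝ) * x + β * ((4 : ℤ) : ℝ) ≠ m := by
      intro x hh
      push_cast at hh
      apply hβ; linarith
    have q1 := key2 (n + 2) 4 (by rw [mem_exS]; omega) (off _)
    rw [mem_exS] at q1
    by_cases hs : s = 5
    · have q2 := key2 0 4 (by rw [mem_exS]; omega) (off _)
      rw [mem_exS] at q2
      left
      refine ⟨hs, Or.inl ?_⟩
      rw [Prod.mk.injEq]; omega
    · have q2 := key2 (4 - s) 4 (by rw [mem_exS]; omega) (off _)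
      rw [mem_exS] at q2
      omega

lemma exP_c {n s : ℤ} (h : exH n s) :
    columnVectorCount (exP n s) ≤ 2 ∧ (s = 2 ∨ s = 3 → columnVectorCount (exP n s) = 0) := by
  unfold columnVectorCount
  constructor
  · by_cases hs : s = 5
    · refine (ncard_le_ncard (t := {(0, 1), (-1, 0)}) ?_ (by simp)).trans ((ncard_insert_le _ _).trans (by simp))
      intro v hv
      rcases exP_col h hv with h1 | h1
      · exact h1.2
      · omega
    · refine (ncard_le_ncard (t := {(-1, -1), (-1, 0)}) ?_ (by simp)).trans ((ncard_insert_le _ _).trans (by simp))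
      intro v hv
      rcases exP_col h hv with h1 | h1
      · omega
      · exact h1.2
  · intro hs
    have : {v : ℤ × ℤ | IsColumnVector (exP n s) v} = ∅ := by
      ext v
      simp only [mem_ofPred_eq, mem_empty_iff_false, iff_false]
      intro hv
      rcases exP_col h hv with h1 | h1 <;> omega
    rw [this, ncard_empty]

lemma exists_ns (g : ℕ) (hg : 12 ≤ g) : ∃ n s : ℤ, exH n s ∧ polygonGenus (exP n s) = g ∧
    (g : ℤ) + 17 ≤ 2 * (boundaryLatticeCount (exP n s) - columnVectorCount (exP n s)) := by
  have fin : ∀ n s : ℤ, exH n s →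
      ((g : ℤ) = 4 * n + 3 - max 0 (1 - s) - max 0 (2 - s) - max 0 (3 - s) - max 0 (4 - s)) →
      ∃ n s : ℤ, exH n s ∧ polygonGenus (exP n s) = g ∧
      (g : ℤ) + 17 ≤ 2 * (boundaryLatticeCount (exP n s) - columnVectorCount (exP n s)) := by
    intro n s h hgn
    have h1 := exP_genus h
    have h2 := exP_total h
    have h3 := exP_c h
    refine ⟨n, s, h, by omega, ?_⟩
    unfold exH at h
    omega
  have : g % 4 = 0 ∨ g % 4 = 1 ∨ g % 4 = 2 ∨ g % 4 = 3 := by omega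
  rcases this with h | h | h | h
  · exact fin (g / 4) 2 (by unfold exH; omega) (by omega)
  · exact fin (g / 4 + 2) 0 (by unfold exH; omega) (by omega)
  · exact fin (g / 4) 3 (by unfold exH; omega) (by omega)
  · exact fin (g / 4) 5 (by unfold exH; omega) (by omega)

/-- For `g ≥ 12`, the maximum of `g + r(P) − 3 − c(P)` over maximal lattice polygons
`P` of genus `g` and expected gonality `5` equals `⌊3g/2⌋ + 6 = ⌊U(g, 5)⌋ − 1`. -/
theorem stmt13 (g : ℕ) (hg : 12 ≤ g) :
    (∃ P : Set (ℝ × ℝ), IsMaximalPolygon P ∧ polygonGenus P = g ∧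
      ExpectedGonalityIs P 5 ∧
      (g : ℚ) + (boundaryLatticeCount P : ℚ) - 3 - (columnVectorCount P : ℚ) =
        ((3 * g / 2 + 6 : ℕ) : ℚ)) ∧
    ∀ P : Set (ℝ × ℝ), IsMaximalPolygon P → polygonGenus P = g →
      ExpectedGonalityIs P 5 →
      (g : ℚ) + (boundaryLatticeCount P : ℚ) - 3 - (columnVectorCount P : ℚ) ≤
        ((3 * g / 2 + 6 : ℕ) : ℚ) := by
  constructor
  · obtain ⟨n, s, h, hgen, hlow⟩ := exists_ns g hg
    have he := exP_egon h (by omega)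
    have hu := upper (exP_max h) (by omega) he
    refine ⟨exP n s, exP_max h, hgen, he, ?_⟩
    have : g + boundaryLatticeCount (exP n s) =
        (3 * g / 2 + 6) + 3 + columnVectorCount (exP n s) := by omega
    have : (g : ℚ) + boundaryLatticeCount (exP n s) =
        ((3 * g / 2 + 6 : ℕ) : ℚ) + 3 + columnVectorCount (exP n s) := by exact_mod_cast this
    linarith
  · intro P hm hgen he
    have hu := upper hm (by omega) he
    have : g + boundaryLatticeCount P ≤ (3 * g / 2 + 6) + 3 + columnVectorCount P := by omega
    have : (g : ℚ) + boundaryLatticeCount P ≤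
        ((3 * g / 2 + 6 : ℕ) : ℚ) + 3 + columnVectorCount P := by exact_mod_cast this
    linarith
end

section
/- Let d ≥ 2 and m ≥ 1 be integers, and let x₁, y₁, x₂, y₂, x₃, y₃, x₄, y₄ be nonnegative integers such that for each i, x_i = 0 if and only if y_i = 0, and x₁ + x₂ < m, x₃ + x₄ < m, y₁ + y₄ < d, y₂ + y₃ < d. Let Q be the convex hull of the eight points (x₁, d), (m − x₂, d), (m, d − y₂), (m, y₃), (m − x₃, 0), (x₄, 0), (0, y₄), (0, d − y₁) (the rectangle [0, m] × [0, d] with corner triangles of legs (x_i, y_i) removed: legs (x₁, y₁) at corner (0, d), (x₂, y₂) at (m, d), (x₃, y₃) at (m, 0), (x₄, y₄) at (0, 0)). Let g be the number of interior lattice points of Q. Then |Q ∩ (ℤ × {0})| + |Q ∩ (ℤ × {d})| = 2g/(d − 1) + 4 + Σ_{i=1}^{4} (x_i(y_i − d) − (y_i − gcd(x_i, y_i)))/(d − 1), where gcd(0, 0) is taken to be 0. -/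
open Set

/-- The rectangle `[0, m] × [0, d]` with corner triangles of legs `(xᵢ, yᵢ)` removed. -/
def truncRect (d m x₁ y₁ x₂ y₂ x₃ y₃ x₄ y₄ : ℕ) : Set (ℝ × ℝ) :=
  convexHull ℝ {((x₁ : ℝ), (d : ℝ)), ((m : ℝ) - (x₂ : ℝ), (d : ℝ)),
    ((m : ℝ), (d : ℝ) - (y₂ : ℝ)), ((m : ℝ), (y₃ : ℝ)),
    ((m : ℝ) - (x₃ : ℝ), (0 : ℝ)), ((x₄ : ℝ), (0 : ℝ)),
    ((0 : ℝ), (y₄ : ℝ)), ((0 : ℝ), (d : ℝ) - (y₁ : ℝ))}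

lemma tri_diag (x y : ℕ) (hx : 0 < x) (hy : 0 < y) :
    (((Finset.Ioo (0:ℤ) x ×ˢ Finset.Ioo (0:ℤ) y).filter
      (fun p => (y:ℤ) * p.1 + x * p.2 = x * y)).card : ℤ) = Nat.gcd x y - 1 := by
  obtain ⟨g, a, b, hg, hab, rfl, rfl⟩ := Nat.exists_coprime' (m := x) (n := y)
    (Nat.gcd_pos_of_pos_left _ hx)
  have ha : 0 < a := Nat.pos_of_mul_pos_right hx
  have hb : 0 < b := Nat.pos_of_mul_pos_right hy
  have hgcd : Nat.gcd (a * g) (b * g) = g := by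
    rw [Nat.gcd_mul_right, hab.gcd_eq_one, one_mul]
  rw [hgcd]
  have : ((Finset.Ioo (0:ℤ) (a * g : ℕ) ×ˢ Finset.Ioo (0:ℤ) (b * g : ℕ)).filter
      (fun p => ((b * g : ℕ):ℤ) * p.1 + (a * g : ℕ) * p.2 = (a * g : ℕ) * (b * g : ℕ)))
      = (Finset.Ioo (0:ℤ) g).image (fun k => ((a:ℤ) * k, (b:ℤ) * (g - k))) := by
    have ha' : (0:ℤ) < a := by exact_mod_cast ha
    have hb' : (0:ℤ) < b := by exact_mod_cast hb
    have hg' : (0:ℤ) < g := by exact_mod_cast hg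
    ext ⟨X, Y⟩
    simp only [Finset.mem_filter, Finset.mem_product, Finset.mem_Ioo, Finset.mem_image,
      Prod.mk.injEq]
    push_cast
    constructor
    · rintro ⟨⟨⟨h1, h2⟩, h3, h4⟩, h5⟩
      have h6 : (b:ℤ) * X + a * Y = a * b * g := by
        apply mul_left_cancel₀ hg'.ne'; linarith
      have h7 : (a:ℤ) ∣ b * X := ⟨b * g - Y, by linarith⟩
      have h8 : (a:ℤ) ∣ X := (Nat.isCoprime_iff_coprime.mpr hab).dvd_of_dvd_mul_left h7
      obtain ⟨k, rfl⟩ := h8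
      refine ⟨k, ⟨by nlinarith, by nlinarith⟩, rfl, ?_⟩
      apply mul_left_cancel₀ ha'.ne'; linarith
    · rintro ⟨k, ⟨h1, h2⟩, rfl, rfl⟩
      refine ⟨⟨⟨by positivity, by nlinarith⟩, by nlinarith, by nlinarith⟩, by ring⟩
  rw [this, Finset.card_image_of_injective, Int.card_Ioo]
  · omega
  · intro k l h
    simp only [Prod.mk.injEq] at h
    exact mul_left_cancel₀ (by exact_mod_cast ha.ne') h.1

lemma tri_count (x y : ℕ) (hxy : x = 0 ↔ y = 0) :
    2 * (((Finset.Ioo (0:ℤ) x ×ˢ Finset.Ioo (0:ℤ) y).filter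
      (fun p => (y:ℤ) * p.1 + x * p.2 ≤ x * y)).card : ℤ) = x * y - x - y + Nat.gcd x y := by
  rcases Nat.eq_zero_or_pos x with h0 | hx
  · have h0' := hxy.1 h0
    subst h0 h0'
    simp
  have hy : 0 < y := by omega
  have hd := tri_diag x y hx hy
  set I := (Finset.Ioo (0:ℤ) x ×ˢ Finset.Ioo (0:ℤ) y) with hI
  have hIc : (I.card : ℤ) = (x - 1) * (y - 1) := by
    rw [hI, Finset.card_product, Int.card_Ioo, Int.card_Ioo]
    push_cast
    congr 1 <;> omega
  have h1 := Finset.card_filter_add_card_filter_not (s := I) (fun p => (y:ℤ) * p.1 + x * p.2 ≤ x * y)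
  have h2 : (I.filter (fun p => (y:ℤ) * p.1 + x * p.2 ≤ x * y)).card
     = (I.filter (fun p => (y:ℤ) * p.1 + x * p.2 = x * y)).card
      + (I.filter (fun p => (y:ℤ) * p.1 + x * p.2 < x * y)).card := by
    rw [← Finset.card_union_of_disjoint]
    · congr 1
      ext p
      simp only [Finset.mem_filter, Finset.mem_union, le_iff_eq_or_lt]
      tauto
    · rw [Finset.disjoint_filter]
      intro p _ h; omega
  have h3 : (I.filter (fun p => (y:ℤ) * p.1 + x * p.2 < x * y)).card
     = (I.filter (fun p => ¬ (y:ℤ) * p.1 + x * p.2 ≤ x * y)).card := by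
    apply Finset.card_nbij' (fun p : ℤ × ℤ => ((x:ℤ) - p.1, (y:ℤ) - p.2))
      (fun p : ℤ × ℤ => ((x:ℤ) - p.1, (y:ℤ) - p.2))
    · rintro ⟨X, Y⟩ h
      simp only [hI, Finset.coe_filter, Finset.mem_product, Finset.mem_Ioo, mem_ofPred_eq] at h ⊢
      refine ⟨by omega, ?_⟩
      linarith
    · rintro ⟨X, Y⟩ h
      simp only [hI, Finset.coe_filter, Finset.mem_product, Finset.mem_Ioo, mem_ofPred_eq] at h ⊢
      refine ⟨by omega, ?_⟩
      linarith
    · rintro ⟨X, Y⟩ h; simp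
    · rintro ⟨X, Y⟩ h; simp
  zify at h1 h2 h3
  rw [hIc] at h1
  linarith

/-- lattice points cut off at a corner, in coordinates `f, h` relative to the corner -/
lemma corner_count (d m x y : ℕ) (hxy : x = 0 ↔ y = 0) (hx : x < m) (hy : y < d)
    (φ : ℤ × ℤ → ℤ × ℤ) (hφ : ∀ p, φ (φ p) = p)
    (hI : ∀ p, φ p ∈ (Finset.Ioo (0:ℤ) m ×ˢ Finset.Ioo (0:ℤ) d) ↔
      p ∈ (Finset.Ioo (0:ℤ) m ×ˢ Finset.Ioo (0:ℤ) d)) :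
    2 * (((Finset.Ioo (0:ℤ) m ×ˢ Finset.Ioo (0:ℤ) d).filter
      (fun p => x ≠ 0 ∧ (y:ℤ) * (φ p).1 + x * (φ p).2 ≤ x * y)).card : ℤ)
      = x * y - x - y + Nat.gcd x y := by
  rw [← tri_count x y hxy]
  congr 2
  apply Finset.card_nbij' φ φ
  · intro p h
    simp only [Finset.coe_filter, mem_ofPred_eq] at h ⊢
    obtain ⟨h1, h0, h2⟩ := h
    rw [← hI] at h1
    refine ⟨?_, h2⟩
    simp only [Finset.mem_product, Finset.mem_Ioo] at h1 ⊢
    obtain ⟨⟨h3, h4⟩, h5, h6⟩ := h1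
    have hx0 : (0:ℤ) < x := by omega
    have hy0 : (0:ℤ) < y := by omega
    refine ⟨⟨h3, ?_⟩, h5, ?_⟩ <;> nlinarith
  · intro p h
    simp only [Finset.coe_filter, mem_ofPred_eq] at h ⊢
    obtain ⟨h1, h2⟩ := h
    rw [hI, hφ]
    simp only [Finset.mem_product, Finset.mem_Ioo] at h1 ⊢
    refine ⟨by omega, by omega, h2⟩
  · intro p _; exact hφ p
  · intro p _; exact hφ p

lemma half_strict {Q : Set (ℝ × ℝ)} (a b c : ℝ) (hab : 0 < a ^ 2 + b ^ 2)
    (hQ : ∀ p ∈ Q, c ≤ a * p.1 + b * p.2) {p : ℝ × ℝ} (hp : p ∈ interior Q) :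
    c < a * p.1 + b * p.2 := by
  have hc : Continuous (fun t : ℝ => (p.1 - t * a, p.2 - t * b)) := by fun_prop
  have ho : IsOpen ((fun t : ℝ => (p.1 - t * a, p.2 - t * b)) ⁻¹' interior Q) :=
    isOpen_interior.preimage hc
  have h0 : (0:ℝ) ∈ ((fun t : ℝ => (p.1 - t * a, p.2 - t * b)) ⁻¹' interior Q) := by
    simpa using hp
  obtain ⟨ε, hε, hb⟩ := Metric.isOpen_iff.1 ho 0 h0
  have h1 : (ε / 2) ∈ Metric.ball (0:ℝ) ε := by
    simp [abs_of_pos hε]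
    linarith
  have h2 := hQ _ (interior_subset (hb h1))
  simp only at h2
  nlinarith [mul_pos hε hab]

lemma seg_mem {Q : Set (ℝ × ℝ)} (hQ : Convex ℝ Q) {p q : ℝ × ℝ} (hp : p ∈ Q) (hq : q ∈ Q)
    (a b : ℝ) (ha : 0 ≤ a) (hb : 0 ≤ b) (hab : a + b = 1) {X Y : ℝ}
    (hX : X = a * p.1 + b * q.1) (hY : Y = a * p.2 + b * q.2) : (X, Y) ∈ Q := by
  have := hQ hp hq ha hb hab
  convert this using 1
  ext <;> simp [hX, hY]

lemma side {Q : Set (ℝ × ℝ)} (hQ : Convex ℝ Q) (o s x y x' y' d X Y : ℝ)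
    (hy : 0 ≤ y) (hy' : 0 ≤ y') (hd : y + y' < d)
    (p1 : (o + s * x, 0) ∈ Q) (p2 : (o + s * 0, y) ∈ Q)
    (p3 : (o + s * 0, d - y') ∈ Q) (p4 : (o + s * x', d) ∈ Q)
    (hX : 0 ≤ X) (hY : 0 ≤ Y) (hYd : Y ≤ d) (c : x * y ≤ y * X + x * Y)
    (c' : x' * y' ≤ y' * X + x' * (d - Y)) : ∃ l ≤ X, (o + s * l, Y) ∈ Q := by
  rcases lt_or_ge Y y with h | h
  · have hy0 : 0 < y := by linarith
    refine ⟨x * (y - Y) / y, ?_, ?_⟩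
    · rw [div_le_iff₀ hy0]; linarith
    · refine seg_mem hQ p1 p2 ((y - Y) / y) (Y / y) (div_nonneg (by linarith) hy)
        (by positivity) (by field_simp; ring) ?_ ?_
      · field_simp; ring
      · field_simp; ring
  rcases lt_or_ge (d - y') Y with h' | h'
  · have hy0 : 0 < y' := by linarith
    refine ⟨x' * (y' - (d - Y)) / y', ?_, ?_⟩
    · rw [div_le_iff₀ hy0]; linarith
    · refine seg_mem hQ p4 p3 ((y' - (d - Y)) / y') ((d - Y) / y') (div_nonneg (by linarith) hy')
        (div_nonneg (by linarith) hy') (by field_simp; ring) ?_ ?_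
      · field_simp; ring
      · field_simp; ring
  · have hw : 0 < d - y' - y := by linarith
    refine ⟨0, hX, ?_⟩
    refine seg_mem hQ p2 p3 ((d - y' - Y) / (d - y' - y)) ((Y - y) / (d - y' - y))
      (div_nonneg (by linarith) hw.le) (div_nonneg (by linarith) hw.le) (by field_simp; ring) ?_ ?_
    · field_simp; ring
    · field_simp; ring

def cutIneq (d m x₁ y₁ x₂ y₂ x₃ y₃ x₄ y₄ : ℝ) (p : ℝ × ℝ) : Prop :=
  (0 ≤ p.1 ∧ p.1 ≤ m ∧ 0 ≤ p.2 ∧ p.2 ≤ d) ∧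
  (x₁ * y₁ ≤ y₁ * p.1 + x₁ * (d - p.2)) ∧ (x₂ * y₂ ≤ y₂ * (m - p.1) + x₂ * (d - p.2)) ∧
  (x₃ * y₃ ≤ y₃ * (m - p.1) + x₃ * p.2) ∧ (x₄ * y₄ ≤ y₄ * p.1 + x₄ * p.2)

lemma convex_cut (d m x₁ y₁ x₂ y₂ x₃ y₃ x₄ y₄ : ℝ) :
    Convex ℝ {p | cutIneq d m x₁ y₁ x₂ y₂ x₃ y₃ x₄ y₄ p} := by
  rintro ⟨X, Y⟩ ⟨⟨a1, a2, a3, a4⟩, a5, a6, a7, a8⟩ ⟨X', Y'⟩ ⟨⟨b1, b2, b3, b4⟩, b5, b6, b7, b8⟩ a b ha hb hab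
  obtain rfl : b = 1 - a := by linarith
  simp only [cutIneq, mem_ofPred_eq, Prod.smul_mk, Prod.mk_add_mk, smul_eq_mul] at *
  refine ⟨⟨?_, ?_, ?_, ?_⟩, ?_, ?_, ?_, ?_⟩
  · linarith [mul_le_mul_of_nonneg_left a1 ha, mul_le_mul_of_nonneg_left b1 hb]
  · linarith [mul_le_mul_of_nonneg_left a2 ha, mul_le_mul_of_nonneg_left b2 hb]
  · linarith [mul_le_mul_of_nonneg_left a3 ha, mul_le_mul_of_nonneg_left b3 hb]
  · linarith [mul_le_mul_of_nonneg_left a4 ha, mul_le_mul_of_nonneg_left b4 hb]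
  · linarith [mul_le_mul_of_nonneg_left a5 ha, mul_le_mul_of_nonneg_left b5 hb]
  · linarith [mul_le_mul_of_nonneg_left a6 ha, mul_le_mul_of_nonneg_left b6 hb]
  · linarith [mul_le_mul_of_nonneg_left a7 ha, mul_le_mul_of_nonneg_left b7 hb]
  · linarith [mul_le_mul_of_nonneg_left a8 ha, mul_le_mul_of_nonneg_left b8 hb]

set_option maxHeartbeats 2000000 in
lemma mem_truncRect (d m x₁ y₁ x₂ y₂ x₃ y₃ x₄ y₄ : ℕ)
    (hx12 : x₁ + x₂ < m) (hx34 : x₃ + x₄ < m)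
    (hy14 : y₁ + y₄ < d) (hy23 : y₂ + y₃ < d) (p : ℝ × ℝ) :
    p ∈ truncRect d m x₁ y₁ x₂ y₂ x₃ y₃ x₄ y₄ ↔ cutIneq d m x₁ y₁ x₂ y₂ x₃ y₃ x₄ y₄ p := by
  have r1 : (x₁ : ℝ) + x₂ < m := by exact_mod_cast hx12
  have r2 : (x₃ : ℝ) + x₄ < m := by exact_mod_cast hx34
  have r3 : (y₁ : ℝ) + y₄ < d := by exact_mod_cast hy14
  have r4 : (y₂ : ℝ) + y₃ < d := by exact_mod_cast hy23
  have n1 : (0:ℝ) ≤ x₁ := Nat.cast_nonneg _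
  have n2 : (0:ℝ) ≤ x₂ := Nat.cast_nonneg _
  have n3 : (0:ℝ) ≤ x₃ := Nat.cast_nonneg _
  have n4 : (0:ℝ) ≤ x₄ := Nat.cast_nonneg _
  have k1 : (0:ℝ) ≤ y₁ := Nat.cast_nonneg _
  have k2 : (0:ℝ) ≤ y₂ := Nat.cast_nonneg _
  have k3 : (0:ℝ) ≤ y₃ := Nat.cast_nonneg _
  have k4 : (0:ℝ) ≤ y₄ := Nat.cast_nonneg _
  have am1 : (0:ℝ) ≤ y₁ * (m - x₁ - x₂) := mul_nonneg k1 (by linarith)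
  have bm1 : (0:ℝ) ≤ y₁ * (m - x₃ - x₄) := mul_nonneg k1 (by linarith)
  have ad1 : (0:ℝ) ≤ x₁ * (d - y₁ - y₄) := mul_nonneg n1 (by linarith)
  have bd1 : (0:ℝ) ≤ x₁ * (d - y₂ - y₃) := mul_nonneg n1 (by linarith)
  have c11 : (0:ℝ) ≤ x₁ * y₁ := mul_nonneg n1 k1
  have c12 : (0:ℝ) ≤ x₁ * y₂ := mul_nonneg n1 k2
  have c13 : (0:ℝ) ≤ x₁ * y₃ := mul_nonneg n1 k3
  have c14 : (0:ℝ) ≤ x₁ * y₄ := mul_nonneg n1 k4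
  have am2 : (0:ℝ) ≤ y₂ * (m - x₁ - x₂) := mul_nonneg k2 (by linarith)
  have bm2 : (0:ℝ) ≤ y₂ * (m - x₃ - x₄) := mul_nonneg k2 (by linarith)
  have ad2 : (0:ℝ) ≤ x₂ * (d - y₁ - y₄) := mul_nonneg n2 (by linarith)
  have bd2 : (0:ℝ) ≤ x₂ * (d - y₂ - y₃) := mul_nonneg n2 (by linarith)
  have c21 : (0:ℝ) ≤ x₂ * y₁ := mul_nonneg n2 k1
  have c22 : (0:ℝ) ≤ x₂ * y₂ := mul_nonneg n2 k2
  have c23 : (0:ℝ) ≤ x₂ * y₃ := mul_nonneg n2 k3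
  have c24 : (0:ℝ) ≤ x₂ * y₄ := mul_nonneg n2 k4
  have am3 : (0:ℝ) ≤ y₃ * (m - x₁ - x₂) := mul_nonneg k3 (by linarith)
  have bm3 : (0:ℝ) ≤ y₃ * (m - x₃ - x₄) := mul_nonneg k3 (by linarith)
  have ad3 : (0:ℝ) ≤ x₃ * (d - y₁ - y₄) := mul_nonneg n3 (by linarith)
  have bd3 : (0:ℝ) ≤ x₃ * (d - y₂ - y₃) := mul_nonneg n3 (by linarith)
  have c31 : (0:ℝ) ≤ x₃ * y₁ := mul_nonneg n3 k1
  have c32 : (0:ℝ) ≤ x₃ * y₂ := mul_nonneg n3 k2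
  have c33 : (0:ℝ) ≤ x₃ * y₃ := mul_nonneg n3 k3
  have c34 : (0:ℝ) ≤ x₃ * y₄ := mul_nonneg n3 k4
  have am4 : (0:ℝ) ≤ y₄ * (m - x₁ - x₂) := mul_nonneg k4 (by linarith)
  have bm4 : (0:ℝ) ≤ y₄ * (m - x₃ - x₄) := mul_nonneg k4 (by linarith)
  have ad4 : (0:ℝ) ≤ x₄ * (d - y₁ - y₄) := mul_nonneg n4 (by linarith)
  have bd4 : (0:ℝ) ≤ x₄ * (d - y₂ - y₃) := mul_nonneg n4 (by linarith)
  have c41 : (0:ℝ) ≤ x₄ * y₁ := mul_nonneg n4 k1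
  have c42 : (0:ℝ) ≤ x₄ * y₂ := mul_nonneg n4 k2
  have c43 : (0:ℝ) ≤ x₄ * y₃ := mul_nonneg n4 k3
  have c44 : (0:ℝ) ≤ x₄ * y₄ := mul_nonneg n4 k4
  constructor
  · intro hp
    refine convexHull_min ?_ (convex_cut d m x₁ y₁ x₂ y₂ x₃ y₃ x₄ y₄) hp
    intro q hq
    simp only [mem_insert_iff, mem_singleton_iff] at hq
    rcases hq with rfl | rfl | rfl | rfl | rfl | rfl | rfl | rfl <;>
    · simp only [mem_ofPred_eq, cutIneq]
      refine ⟨⟨?_, ?_, ?_, ?_⟩, ?_, ?_, ?_, ?_⟩ <;> linarith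
  · rintro ⟨⟨a1, a2, a3, a4⟩, a5, a6, a7, a8⟩
    obtain ⟨X, Y⟩ := p
    have hsub := subset_convexHull ℝ {((x₁ : ℝ), (d : ℝ)), ((m : ℝ) - (x₂ : ℝ), (d : ℝ)),
      ((m : ℝ), (d : ℝ) - (y₂ : ℝ)), ((m : ℝ), (y₃ : ℝ)),
      ((m : ℝ) - (x₃ : ℝ), (0 : ℝ)), ((x₄ : ℝ), (0 : ℝ)),
      ((0 : ℝ), (y₄ : ℝ)), ((0 : ℝ), (d : ℝ) - (y₁ : ℝ))}
    change _ ⊆ truncRect d m x₁ y₁ x₂ y₂ x₃ y₃ x₄ y₄ at hsub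
    have hcv : Convex ℝ (truncRect d m x₁ y₁ x₂ y₂ x₃ y₃ x₄ y₄) := convex_convexHull _ _
    simp only at a1 a2 a3 a4 a5 a6 a7 a8
    obtain ⟨l, hl, hlQ⟩ := side hcv 0 1 x₄ y₄ x₁ y₁ d X Y k4 k1
      (by linarith)
      (hsub (by simp)) (hsub (by simp)) (hsub (by simp)) (hsub (by simp)) a1 a3 a4 a8 a5
    obtain ⟨r, hr, hrQ⟩ := side hcv m (-1) x₃ y₃ x₂ y₂ d (m - X) Y k3 k2
      (by linarith)
      (hsub (by simp [← sub_eq_add_neg])) (hsub (by simp)) (hsub (by simp))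
      (hsub (by simp [← sub_eq_add_neg])) (by linarith) a3 a4 a7 a6
    have hle : l ≤ X ∧ X ≤ m - r := ⟨hl, by linarith⟩
    rcases eq_or_lt_of_le (show l ≤ m - r by linarith) with he | hlt
    · have : X = 0 + 1 * l := by linarith
      rw [this]; exact hlQ
    · have hw : 0 < m - r - l := by linarith
      refine seg_mem hcv hlQ hrQ ((m - r - X) / (m - r - l)) ((X - l) / (m - r - l))
        (div_nonneg (by linarith) hw.le) (div_nonneg (by linarith) hw.le) (by field_simp; ring) ?_ ?_
      · field_simp; ring
      · field_simp; ring

lemma corner_open (f : ℝ × ℝ → ℝ) (hf : Continuous f) (x : ℕ) (c : ℝ) :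
    IsOpen {p : ℝ × ℝ | x ≠ 0 → c < f p} := by
  by_cases h : x = 0
  · simp [h]
  · simpa [h] using isOpen_lt continuous_const hf

lemma interior_iff (d m x₁ y₁ x₂ y₂ x₃ y₃ x₄ y₄ : ℕ)
    (h1 : x₁ = 0 ↔ y₁ = 0) (h2 : x₂ = 0 ↔ y₂ = 0)
    (h3 : x₃ = 0 ↔ y₃ = 0) (h4 : x₄ = 0 ↔ y₄ = 0)
    (hx12 : x₁ + x₂ < m) (hx34 : x₃ + x₄ < m)
    (hy14 : y₁ + y₄ < d) (hy23 : y₂ + y₃ < d) (p : ℝ × ℝ) :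
    p ∈ interior (truncRect d m x₁ y₁ x₂ y₂ x₃ y₃ x₄ y₄) ↔
      (0 < p.1 ∧ p.1 < m ∧ 0 < p.2 ∧ p.2 < d) ∧
      (x₁ ≠ 0 → (x₁ * y₁ : ℝ) < y₁ * p.1 + x₁ * (d - p.2)) ∧
      (x₂ ≠ 0 → (x₂ * y₂ : ℝ) < y₂ * (m - p.1) + x₂ * (d - p.2)) ∧
      (x₃ ≠ 0 → (x₃ * y₃ : ℝ) < y₃ * (m - p.1) + x₃ * p.2) ∧
      (x₄ ≠ 0 → (x₄ * y₄ : ℝ) < y₄ * p.1 + x₄ * p.2) := by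
  have hmem := mem_truncRect d m x₁ y₁ x₂ y₂ x₃ y₃ x₄ y₄ hx12 hx34 hy14 hy23
  constructor
  · intro hp
    have hpos : ∀ (x : ℕ) (y : ℝ), x ≠ 0 → (0:ℝ) < y ^ 2 + (x:ℝ) ^ 2 := by
      intro x y hx
      have : (0:ℝ) < x := by exact_mod_cast Nat.pos_of_ne_zero hx
      positivity
    refine ⟨⟨?_, ?_, ?_, ?_⟩, fun hx => ?_, fun hx => ?_, fun hx => ?_, fun hx => ?_⟩
    · have := half_strict 1 0 0 (by norm_num)
        (fun q hq => by have := ((hmem q).1 hq).1; linarith [this.1]) hp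
      linarith
    · have := half_strict (-1) 0 (-m) (by norm_num)
        (fun q hq => by have := ((hmem q).1 hq).1; linarith [this.2.1]) hp
      linarith
    · have := half_strict 0 1 0 (by norm_num)
        (fun q hq => by have := ((hmem q).1 hq).1; linarith [this.2.2.1]) hp
      linarith
    · have := half_strict 0 (-1) (-d) (by norm_num)
        (fun q hq => by have := ((hmem q).1 hq).1; linarith [this.2.2.2]) hp
      linarith
    · have := half_strict y₁ (-x₁) (x₁ * y₁ - x₁ * d) (by simpa using hpos x₁ y₁ hx)
        (fun q hq => by have := ((hmem q).1 hq).2; linarith [this.1]) hp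
      linarith
    · have := half_strict (-y₂) (-x₂) (x₂ * y₂ - x₂ * d - y₂ * m) (by simpa using hpos x₂ y₂ hx)
        (fun q hq => by have := ((hmem q).1 hq).2; linarith [this.2.1]) hp
      linarith
    · have := half_strict (-y₃) x₃ (x₃ * y₃ - y₃ * m) (by simpa using hpos x₃ y₃ hx)
        (fun q hq => by have := ((hmem q).1 hq).2; linarith [this.2.2.1]) hp
      linarith
    · have := half_strict y₄ x₄ (x₄ * y₄) (hpos x₄ y₄ hx)
        (fun q hq => by have := ((hmem q).1 hq).2; linarith [this.2.2.2]) hp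
      linarith
  · intro hp
    rw [mem_interior]
    refine ⟨{p : ℝ × ℝ | (0 < p.1 ∧ p.1 < m ∧ 0 < p.2 ∧ p.2 < d) ∧
      (x₁ ≠ 0 → (x₁ * y₁ : ℝ) < y₁ * p.1 + x₁ * (d - p.2)) ∧
      (x₂ ≠ 0 → (x₂ * y₂ : ℝ) < y₂ * (m - p.1) + x₂ * (d - p.2)) ∧
      (x₃ ≠ 0 → (x₃ * y₃ : ℝ) < y₃ * (m - p.1) + x₃ * p.2) ∧
      (x₄ ≠ 0 → (x₄ * y₄ : ℝ) < y₄ * p.1 + x₄ * p.2)}, ?_, ?_, hp⟩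
    · rintro q ⟨⟨a1, a2, a3, a4⟩, a5, a6, a7, a8⟩
      rw [hmem]
      have key : ∀ (x y : ℕ) (_ : x = 0 ↔ y = 0) (u v : ℝ), (x ≠ 0 → (x * y : ℝ) < y * u + x * v) →
          (x * y : ℝ) ≤ y * u + x * v := by
        intro x y hxy u v h
        by_cases hx : x = 0
        · have := hxy.1 hx
          subst hx this
          simp
        · exact (h hx).le
      exact ⟨⟨a1.le, a2.le, a3.le, a4.le⟩, key _ _ h1 _ _ a5, key _ _ h2 _ _ a6,
        key _ _ h3 _ _ a7, key _ _ h4 _ _ a8⟩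
    · refine IsOpen.and ?_ (IsOpen.and ?_ (IsOpen.and ?_ (IsOpen.and ?_ ?_)))
      · exact (isOpen_lt continuous_const continuous_fst).and
          ((isOpen_lt continuous_fst continuous_const).and
          ((isOpen_lt continuous_const continuous_snd).and
          (isOpen_lt continuous_snd continuous_const)))
      all_goals exact corner_open _ (by fun_prop) _ _

/-- adjacent corners do not overlap -/
lemma corner_le (x y u v : ℤ) (hx : 0 < x) (hu : 0 < u) (hv : 0 < v) (hy : 0 ≤ y)
    (h : y * u + x * v ≤ x * y) : v ≤ y := by
  by_contra hc
  push Not at hc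
  nlinarith

lemma corner_opp (x y u v m d : ℤ) (hx : 0 < x) (hu : 0 < u) (hv : 0 < v) (hy : 0 < y)
    (hxm : x < m) (hyd : y < d) (h : y * u + x * v ≤ x * y) : d * u + m * v < m * d := by
  -- u/x + v/y ≤ 1
  have hxy : 0 < x * y := mul_pos hx hy
  have e1 : d * x * (y * u) < m * d * (y * u) := by
    have : 0 < (m - x) * (d * (y * u)) := by
      apply mul_pos (by linarith); apply mul_pos (by linarith); positivity
    linarith
  have e2 : m * y * (x * v) < m * d * (x * v) := by
    have : 0 < (d - y) * (m * (x * v)) := by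
      apply mul_pos (by linarith); apply mul_pos (by linarith); positivity
    linarith
  have e3 : m * d * (y * u + x * v) ≤ m * d * (x * y) :=
    mul_le_mul_of_nonneg_left h (mul_nonneg (by linarith) (by linarith))
  have : (x * y) * (d * u + m * v) < (x * y) * (m * d) := by linarith
  exact lt_of_mul_lt_mul_left this hxy.le

set_option maxHeartbeats 1000000 in
lemma genus_count (d m x₁ y₁ x₂ y₂ x₃ y₃ x₄ y₄ : ℕ) (hd : 2 ≤ d) (hm : 1 ≤ m)
    (h1 : x₁ = 0 ↔ y₁ = 0) (h2 : x₂ = 0 ↔ y₂ = 0)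
    (h3 : x₃ = 0 ↔ y₃ = 0) (h4 : x₄ = 0 ↔ y₄ = 0)
    (hx12 : x₁ + x₂ < m) (hx34 : x₃ + x₄ < m)
    (hy14 : y₁ + y₄ < d) (hy23 : y₂ + y₃ < d) :
    2 * (polygonGenus (truncRect d m x₁ y₁ x₂ y₂ x₃ y₃ x₄ y₄) : ℤ) = 2 * ((m - 1) * (d - 1)) -
      ((x₁ * y₁ - x₁ - y₁ + Nat.gcd x₁ y₁) + (x₂ * y₂ - x₂ - y₂ + Nat.gcd x₂ y₂) +
       (x₃ * y₃ - x₃ - y₃ + Nat.gcd x₃ y₃) + (x₄ * y₄ - x₄ - y₄ + Nat.gcd x₄ y₄)) := by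
  have c1 := corner_count d m x₁ y₁ h1 (by omega) (by omega) (fun p => (p.1, d - p.2))
    (by simp) (by intro p; simp only [Finset.mem_product, Finset.mem_Ioo]; omega)
  have c2 := corner_count d m x₂ y₂ h2 (by omega) (by omega) (fun p => (m - p.1, d - p.2))
    (by simp) (by intro p; simp only [Finset.mem_product, Finset.mem_Ioo]; omega)
  have c3 := corner_count d m x₃ y₃ h3 (by omega) (by omega) (fun p => (m - p.1, p.2))
    (by simp) (by intro p; simp only [Finset.mem_product, Finset.mem_Ioo]; omega)
  have c4 := corner_count d m x₄ y₄ h4 (by omega) (by omega) (fun p => (p.1, p.2))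
    (by simp) (by intro p; simp only [Finset.mem_product, Finset.mem_Ioo])
  simp only at c1 c2 c3 c4
  set I := Finset.Ioo (0:ℤ) m ×ˢ Finset.Ioo (0:ℤ) d with hI
  have hIc : (I.card : ℤ) = (m - 1) * (d - 1) := by
    rw [hI, Finset.card_product, Int.card_Ioo, Int.card_Ioo]
    push_cast
    congr 1 <;> omega
  set T1 := I.filter (fun p => x₁ ≠ 0 ∧ (y₁:ℤ) * p.1 + x₁ * (d - p.2) ≤ x₁ * y₁) with hT1
  set T2 := I.filter (fun p => x₂ ≠ 0 ∧ (y₂:ℤ) * (m - p.1) + x₂ * (d - p.2) ≤ x₂ * y₂) with hT2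
  set T3 := I.filter (fun p => x₃ ≠ 0 ∧ (y₃:ℤ) * (m - p.1) + x₃ * p.2 ≤ x₃ * y₃) with hT3
  set T4 := I.filter (fun p => x₄ ≠ 0 ∧ (y₄:ℤ) * p.1 + x₄ * p.2 ≤ x₄ * y₄) with hT4
  have d12 : Disjoint T1 T2 := by
    rw [hT1, hT2, Finset.disjoint_filter]
    rintro ⟨X, Y⟩ hp ⟨a, b⟩ ⟨a', b'⟩
    simp only [hI, Finset.mem_product, Finset.mem_Ioo] at hp b b'
    have := corner_le y₁ x₁ (d - Y) X (by omega) (by omega) (by omega) (by omega) (by linarith)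
    have := corner_le y₂ x₂ (d - Y) (m - X) (by omega) (by omega) (by omega) (by omega) (by linarith)
    omega
  have d34 : Disjoint T3 T4 := by
    rw [hT3, hT4, Finset.disjoint_filter]
    rintro ⟨X, Y⟩ hp ⟨a, b⟩ ⟨a', b'⟩
    simp only [hI, Finset.mem_product, Finset.mem_Ioo] at hp b b'
    have := corner_le y₃ x₃ Y (m - X) (by omega) (by omega) (by omega) (by omega) (by linarith)
    have := corner_le y₄ x₄ Y X (by omega) (by omega) (by omega) (by omega) (by linarith)
    omega
  have d14 : Disjoint T1 T4 := by
    rw [hT1, hT4, Finset.disjoint_filter]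
    rintro ⟨X, Y⟩ hp ⟨a, b⟩ ⟨a', b'⟩
    simp only [hI, Finset.mem_product, Finset.mem_Ioo] at hp b b'
    have := corner_le x₁ y₁ X (d - Y) (by omega) (by omega) (by omega) (by omega) (by linarith)
    have := corner_le x₄ y₄ X Y (by omega) (by omega) (by omega) (by omega) (by linarith)
    omega
  have d23 : Disjoint T2 T3 := by
    rw [hT2, hT3, Finset.disjoint_filter]
    rintro ⟨X, Y⟩ hp ⟨a, b⟩ ⟨a', b'⟩
    simp only [hI, Finset.mem_product, Finset.mem_Ioo] at hp b b'
    have := corner_le x₂ y₂ (m - X) (d - Y) (by omega) (by omega) (by omega) (by omega) (by linarith)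
    have := corner_le x₃ y₃ (m - X) Y (by omega) (by omega) (by omega) (by omega) (by linarith)
    omega
  have d13 : Disjoint T1 T3 := by
    rw [hT1, hT3, Finset.disjoint_filter]
    rintro ⟨X, Y⟩ hp ⟨a, b⟩ ⟨a', b'⟩
    simp only [hI, Finset.mem_product, Finset.mem_Ioo] at hp b b'
    have := corner_opp x₁ y₁ X (d - Y) m d (by omega) (by omega) (by omega) (by omega) (by omega)
      (by omega) (by linarith)
    have := corner_opp x₃ y₃ (m - X) Y m d (by omega) (by omega) (by omega) (by omega) (by omega)
      (by omega) (by linarith)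
    linarith
  have d24 : Disjoint T2 T4 := by
    rw [hT2, hT4, Finset.disjoint_filter]
    rintro ⟨X, Y⟩ hp ⟨a, b⟩ ⟨a', b'⟩
    simp only [hI, Finset.mem_product, Finset.mem_Ioo] at hp b b'
    have := corner_opp x₂ y₂ (m - X) (d - Y) m d (by omega) (by omega) (by omega) (by omega)
      (by omega) (by omega) (by linarith)
    have := corner_opp x₄ y₄ X Y m d (by omega) (by omega) (by omega) (by omega) (by omega)
      (by omega) (by linarith)
    linarith
  have hU : ((T1 ∪ T2) ∪ (T3 ∪ T4)).card = T1.card + T2.card + (T3.card + T4.card) := by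
    rw [Finset.card_union_of_disjoint, Finset.card_union_of_disjoint d12,
      Finset.card_union_of_disjoint d34]
    simp only [Finset.disjoint_union_left, Finset.disjoint_union_right]
    exact ⟨⟨d13, d23⟩, d14, d24⟩
  have hsub : (T1 ∪ T2) ∪ (T3 ∪ T4) ⊆ I := by
    refine Finset.union_subset (Finset.union_subset ?_ ?_) (Finset.union_subset ?_ ?_) <;>
    exact Finset.filter_subset _ _
  have hg : interiorLatticePoints (truncRect d m x₁ y₁ x₂ y₂ x₃ y₃ x₄ y₄) =
      ((I \ ((T1 ∪ T2) ∪ (T3 ∪ T4)) : Finset (ℤ × ℤ)) : Set (ℤ × ℤ)) := by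
    ext ⟨X, Y⟩
    simp only [interiorLatticePoints, mem_ofPred_eq, latticeEmbed,
      interior_iff d m x₁ y₁ x₂ y₂ x₃ y₃ x₄ y₄ h1 h2 h3 h4 hx12 hx34 hy14 hy23,
      Finset.mem_coe, Finset.mem_sdiff, Finset.mem_union, hT1, hT2, hT3, hT4, Finset.mem_filter,
      hI, Finset.mem_product, Finset.mem_Ioo]
    rw [← Int.cast_natCast (R := ℝ) d, ← Int.cast_natCast (R := ℝ) m,
      ← Int.cast_natCast (R := ℝ) x₁, ← Int.cast_natCast (R := ℝ) x₂,
      ← Int.cast_natCast (R := ℝ) x₃, ← Int.cast_natCast (R := ℝ) x₄,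
      ← Int.cast_natCast (R := ℝ) y₁, ← Int.cast_natCast (R := ℝ) y₂,
      ← Int.cast_natCast (R := ℝ) y₃, ← Int.cast_natCast (R := ℝ) y₄]
    simp only [← Int.cast_mul, ← Int.cast_sub, ← Int.cast_add, Int.cast_lt, Int.cast_pos,
      ← not_le (b := (x₁ * y₁ : ℤ)), ← not_le (b := (x₂ * y₂ : ℤ)),
      ← not_le (b := (x₃ * y₃ : ℤ)), ← not_le (b := (x₄ * y₄ : ℤ))]
    constructor
    · rintro ⟨⟨a1, a2, a3, a4⟩, a5, a6, a7, a8⟩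
      refine ⟨⟨⟨a1, a2⟩, a3, a4⟩, ?_⟩
      rintro ((⟨_, u, v⟩ | ⟨_, u, v⟩) | (⟨_, u, v⟩ | ⟨_, u, v⟩))
      · exact a5 u v
      · exact a6 u v
      · exact a7 u v
      · exact a8 u v
    · rintro ⟨⟨⟨a1, a2⟩, a3, a4⟩, h⟩
      exact ⟨⟨a1, a2, a3, a4⟩,
        fun u v => h (Or.inl (Or.inl ⟨⟨⟨a1, a2⟩, a3, a4⟩, u, v⟩)),
        fun u v => h (Or.inl (Or.inr ⟨⟨⟨a1, a2⟩, a3, a4⟩, u, v⟩)),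
        fun u v => h (Or.inr (Or.inl ⟨⟨⟨a1, a2⟩, a3, a4⟩, u, v⟩)),
        fun u v => h (Or.inr (Or.inr ⟨⟨⟨a1, a2⟩, a3, a4⟩, u, v⟩))⟩
  have hcard : polygonGenus (truncRect d m x₁ y₁ x₂ y₂ x₃ y₃ x₄ y₄)
      + (T1.card + T2.card + (T3.card + T4.card)) = I.card := by
    rw [polygonGenus, hg, Set.ncard_coe_finset, ← hU]
    exact Finset.card_sdiff_add_card_eq_card hsub
  zify at hcard
  rw [hIc] at hcard
  linarith

lemma row_count (a b : ℕ) (m : ℕ) (h : a + b < m) (S : Set ℤ)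
    (hS : ∀ x : ℤ, x ∈ S ↔ (a : ℝ) ≤ x ∧ (x : ℝ) ≤ m - b) :
    (S.ncard : ℚ) = m - a - b + 1 := by
  have : S = ((Finset.Icc (a:ℤ) (m - b) : Finset ℤ) : Set ℤ) := by
    ext x
    rw [hS]
    simp only [Finset.coe_Icc, mem_Icc]
    constructor
    · rintro ⟨u, v⟩; exact ⟨by exact_mod_cast u, by exact_mod_cast v⟩
    · rintro ⟨u, v⟩; exact ⟨by exact_mod_cast u, by exact_mod_cast v⟩
  rw [this, Set.ncard_coe_finset, Int.card_Icc]
  have h2 : (((m:ℤ) - b + 1 - a).toNat : ℤ) = (m:ℤ) - b + 1 - a := by omega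
  have h3 : (((((m:ℤ) - b + 1 - a).toNat : ℤ)) : ℚ) = (((m:ℤ) - b + 1 - a : ℤ) : ℚ) := by rw [h2]
  push_cast at h3
  linarith

/-- For a truncated rectangle `Q` of genus `g`,
`|Q ∩ (ℤ × {0})| + |Q ∩ (ℤ × {d})| = 2g/(d−1) + 4 + Σᵢ Xᵢ`, where
`Xᵢ = (xᵢ(yᵢ − d) − (yᵢ − gcd(xᵢ, yᵢ)))/(d − 1)`. -/
theorem stmt14 (d m x₁ y₁ x₂ y₂ x₃ y₃ x₄ y₄ : ℕ) (hd : 2 ≤ d) (hm : 1 ≤ m)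
    (h1 : x₁ = 0 ↔ y₁ = 0) (h2 : x₂ = 0 ↔ y₂ = 0)
    (h3 : x₃ = 0 ↔ y₃ = 0) (h4 : x₄ = 0 ↔ y₄ = 0)
    (hx12 : x₁ + x₂ < m) (hx34 : x₃ + x₄ < m)
    (hy14 : y₁ + y₄ < d) (hy23 : y₂ + y₃ < d) :
    ({x : ℤ | ((x : ℝ), (0 : ℝ)) ∈ truncRect d m x₁ y₁ x₂ y₂ x₃ y₃ x₄ y₄}.ncard : ℚ) +
        ({x : ℤ | ((x : ℝ), (d : ℝ)) ∈ truncRect d m x₁ y₁ x₂ y₂ x₃ y₃ x₄ y₄}.ncard : ℚ) =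
      2 * (polygonGenus (truncRect d m x₁ y₁ x₂ y₂ x₃ y₃ x₄ y₄) : ℚ) / ((d : ℚ) - 1) + 4 +
        (((x₁ : ℚ) * ((y₁ : ℚ) - (d : ℚ)) - ((y₁ : ℚ) - (Nat.gcd x₁ y₁ : ℚ))) / ((d : ℚ) - 1) +
          ((x₂ : ℚ) * ((y₂ : ℚ) - (d : ℚ)) - ((y₂ : ℚ) - (Nat.gcd x₂ y₂ : ℚ))) / ((d : ℚ) - 1) +
          ((x₃ : ℚ) * ((y₃ : ℚ) - (d : ℚ)) - ((y₃ : ℚ) - (Nat.gcd x₃ y₃ : ℚ))) / ((d : ℚ) - 1) +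
          ((x₄ : ℚ) * ((y₄ : ℚ) - (d : ℚ)) - ((y₄ : ℚ) - (Nat.gcd x₄ y₄ : ℚ))) / ((d : ℚ) - 1)) := by
  have hmem := mem_truncRect d m x₁ y₁ x₂ y₂ x₃ y₃ x₄ y₄ hx12 hx34 hy14 hy23
  have hg := genus_count d m x₁ y₁ x₂ y₂ x₃ y₃ x₄ y₄ hd hm h1 h2 h3 h4 hx12 hx34 hy14 hy23
  have pos : ∀ x y : ℕ, (x = 0 ↔ y = 0) → (x = 0 ∧ y = 0) ∨ ((0:ℝ) < x ∧ (0:ℝ) < y) := by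
    intro x y h
    rcases Nat.eq_zero_or_pos x with h0 | h0
    · exact Or.inl ⟨h0, h.1 h0⟩
    · exact Or.inr ⟨by exact_mod_cast h0, by exact_mod_cast (by omega : 0 < y)⟩
  have cut : ∀ x y : ℕ, (x = 0 ↔ y = 0) → ∀ u : ℝ, 0 ≤ u → (x * y : ℝ) ≤ y * u → (x:ℝ) ≤ u := by
    intro x y h u hu hle
    rcases pos x y h with ⟨rfl, rfl⟩ | ⟨_, hy⟩
    · simpa using hu
    · nlinarith
  have far : ∀ x y : ℕ, y < d → ∀ u : ℝ, 0 ≤ u → (x * y : ℝ) ≤ y * u + x * d := by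
    intro x y hy u hu
    have e1 : (y:ℝ) ≤ d := by exact_mod_cast hy.le
    have e2 : (0:ℝ) ≤ y * u := by positivity
    have e3 : (x * y : ℝ) ≤ x * d := mul_le_mul_of_nonneg_left e1 (Nat.cast_nonneg _)
    linarith
  have cut' : ∀ x y : ℕ, ∀ u : ℝ, (x:ℝ) ≤ u → (x * y : ℝ) ≤ y * u := by
    intro x y u hu
    rw [mul_comm]
    exact mul_le_mul_of_nonneg_left hu (Nat.cast_nonneg _)
  have n : ∀ k : ℕ, (0:ℝ) ≤ k := fun k => Nat.cast_nonneg _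
  have r0 := row_count x₄ x₃ m (by omega)
    {x : ℤ | ((x : ℝ), (0 : ℝ)) ∈ truncRect d m x₁ y₁ x₂ y₂ x₃ y₃ x₄ y₄} (by
      intro x
      rw [mem_ofPred_eq, hmem]
      simp only [cutIneq]
      constructor
      · rintro ⟨⟨a1, a2, a3, a4⟩, a5, a6, a7, a8⟩
        have := cut x₄ y₄ h4 x a1 (by linarith)
        have := cut x₃ y₃ h3 (m - x) (by linarith) (by linarith)
        constructor <;> linarith
      · rintro ⟨u, v⟩
        have b1 : (0:ℝ) ≤ x := by linarith [n x₄]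
        have b2 : (0:ℝ) ≤ m - x := by linarith [n x₃]
        have := far x₁ y₁ (by omega) x b1
        have := far x₂ y₂ (by omega) _ b2
        have := cut' x₄ y₄ x u
        have := cut' x₃ y₃ (m - x) (by linarith)
        refine ⟨⟨?_, ?_, ?_, ?_⟩, ?_, ?_, ?_, ?_⟩ <;> linarith [n d])
  have r1 := row_count x₁ x₂ m (by omega)
    {x : ℤ | ((x : ℝ), (d : ℝ)) ∈ truncRect d m x₁ y₁ x₂ y₂ x₃ y₃ x₄ y₄} (by
      intro x
      rw [mem_ofPred_eq, hmem]
      simp only [cutIneq]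
      constructor
      · rintro ⟨⟨a1, a2, a3, a4⟩, a5, a6, a7, a8⟩
        have := cut x₁ y₁ h1 x a1 (by linarith)
        have := cut x₂ y₂ h2 (m - x) (by linarith) (by linarith)
        constructor <;> linarith
      · rintro ⟨u, v⟩
        have b1 : (0:ℝ) ≤ x := by linarith [n x₁]
        have b2 : (0:ℝ) ≤ m - x := by linarith [n x₂]
        have := far x₄ y₄ (by omega) x b1
        have := far x₃ y₃ (by omega) _ b2
        have := cut' x₁ y₁ x u
        have := cut' x₂ y₂ (m - x) (by linarith)
        refine ⟨⟨?_, ?_, ?_, ?_⟩, ?_, ?_, ?_, ?_⟩ <;> linarith [n d])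
  rw [r0, r1]
  have hg' := congrArg (fun z : ℤ => (z : ℚ)) hg
  push_cast at hg'
  rw [hg']
  have hd' : (d : ℚ) - 1 ≠ 0 := by
    have : (2:ℚ) ≤ d := by exact_mod_cast hd
    linarith
  field_simp
  ring
end
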